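/- arXiv:math/0503649 — 2 statements merged into one kernel-verified Lean document; each statement's English description precedes it below -/
import Mathlib

section
/- For every real constant c > 0 and every integer k > 3 there exists a threshold n₀ = n₀(c, k) such that the following holds. If A is a finite set of real numbers with |A| ≥ n₀ that contains at least c·|A|² three-term arithmetic progressions (i.e., at least c·|A|² pairs (x, d) with d ≠ 0 and x, x+d, x+2d ∈ A), then A contains a k-term arithmetic progression, i.e., there exist x and d ≠ 0 with x + i·d ∈ A for all integers 0 ≤ i ≤ k−1. -/
namespace SzAP

open Finset

/-- Average of a real function over a finite type. -/
noncomputable def avg {X : Type} [Finite X] (f : X → ℝ) : ℝ :=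
  (∑ x ∈ @Finset.univ X (Fintype.ofFinite X), f x) / (Nat.card X : ℝ)

open Classical in
/-- Real valued indicator of a proposition. -/
noncomputable def ind (p : Prop) : ℝ := if p then 1 else 0

lemma ind_nonneg (p : Prop) : 0 ≤ ind p := by unfold ind; split_ifs <;> norm_num
lemma ind_le_one (p : Prop) : ind p ≤ 1 := by unfold ind; split_ifs <;> norm_num
lemma ind_true {p : Prop} (h : p) : ind p = 1 := by simp [ind, h]
lemma ind_false {p : Prop} (h : ¬ p) : ind p = 0 := by simp [ind, h]
lemma ind_mono {p q : Prop} (h : p → q) : ind p ≤ ind q := by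
  by_cases hp : p
  · rw [ind_true hp, ind_true (h hp)]
  · rw [ind_false hp]; exact ind_nonneg _
lemma ind_not (p : Prop) : ind (¬ p) = 1 - ind p := by
  by_cases hp : p <;> simp [ind, hp]

section avg
variable {X Y : Type} [Finite X] [Finite Y]

lemma avg_eq [Fintype X] (f : X → ℝ) : avg f = (∑ x, f x) / (Fintype.card X : ℝ) := by
  unfold avg
  rw [Nat.card_eq_fintype_card]
  congr!

lemma avg_equiv (e : X ≃ Y) (f : Y → ℝ) : avg (fun x => f (e x)) = avg f := by
  classical
  have := Fintype.ofFinite X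
  have := Fintype.ofFinite Y
  rw [avg_eq, avg_eq, Fintype.card_congr e, e.sum_comp f]

lemma avg_prod (f : X × Y → ℝ) : avg f = avg fun x => avg fun y => f (x, y) := by
  classical
  have := Fintype.ofFinite X
  have := Fintype.ofFinite Y
  simp only [avg_eq, Fintype.card_prod, Fintype.sum_prod_type, ← Finset.sum_div]
  push_cast
  rw [div_div, mul_comm]

lemma avg_comm (f : X → Y → ℝ) :
    (avg fun x => avg fun y => f x y) = avg fun y => avg fun x => f x y := by
  have h1 := avg_prod (fun p : X × Y => f p.1 p.2)
  have h2 := avg_prod (fun p : Y × X => f p.2 p.1)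
  rw [← h1, ← h2, ← avg_equiv (Equiv.prodComm X Y)]
  rfl

lemma avg_mono {f g : X → ℝ} (h : ∀ x, f x ≤ g x) : avg f ≤ avg g := by
  have := Fintype.ofFinite X
  rw [avg_eq, avg_eq]
  gcongr
  exact h _

lemma avg_const [Nonempty X] (c : ℝ) : avg (fun _ : X => c) = c := by
  have := Fintype.ofFinite X
  have : (Fintype.card X : ℝ) ≠ 0 := by exact_mod_cast Fintype.card_ne_zero
  rw [avg_eq]
  simp

lemma avg_add (f g : X → ℝ) : avg (fun x => f x + g x) = avg f + avg g := by
  have := Fintype.ofFinite X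
  simp only [avg_eq, Finset.sum_add_distrib, add_div]

lemma avg_sub (f g : X → ℝ) : avg (fun x => f x - g x) = avg f - avg g := by
  have := Fintype.ofFinite X
  simp only [avg_eq, Finset.sum_sub_distrib, sub_div]

lemma avg_const_mul (c : ℝ) (f : X → ℝ) : avg (fun x => c * f x) = c * avg f := by
  have := Fintype.ofFinite X
  simp only [avg_eq, ← Finset.mul_sum, mul_div_assoc]

lemma avg_sum {S : Type} (s : Finset S) (f : S → X → ℝ) :
    avg (fun x => ∑ i ∈ s, f i x) = ∑ i ∈ s, avg (f i) := by
  have := Fintype.ofFinite X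
  simp only [avg_eq]
  rw [Finset.sum_comm, Finset.sum_div]

lemma avg_nonneg {f : X → ℝ} (h : ∀ x, 0 ≤ f x) : 0 ≤ avg f := by
  have := Fintype.ofFinite X
  rw [avg_eq]
  exact div_nonneg (Finset.sum_nonneg fun x _ => h x) (by positivity)

lemma avg_le_const [Nonempty X] {f : X → ℝ} {c : ℝ} (h : ∀ x, f x ≤ c) : avg f ≤ c := by
  rw [← avg_const (X := X) c]; exact avg_mono h

lemma const_le_avg [Nonempty X] {f : X → ℝ} {c : ℝ} (h : ∀ x, c ≤ f x) : c ≤ avg f := by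
  rw [← avg_const (X := X) c]; exact avg_mono h

lemma exists_le_of_le_avg [Nonempty X] {f : X → ℝ} {c : ℝ} (h : c ≤ avg f) : ∃ x, c ≤ f x := by
  have := Fintype.ofFinite X
  by_contra! hc
  have h1 : (Fintype.card X : ℝ) > 0 := by exact_mod_cast Fintype.card_pos
  rw [avg_eq, le_div_iff₀ h1] at h
  have : ∑ x, f x < ∑ x : X, c := Finset.sum_lt_sum_of_nonempty Finset.univ_nonempty fun x _ => hc x
  simp at this
  linarith

lemma avg_lower {f : X → ℝ} {u : ℝ} (h : ∀ x, f x ≤ u) (x₀ : X) :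
    u - Nat.card X * (u - avg f) ≤ f x₀ := by
  have := Fintype.ofFinite X
  have : Nonempty X := ⟨x₀⟩
  have h1 : (Fintype.card X : ℝ) > 0 := by exact_mod_cast Fintype.card_pos
  have h2 : u - f x₀ ≤ ∑ x, (u - f x) :=
    Finset.single_le_sum (f := fun x => u - f x) (fun x _ => sub_nonneg.2 (h x)) (Finset.mem_univ x₀)
  have h3 : (Nat.card X : ℝ) * (u - avg f) = ∑ x, (u - f x) := by
    rw [Nat.card_eq_fintype_card, avg_eq]
    simp
    field_simp
  linarith

lemma avg_split {ι κ B : Type} [Finite ι] [Finite κ] [Finite B] (f : (ι ⊕ κ → B) → ℝ) :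
    avg f = avg fun x : ι → B => avg fun y : κ → B => f (Sum.elim x y) := by
  rw [← avg_prod (fun p : (ι → B) × (κ → B) => f (Sum.elim p.1 p.2)),
    ← avg_equiv (Equiv.sumArrowEquivProdArrow ι κ B).symm]
  rfl

end avg

/-! ### Words, lines and subspaces -/

section words
variable {α β ι η ζ κ : Type}

/-- Evaluation of a (pre-)subspace. -/
def ap (c : α → β) (v : ι → α ⊕ η) (x : η → β) : ι → β := fun i => Sum.elim c x (v i)

/-- Every direction occurs. -/
def Proper (v : ι → α ⊕ η) : Prop := ∀ e, ∃ i, v i = Sum.inr e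

/-- Nondegenerate variable word. -/
def PL (x : ι → Option α) : Prop := ∃ i, x i = none

/-- Evaluation of a variable word. -/
def ev (x : ι → Option α) (a : α) : ι → α := fun i => (x i).getD a

/-- The set contains a combinatorial line. -/
def HasLine (A : Set (ι → α)) : Prop := ∃ x : ι → Option α, PL x ∧ ∀ a, ev x a ∈ A

/-- Density of a set of words. -/
noncomputable def dens {X : Type} [Finite X] (A : Set X) : ℝ := avg fun x => ind (x ∈ A)

/-- The density Hales-Jewett property of an alphabet. -/
def DHJ (α : Type) [Finite α] : Prop :=
  ∀ δ : ℝ, 0 < δ → ∃ n₀ : ℕ, ∀ (ι : Type) [Finite ι], n₀ ≤ Nat.card ι →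
    ∀ A : Set (ι → α), δ ≤ dens A → HasLine A

/-- Composition of subspaces. -/
def comp (v : ι → α ⊕ η) (w : η → α ⊕ ζ) : ι → α ⊕ ζ := fun i => Sum.elim Sum.inl w (v i)

lemma ap_comp (c : α → β) (v : ι → α ⊕ η) (w : η → α ⊕ ζ) (x : ζ → β) :
    ap c (comp v w) x = ap c v (ap c w x) := by
  funext i
  simp only [ap, comp]
  cases v i <;> rfl

lemma Proper.comp {v : ι → α ⊕ η} {w : η → α ⊕ ζ} (hv : Proper v) (hw : Proper w) :
    Proper (comp v w) := by
  intro e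
  obtain ⟨j, hj⟩ := hw e
  obtain ⟨i, hi⟩ := hv j
  exact ⟨i, by simp [SzAP.comp, hi, hj]⟩

lemma ev_ap (v : ι → α ⊕ η) (x : η → Option α) (a : α) :
    ev (ap some v x) a = ap id v (ev x a) := by
  funext i
  simp only [ap, ev]
  cases v i <;> rfl

lemma PL.ap {v : ι → α ⊕ η} {x : η → Option α} (hv : Proper v) (hx : PL x) :
    PL (ap some v x) := by
  obtain ⟨e, he⟩ := hx
  obtain ⟨i, hi⟩ := hv e
  exact ⟨i, by simp [SzAP.ap, hi, he]⟩

lemma ap_injective {v : ι → α ⊕ η} (c : α → β) (hv : Proper v) :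
    Function.Injective (ap c v) := by
  intro x y h
  funext e
  obtain ⟨i, hi⟩ := hv e
  have := congrFun h i
  simpa [ap, hi] using this

lemma HasLine.of_ap {v : ι → α ⊕ η} (hv : Proper v) {A : Set (ι → α)}
    (h : HasLine {x | ap id v x ∈ A}) : HasLine A := by
  obtain ⟨x, hx, h⟩ := h
  refine ⟨ap some v x, hx.ap hv, fun a => ?_⟩
  rw [ev_ap]; exact h a

/-- The subspace induced by a bijection of index sets. -/
def ofEquiv (α : Type) (e : ι ≃ κ) : ι → α ⊕ κ := fun i => Sum.inr (e i)

lemma proper_ofEquiv (e : ι ≃ κ) : Proper (ofEquiv α e) := fun k => ⟨e.symm k, by simp [ofEquiv]⟩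

lemma ap_ofEquiv (c : α → β) (e : ι ≃ κ) (x : κ → β) : ap c (ofEquiv α e) x = fun i => x (e i) := rfl

lemma avg_reindex [Finite ι] [Finite κ] [Finite β] (e : ι ≃ κ) (f : (ι → β) → ℝ) :
    avg (fun x : κ → β => f (fun i => x (e i))) = avg f := by
  rw [← avg_equiv (Equiv.arrowCongr e.symm (Equiv.refl β)) f]
  rfl

lemma exists_split {ι : Type} [Finite ι] {J : Type} [Finite J] {n : ℕ}
    (h : Nat.card J + n ≤ Nat.card ι) :
    ∃ m, n ≤ m ∧ Nonempty (ι ≃ J ⊕ Fin m) := by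
  refine ⟨Nat.card ι - Nat.card J, by omega, ?_⟩
  have := Fintype.ofFinite ι
  have := Fintype.ofFinite J
  simp only [Nat.card_eq_fintype_card] at h ⊢
  exact ⟨Fintype.equivOfCardEq (by simp; omega)⟩

end words

/-! ### Probabilistic and multidimensional versions of DHJ -/

lemma prob_version {Ω T S : Type} [Finite Ω] [Nonempty Ω] [Finite T] [Nonempty T] [Finite S]
    {ε : ℝ} (hε : 0 < ε) (E : T → Set Ω) (Q : S → Set T)
    (hE : ε ≤ avg fun t => dens (E t))
    (hQ : ∀ F : Set T, ε / 2 ≤ dens F → ∃ s, Q s ⊆ F) :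
    ∃ s, ε / (2 * (Nat.card S + 1)) ≤ dens {ω | ∀ t ∈ Q s, ω ∈ E t} := by
  classical
  have := Fintype.ofFinite S
  have key : ∀ ω, (avg fun t => ind (ω ∈ E t)) ≤
      ε / 2 + ∑ s, ind (ω ∈ {ω | ∀ t ∈ Q s, ω ∈ E t}) := by
    intro ω
    by_cases h : ε / 2 ≤ dens {t | ω ∈ E t}
    · obtain ⟨s, hs⟩ := hQ _ h
      have h1 : (avg fun t => ind (ω ∈ E t)) ≤ 1 := avg_le_const fun t => ind_le_one _
      have h2 : ind (ω ∈ {ω | ∀ t ∈ Q s, ω ∈ E t}) = 1 := ind_true fun t ht => hs ht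
      have h3 := Finset.single_le_sum (f := fun s => ind (ω ∈ {ω | ∀ t ∈ Q s, ω ∈ E t}))
        (fun s _ => ind_nonneg _) (Finset.mem_univ s)
      linarith
    · push Not at h
      have h3 : 0 ≤ ∑ s, ind (ω ∈ {ω | ∀ t ∈ Q s, ω ∈ E t}) :=
        Finset.sum_nonneg fun s _ => ind_nonneg _
      unfold dens at h
      simp only [Set.mem_ofPred_eq] at h
      linarith
  have h1 := avg_mono key
  rw [avg_comm, avg_add, avg_const, avg_sum] at h1
  have h2 : ε ≤ avg fun t => avg fun ω => ind (ω ∈ E t) := hE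
  by_contra! hc
  have h3 : ∑ s, (avg fun ω => ind (ω ∈ {ω | ∀ t ∈ Q s, ω ∈ E t})) ≤
      ∑ s : S, ε / (2 * (Nat.card S + 1)) := Finset.sum_le_sum fun s _ => (hc s).le
  rw [Finset.sum_const, Finset.card_univ, ← Nat.card_eq_fintype_card, nsmul_eq_mul] at h3
  have h4 : (Nat.card S : ℝ) * (ε / (2 * (Nat.card S + 1))) < ε / 2 := by
    rw [mul_div_assoc', div_lt_div_iff₀ (by positivity) (by positivity)]
    nlinarith
  linarith

lemma prob_DHJ {α : Type} [Finite α] [Nonempty α] (h : DHJ α) {ε : ℝ} (hε : 0 < ε) :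
    ∃ (m : ℕ) (θ : ℝ), 0 < θ ∧ ∀ (Ω : Type) [Finite Ω] [Nonempty Ω] (E : (Fin m → α) → Set Ω),
      (∀ t, ε ≤ dens (E t)) → ∃ x : Fin m → Option α, PL x ∧ θ ≤ dens {ω | ∀ a, ω ∈ E (ev x a)} := by
  obtain ⟨m, hm⟩ := h (ε / 2) (by positivity)
  refine ⟨m, ε / (2 * (Nat.card {x : Fin m → Option α // PL x} + 1)), by positivity, ?_⟩
  intro Ω _ _ E hE
  obtain ⟨s, hs⟩ := prob_version hε E
    (fun x : {x : Fin m → Option α // PL x} => Set.range (ev x.1)) (const_le_avg hE) (by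
      intro F hF
      obtain ⟨x, hx, h⟩ := hm (Fin m) (by simp) F hF
      exact ⟨⟨x, hx⟩, by rintro _ ⟨a, rfl⟩; exact h a⟩)
  refine ⟨s.1, s.2, ?_⟩
  simpa using hs

/-- Multidimensional density Hales-Jewett property. -/
def MDHJ (α : Type) [Finite α] (η : Type) : Prop :=
  ∀ δ : ℝ, 0 < δ → ∃ n₀ : ℕ, ∀ (ι : Type) [Finite ι], n₀ ≤ Nat.card ι →
    ∀ A : Set (ι → α), δ ≤ dens A → ∃ v : ι → α ⊕ η, Proper v ∧ ∀ x, ap id v x ∈ A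

lemma mdhj {α : Type} [Finite α] [Nonempty α] (h : DHJ α) (η : Type) [Finite η] : MDHJ α η := by
  refine Finite.induction_empty_option (P := fun η => MDHJ α η) ?_ ?_ ?_ η
  · intro η η' e hη δ hδ
    obtain ⟨n, hn⟩ := hη δ hδ
    refine ⟨n, fun ι _ hι A hA => ?_⟩
    obtain ⟨v, hv, h⟩ := hn ι hι A hA
    refine ⟨comp v (ofEquiv α e), hv.comp (proper_ofEquiv e), fun x => ?_⟩
    rw [ap_comp]; exact h _
  · intro δ hδ
    refine ⟨0, fun ι _ hι A hA => ?_⟩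
    obtain ⟨x, hx⟩ : ∃ x, x ∈ A := by
      by_contra! hc
      have : dens A ≤ 0 := avg_le_const fun x => by rw [ind_false (hc x)]
      linarith
    exact ⟨fun i => Sum.inl (x i), fun e => e.elim, fun _ => hx⟩
  · intro η _ hη δ hδ
    obtain ⟨n₁, h₁⟩ := hη (δ / 2) (by positivity)
    set S := {v : Fin n₁ → α ⊕ η // Proper v} with hS
    obtain ⟨n₂, h₂⟩ := h (δ / (2 * (Nat.card S + 1))) (by positivity)
    refine ⟨n₁ + n₂, fun ι _ hι A hA => ?_⟩
    obtain ⟨m, hm, ⟨e⟩⟩ := exists_split (J := Fin n₁) (n := n₂) (by simpa using hι)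
    let A' : Set (Fin n₁ ⊕ Fin m → α) := {x | (fun i => x (e i)) ∈ A}
    have hA' : δ ≤ dens A' := by
      refine hA.trans_eq ?_
      exact (avg_reindex e (fun x => ind (x ∈ A))).symm
    -- find a common subspace
    have key : ∃ v : S, δ / (2 * (Nat.card S + 1)) ≤
        dens {y : Fin m → α | ∀ x, Sum.elim (ap id v.1 x) y ∈ A'} := by
      obtain ⟨v, hv⟩ := prob_version hδ
        (fun x : Fin n₁ → α => {y : Fin m → α | Sum.elim x y ∈ A'})
        (fun v : S => Set.range (ap id v.1)) (by
          refine hA'.trans_eq ?_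
          exact avg_split (fun x => ind (x ∈ A'))) (by
          intro F hF
          obtain ⟨v, hv, hs⟩ := h₁ (Fin n₁) (by simp) _ hF
          exact ⟨⟨v, hv⟩, by rintro _ ⟨a, rfl⟩; exact hs a⟩)
      refine ⟨v, hv.trans_eq ?_⟩
      simp
    obtain ⟨v, hv⟩ := key
    obtain ⟨l, hl, hl'⟩ := h₂ (Fin m) (by simpa using hm) _ hv
    refine ⟨fun i => Sum.elim (fun j => Sum.map id some (v.1 j))
      (fun j => (l j).elim (Sum.inr none) Sum.inl) (e i), ?_, ?_⟩
    · rintro (_ | d)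
      · obtain ⟨j, hj⟩ := hl
        exact ⟨e.symm (Sum.inr j), by simp [hj]⟩
      · obtain ⟨j, hj⟩ := v.2 d
        exact ⟨e.symm (Sum.inl j), by simp [hj]⟩
    · intro x
      have := hl' (x none) (fun d => x (some d))
      simp only [A', Set.mem_ofPred_eq] at this
      convert this using 1
      funext i
      simp only [ap]
      rcases e i with j | j
      · simp only [Sum.elim_inl, ap]
        cases v.1 j <;> rfl
      · simp only [Sum.elim_inr, ev]
        cases l j <;> rfl

end SzAP

namespace SzAP

open Finset

lemma extremal (P : ℕ → ℝ → Prop) (hb : ∀ n v, P n v → v ≤ 1) {δ : ℝ}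
    (h : ∀ n₀, ∃ n ≥ n₀, ∃ v ≥ δ, P n v) :
    ∃ s ≥ δ, (∀ ε > 0, ∃ n₀, ∀ n ≥ n₀, ∀ v, P n v → v ≤ s + ε) ∧
      (∀ ε > 0, ∀ n₀, ∃ n ≥ n₀, ∃ v, s - ε < v ∧ P n v) := by
  set T : Set ℝ := {t | ∀ n₀, ∃ n ≥ n₀, ∃ v ≥ t, P n v} with hT
  have hδ : δ ∈ T := h
  have hbdd : BddAbove T := by
    refine ⟨1, fun t ht => ?_⟩
    obtain ⟨n, -, v, hv, hP⟩ := ht 0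
    exact le_trans hv (hb n v hP)
  refine ⟨sSup T, le_csSup hbdd hδ, fun ε hε => ?_, fun ε hε n₀ => ?_⟩
  · by_contra! hc
    have : sSup T + ε ∈ T := by
      intro n₀
      obtain ⟨n, hn, v, hP, hv⟩ := hc n₀
      exact ⟨n, hn, v, hv.le, hP⟩
    have := le_csSup hbdd this
    linarith
  · obtain ⟨t, ht, ht'⟩ := exists_lt_of_lt_csSup ⟨δ, hδ⟩ (show sSup T - ε < sSup T by linarith)
    obtain ⟨n, hn, v, hv, hP⟩ := ht n₀
    exact ⟨n, hn, v, by linarith [show t ≤ v from hv], hP⟩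

section insens
variable {α : Type} [Finite α] {ι : Type}

/-- Replace the special letter by `a`. -/
def nrm (a : α) (x : ι → Option α) : ι → Option α := fun i => some ((x i).getD a)

/-- Insensitivity to exchanging `a` and the special letter. -/
def Insens (a : α) (D : Set (ι → Option α)) : Prop := ∀ x, x ∈ D ↔ nrm a x ∈ D

lemma Insens.of_nrm_eq {a : α} {D : Set (ι → Option α)} (h : Insens a D) {x y : ι → Option α}
    (hxy : nrm a x = nrm a y) : x ∈ D ↔ y ∈ D := by
  rw [h x, h y, hxy]

lemma Insens.compl {a : α} {D : Set (ι → Option α)} (h : Insens a D) : Insens a {x | x ∉ D} :=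
  fun x => not_congr (h x)

lemma Insens.ap {η : Type} {a : α} {D : Set (ι → Option α)} (h : Insens a D)
    (v : ι → Option α ⊕ η) : Insens a {x | ap id v x ∈ D} := by
  intro x
  refine h.of_nrm_eq ?_
  funext i
  simp only [nrm, SzAP.ap]
  cases v i <;> simp [nrm]

end insens

section chernoff
variable {α : Type} [Finite α] {ι : Type} [Finite ι]

open Classical in
/-- The support of a word. -/
noncomputable def supp [Fintype ι] (x : ι → Option α) : Finset ι := univ.filter fun i => x i ≠ none

lemma chernoff [Nonempty α] [Fintype ι] (N : ℕ) :
    (avg fun x : ι → Option α => ind ((supp x).card < N)) ≤ 2 ^ N * (3 / 4 : ℝ) ^ (Nat.card ι) := by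
  classical
  have := Fintype.ofFinite α
  set w : Option α → ℝ := fun b => if b ≠ none then 1 / 2 else 1 with hw
  have h1 : ∀ x : ι → Option α, ind ((supp x).card < N) ≤ 2 ^ N * ∏ i, w (x i) := by
    intro x
    have h2 : ∏ i, w (x i) = (1 / 2) ^ (supp x).card := by
      simp only [hw, supp]
      rw [Finset.prod_ite]
      simp
    rw [h2]
    by_cases hx : (supp x).card < N
    · rw [ind_true hx, one_div, inv_pow, ← div_eq_mul_inv, le_div_iff₀ (by positivity), one_mul]
      exact pow_le_pow_right₀ (by norm_num) hx.le
    · rw [ind_false hx]; positivity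
  refine (avg_mono h1).trans ?_
  rw [avg_const_mul]
  gcongr
  rw [avg_eq]
  have h3 : ∑ x : ι → Option α, ∏ i, w (x i) = ∏ i : ι, ∑ b, w b := by
    rw [Finset.prod_univ_sum]
    simp
  rw [h3, Finset.prod_const, Fintype.card_fun, Finset.card_univ, Nat.card_eq_fintype_card]
  push_cast
  rw [← div_pow]
  have h4 : ∑ b, w b = 1 + Fintype.card α * (1 / 2) := by
    rw [Fintype.sum_option]
    simp [hw]
  have h5 : (1 : ℝ) ≤ Fintype.card α := by exact_mod_cast Fintype.card_pos
  rw [h4, Fintype.card_option]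
  refine pow_le_pow_left₀ (by positivity) ?_ _
  rw [div_le_div_iff₀ (by positivity) (by positivity)]
  push_cast
  linarith

open Classical in
/-- Extend a word on `S` by the special letter. -/
noncomputable def ext (S : Finset ι) (z : S → α) : ι → Option α :=
  fun i => if h : i ∈ S then some (z ⟨i, h⟩) else none

lemma sum_supp [Nonempty α] [Fintype ι] [Fintype α] [DecidableEq ι] (F : (ι → Option α) → ℝ) :
    ∑ x, F x = ∑ S : Finset ι, ∑ z : S → α, F (ext S z) := by
  classical
  rw [← Finset.sum_fiberwise (s := univ) (g := fun x : ι → Option α => supp x)]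
  refine Finset.sum_congr rfl fun S _ => ?_
  let a₀ : α := Classical.arbitrary α
  refine Finset.sum_nbij' (fun x i => (x i.1).getD a₀) (fun z => ext S z) ?_ ?_ ?_ ?_ ?_
  · intro x _; simp
  · intro z _
    simp only [mem_filter, mem_univ, true_and]
    ext i
    by_cases h : i ∈ S <;> simp [supp, ext, h]
  · intro x hx
    simp only [mem_filter, mem_univ, true_and] at hx
    subst hx
    funext i
    cases h : x i <;> simp [ext, supp, h]
  · intro z _
    funext i
    simp [ext]
  · intro x hx
    congr 1
    simp only [mem_filter, mem_univ, true_and] at hx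
    subst hx
    funext i
    cases h : x i <;> simp [ext, supp, h]

end chernoff

lemma insens_subspace {α : Type} [Finite α] [Nonempty α] (h : DHJ α) (m : ℕ) {ε : ℝ} (hε : 0 < ε) :
    ∃ n₀ : ℕ, ∀ (ι : Type) [Finite ι], n₀ ≤ Nat.card ι → ∀ (a : α) (D : Set (ι → Option α)),
      Insens a D → ε ≤ dens D → ∃ v : ι → Option α ⊕ Fin m, Proper v ∧ ∀ x, ap id v x ∈ D := by
  classical
  obtain ⟨N, hN⟩ := mdhj h (Fin m) (ε / 2) (by positivity)
  obtain ⟨n₀, hn₀⟩ := exists_pow_lt_of_lt_one (show (0 : ℝ) < ε / 2 / 2 ^ N by positivity)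
    (show (3 / 4 : ℝ) < 1 by norm_num)
  refine ⟨n₀, fun ι _ hι a D hD hd => ?_⟩
  have := Fintype.ofFinite ι
  have := Fintype.ofFinite α
  by_cases hS : ∃ S : Finset ι, N ≤ S.card ∧ ε / 2 ≤ dens {z : S → α | ext S z ∈ D}
  · obtain ⟨S, hS, hd⟩ := hS
    obtain ⟨v, hv, hv'⟩ := hN S (by simpa using hS) _ hd
    refine ⟨fun i => if h : i ∈ S then Sum.map some id (v ⟨i, h⟩) else Sum.inl none, ?_, ?_⟩
    · intro e
      obtain ⟨i, hi⟩ := hv e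
      exact ⟨i, by simp [hi]⟩
    · intro x
      refine (hD.of_nrm_eq ?_).1 (hv' (fun e => (x e).getD a))
      funext i
      by_cases hi : i ∈ S
      · simp only [nrm, ap, ext, hi, dif_pos]
        cases v ⟨i, hi⟩ <;> simp
      · simp [nrm, ap, ext, hi]
  · exfalso
    push Not at hS
    have h1 : ∑ x : ι → Option α, ind (x ∈ D) ≤
        ∑ x : ι → Option α, (ε / 2 + ind ((supp x).card < N)) := by
      rw [sum_supp, sum_supp (fun x => ε / 2 + ind ((supp x).card < N))]
      refine Finset.sum_le_sum fun S _ => ?_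
      have hsupp : ∀ z : S → α, supp (ext S z) = S := by
        intro z; ext i
        by_cases h : i ∈ S <;> simp [supp, ext, h]
      simp only [hsupp]
      by_cases hc : N ≤ S.card
      · have := hS S hc
        rw [dens, avg_eq, div_lt_iff₀ (by exact_mod_cast Fintype.card_pos)] at this
        refine (this.le.trans ?_)
        rw [Finset.sum_const, nsmul_eq_mul, Finset.card_univ, mul_comm]
        gcongr
        linarith [ind_nonneg (S.card < N)]
      · refine Finset.sum_le_sum fun z _ => ?_
        rw [ind_true (show S.card < N by omega)]
        linarith [ind_le_one (ext S z ∈ D)]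
    have h2 : dens D ≤ avg fun x : ι → Option α => (ε / 2 + ind ((supp x).card < N)) := by
      rw [dens, avg_eq, avg_eq]
      gcongr
    rw [avg_add, avg_const] at h2
    have h3 := chernoff (α := α) (ι := ι) N
    have h4 : (3 / 4 : ℝ) ^ (Nat.card ι) ≤ (3 / 4 : ℝ) ^ n₀ :=
      pow_le_pow_of_le_one (by norm_num) (by norm_num) hι
    have h5 : 2 ^ N * (3 / 4 : ℝ) ^ (Nat.card ι) < ε / 2 := by
      rw [lt_div_iff₀ (by positivity)] at hn₀
      nlinarith [show (0:ℝ) < 2 ^ N by positivity]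
    linarith

/-- Nonpositive averages on all `m`-dimensional subspaces. -/
def Nonpos {β ι : Type} [Finite β] (m : ℕ) (f : (ι → β) → ℝ) : Prop :=
  ∀ v : ι → β ⊕ Fin m, Proper v → (avg fun x : Fin m → β => f (ap id v x)) ≤ 0

lemma avg_range {X Y : Type} [Finite X] [Finite Y] [Nonempty X] (g : X → Y)
    (hg : Function.Injective g) (f : Y → ℝ) :
    (avg fun y => ind (y ∈ Set.range g) * f y) =
      ((Nat.card X : ℝ) / Nat.card Y) * avg fun x => f (g x) := by
  classical
  have := Fintype.ofFinite X
  have := Fintype.ofFinite Y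
  have hX : (Fintype.card X : ℝ) ≠ 0 := by exact_mod_cast Fintype.card_ne_zero
  have : Nonempty Y := ⟨g (Classical.arbitrary X)⟩
  have hY : (Fintype.card Y : ℝ) ≠ 0 := by exact_mod_cast Fintype.card_ne_zero
  rw [avg_eq, avg_eq, Nat.card_eq_fintype_card, Nat.card_eq_fintype_card]
  have : ∑ y, ind (y ∈ Set.range g) * f y = ∑ x, f (g x) := by
    rw [← Finset.sum_image (s := univ) (f := f) (g := g) (fun a _ b _ h => hg h)]
    rw [← Finset.sum_subset (Finset.subset_univ (univ.image g))]
    · refine Finset.sum_congr rfl fun y hy => ?_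
      rw [ind_true (by simpa using hy), one_mul]
    · intro y _ hy
      rw [ind_false (by simpa using hy), zero_mul]
  rw [this]
  field_simp

/-- The admissible configurations for the extremal problem in `claim1`. -/
def Conf (α : Type) [Finite α] (m : ℕ) (μ : ℝ) (n : ℕ) (v : ℝ) : Prop :=
  ∃ (ι : Type) (_ : Finite ι) (a : α) (D : Set (ι → Option α)) (f : (ι → Option α) → ℝ),
    Nat.card ι = n ∧ Insens a D ∧ (∀ x, f x ≤ 1) ∧ Nonpos m f ∧
      v = avg fun x => ind (x ∈ D) * (f x - μ)

lemma claim1 {α : Type} [Finite α] [Nonempty α] (h : DHJ α) (m : ℕ) {l : ℝ} (hl : 0 < l) :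
    ∃ n₀ : ℕ, ∀ (ι : Type) [Finite ι], n₀ ≤ Nat.card ι → ∀ (a : α) (D : Set (ι → Option α))
      (f : (ι → Option α) → ℝ), Insens a D → (∀ x, f x ≤ 1) → Nonpos m f →
      (avg fun x => ind (x ∈ D) * f x) ≤ l := by
  classical
  by_contra! hcon
  set μ := l / 2 with hμ
  have hμ0 : 0 < μ := by positivity
  obtain ⟨s, hs, hup, hlow⟩ := extremal (Conf α m μ) (δ := μ) (by
      rintro n v ⟨ι, _, a, D, f, -, -, hf, -, rfl⟩
      refine avg_le_const fun x => ?_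
      have := ind_nonneg (x ∈ D)
      have := ind_le_one (x ∈ D)
      nlinarith [hf x]) (by
      intro n₀
      obtain ⟨ι, hfin, hι, a, D, f, hD, hf, hnp, hlt⟩ := hcon n₀
      refine ⟨Nat.card ι, hι, _, ?_, ι, hfin, a, D, f, rfl, hD, hf, hnp, rfl⟩
      have h1 : (avg fun x => ind (x ∈ D) * (f x - μ)) =
          (avg fun x => ind (x ∈ D) * f x) - μ * avg fun x => ind (x ∈ D) := by
        rw [← avg_const_mul, ← avg_sub]
        congr 1; funext x; ring
      have h2 : (avg fun x => ind (x ∈ D)) ≤ 1 := avg_le_const fun x => ind_le_one _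
      rw [h1]
      nlinarith)
  have hs0 : 0 < s := lt_of_lt_of_le hμ0 hs
  obtain ⟨m₁, hm₁⟩ := insens_subspace h m (show 0 < s / 2 by positivity)
  set c₀ : ℝ := (Nat.card (Fin m → Option α) : ℝ) / Nat.card (Fin m₁ → Option α) with hc₀
  have hc₀pos : 0 < c₀ := by
    have h1 : (0:ℝ) < Nat.card (Fin m → Option α) := by exact_mod_cast Nat.card_pos
    have h2 : (0:ℝ) < Nat.card (Fin m₁ → Option α) := by exact_mod_cast Nat.card_pos
    positivity
  set ρ := min (s / 4) (μ * c₀ * s / 16) with hρ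
  have hρ0 : 0 < ρ := by positivity
  have hρ1 : ρ ≤ s / 4 := min_le_left _ _
  have hρ2 : ρ ≤ μ * c₀ * s / 16 := min_le_right _ _
  obtain ⟨n₀, hn₀⟩ := hup ρ hρ0
  obtain ⟨n, hn, v, hv, ι, hfin, a, D, f, hcard, hD, hf, hnp, hveq⟩ := hlow ρ hρ0 (m₁ + n₀)
  obtain ⟨n', hn', ⟨e⟩⟩ := exists_split (ι := ι) (J := Fin m₁) (n := n₀) (by simp; omega)
  -- combined word
  set F : (Fin m₁ → Option α) → (Fin n' → Option α) → (ι → Option α) :=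
    fun u y i => Sum.elim u y (e i) with hF
  have hsplit : ∀ g : (ι → Option α) → ℝ, avg g = avg fun u => avg fun y => g (F u y) := by
    intro g
    rw [← avg_reindex e g, avg_split]
  set Dy : (Fin n' → Option α) → Set (Fin m₁ → Option α) := fun y => {u | F u y ∈ D} with hDy
  have hDyI : ∀ y, Insens a (Dy y) := by
    intro y u
    refine hD.of_nrm_eq ?_
    funext i
    simp only [nrm, hF]
    cases e i <;> simp [nrm]
  have hDyN : ∀ y, Dy (nrm a y) = Dy y := by
    intro y
    ext u
    refine hD.of_nrm_eq ?_
    funext i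
    simp only [nrm, hF]
    cases e i <;> simp [nrm]
  have hV : ∃ V : Set (Fin m₁ → Option α) → Set (Fin m₁ → Option α), ∀ E,
      (V E = ∅ ∧ ¬ (Insens a E ∧ s / 2 ≤ dens E)) ∨
      ∃ v : Fin m₁ → Option α ⊕ Fin m, Proper v ∧ (∀ x, ap id v x ∈ E) ∧
        V E = Set.range (ap id v) := by
    have : ∀ E : Set (Fin m₁ → Option α), ∃ W : Set (Fin m₁ → Option α),
      (W = ∅ ∧ ¬ (Insens a E ∧ s / 2 ≤ dens E)) ∨
      ∃ v : Fin m₁ → Option α ⊕ Fin m, Proper v ∧ (∀ x, ap id v x ∈ E) ∧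
        W = Set.range (ap id v) := by
      intro E
      by_cases hE : Insens a E ∧ s / 2 ≤ dens E
      · obtain ⟨v, hv, hv'⟩ := hm₁ (Fin m₁) (by simp) a E hE.1 hE.2
        exact ⟨_, Or.inr ⟨v, hv, hv', rfl⟩⟩
      · exact ⟨∅, Or.inl ⟨rfl, hE⟩⟩
    choose V hV using this
    exact ⟨V, hV⟩
  obtain ⟨V, hV⟩ := hV
  -- each section is admissible
  have hsec : ∀ u, (avg fun y => ind (F u y ∈ D ∧ u ∉ V (Dy y)) * (f (F u y) - μ)) ≤ s + ρ := by
    intro u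
    refine hn₀ n' hn' _ ⟨Fin n', inferInstance, a, {y | F u y ∈ D ∧ u ∉ V (Dy y)},
      fun y => f (F u y), by simp, ?_, fun y => hf _, ?_, rfl⟩
    · intro y
      have h1 : F u y ∈ D ↔ F u (nrm a y) ∈ D := by
        have := hDyN y
        have h2 : u ∈ Dy y ↔ u ∈ Dy (nrm a y) := by rw [this]
        exact h2
      show (F u y ∈ D ∧ u ∉ V (Dy y)) ↔ (F u (nrm a y) ∈ D ∧ u ∉ V (Dy (nrm a y)))
      rw [hDyN, h1]
    · intro w hw
      have := hnp (fun i => Sum.elim (fun j => Sum.inl (u j)) w (e i)) (by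
        intro d
        obtain ⟨j, hj⟩ := hw d
        exact ⟨e.symm (Sum.inr j), by simp [hj]⟩)
      refine le_of_eq_of_le ?_ this
      congr 1; funext x
      show f _ = f _
      congr 1; funext i
      simp only [hF, ap]
      cases e i <;> rfl
  have havg : (avg fun u => avg fun y => ind (F u y ∈ D ∧ u ∉ V (Dy y)) * (f (F u y) - μ)) ≤ s + ρ :=
    avg_le_const hsec
  rw [avg_comm] at havg
  have hpt : ∀ y, (avg fun u => ind (F u y ∈ D) * (f (F u y) - μ)) +
      μ * c₀ * (dens (Dy y) - s / 2) ≤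
      avg fun u => ind (F u y ∈ D ∧ u ∉ V (Dy y)) * (f (F u y) - μ) := by
    intro y
    have hd1 : dens (Dy y) ≤ 1 := avg_le_const fun x => ind_le_one _
    rcases hV (Dy y) with ⟨hE, hbad⟩ | ⟨v, hvp, hv', hE⟩
    · have : dens (Dy y) < s / 2 := by
        by_contra hc
        exact hbad ⟨hDyI y, not_lt.1 hc⟩
      simp only [hE, Set.mem_empty_iff_false, not_false_eq_true, and_true]
      nlinarith [mul_pos hμ0 hc₀pos]
    · have h1 : (avg fun u => ind (F u y ∈ D ∧ u ∉ V (Dy y)) * (f (F u y) - μ)) =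
          (avg fun u => ind (F u y ∈ D) * (f (F u y) - μ)) -
          avg fun u => ind (u ∈ Set.range (ap id v)) * (f (F u y) - μ) := by
        rw [← avg_sub]
        congr 1; funext u
        rw [hE]
        by_cases hu : u ∈ Set.range (ap id v)
        · have : F u y ∈ D := by
            obtain ⟨x, rfl⟩ := hu
            exact hv' x
          rw [ind_true hu, ind_true this, ind_false (by tauto)]; ring
        · rw [ind_false hu]
          by_cases hD : F u y ∈ D
          · rw [ind_true hD, ind_true ⟨hD, hu⟩]; ring
          · rw [ind_false hD, ind_false (by tauto)]; ring
      have h2 : (avg fun u => ind (u ∈ Set.range (ap id v)) * (f (F u y) - μ)) ≤ - (c₀ * μ) := by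
        rw [avg_range _ (ap_injective id hvp) (fun u => f (F u y) - μ), avg_sub, avg_const, ← hc₀]
        have h3 : (avg fun x => f (F (ap id v x) y)) ≤ 0 := by
          have := hnp (fun i => Sum.elim v (fun j => Sum.inl (y j)) (e i)) (by
            intro d
            obtain ⟨j, hj⟩ := hvp d
            exact ⟨e.symm (Sum.inl j), by simp [hj]⟩)
          refine le_of_eq_of_le ?_ this
          congr 1; funext x; congr 1; funext i
          simp only [hF, ap]
          cases e i <;> rfl
        nlinarith
      rw [h1]
      nlinarith [mul_pos hμ0 hc₀pos]
  have h6 := (avg_mono hpt).trans havg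
  rw [avg_add, avg_const_mul, avg_sub, avg_const, avg_comm,
    ← hsplit (fun x => ind (x ∈ D) * (f x - μ)), ← hveq] at h6
  have h7 : (avg fun y => dens (Dy y)) = dens D := by
    rw [dens, hsplit, avg_comm]; rfl
  have h8 : v ≤ dens D := by
    rw [hveq]
    refine avg_mono fun x => ?_
    have := ind_nonneg (x ∈ D)
    nlinarith [hf x]
  rw [h7] at h6
  nlinarith [mul_pos hμ0 hc₀pos]

lemma claimC {α : Type} [Finite α] [Nonempty α] (h : DHJ α) (s : Finset α) :
    ∀ (m : ℕ) {l : ℝ} (_ : 0 < l),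
    ∃ n₀ : ℕ, ∀ (ι : Type) [Finite ι], n₀ ≤ Nat.card ι → ∀ (D : α → Set (ι → Option α))
      (f : (ι → Option α) → ℝ), (∀ a, Insens a (D a)) → (∀ x, f x ≤ 1) → Nonpos m f →
      (avg fun x => ind (¬ ∀ a ∈ s, x ∈ D a) * f x) ≤ l := by
  classical
  induction s using Finset.induction_on with
  | empty =>
    intro m l hl
    refine ⟨0, fun ι _ _ D f _ _ _ => ?_⟩
    refine avg_le_const fun x => ?_
    rw [ind_false (by simp)]; linarith
  | insert a s has ih =>
    intro m l hl
    obtain ⟨n₁, h₁⟩ := ih m (show 0 < l / 4 by positivity)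
    obtain ⟨n₂, h₂⟩ := claim1 h n₁ (show 0 < l / 4 by positivity)
    obtain ⟨n₃, h₃⟩ := claim1 h m (show 0 < l / 2 by positivity)
    refine ⟨max n₂ n₃, fun ι _ hι D f hD hf hnp => ?_⟩
    have e1 := h₃ ι (le_trans (le_max_right _ _) hι) a _ f (hD a).compl hf hnp
    set f' : (ι → Option α) → ℝ := fun x => ind (¬ ∀ a ∈ s, x ∈ D a) * f x - l / 4 with hf'
    have e2 := h₂ ι (le_trans (le_max_left _ _) hι) a _ f' (hD a) (by
      intro x
      have := ind_nonneg (¬ ∀ a ∈ s, x ∈ D a)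
      have := ind_le_one (¬ ∀ a ∈ s, x ∈ D a)
      simp only [hf']
      nlinarith [hf x]) (by
      intro v hv
      simp only [hf']
      rw [avg_sub, avg_const]
      have := h₁ (Fin n₁) (by simp) (fun a => {x | ap id v x ∈ D a}) (fun x => f (ap id v x))
        (fun a => (hD a).ap v) (fun x => hf _) (by
          intro w hw
          have := hnp (comp v w) (hv.comp hw)
          simpa only [ap_comp] using this)
      simp only [Set.mem_ofPred_eq] at this
      linarith)
    have e3 : (avg fun x => ind (¬ ∀ b ∈ insert a s, x ∈ D b) * f x) =
        (avg fun x => ind (x ∈ {x | x ∉ D a}) * f x) +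
        (avg fun x => ind (x ∈ D a) * f' x) + l / 4 * avg fun x => ind (x ∈ D a) := by
      rw [← avg_const_mul, ← avg_add, ← avg_add]
      congr 1; funext x
      simp only [Set.mem_ofPred_eq, hf']
      by_cases hx : x ∈ D a
      · rw [ind_true hx, ind_false (show ¬ x ∉ D a by simpa using hx)]
        have : (¬ ∀ b ∈ insert a s, x ∈ D b) ↔ (¬ ∀ b ∈ s, x ∈ D b) := by simp [hx]
        rw [this]; ring
      · rw [ind_false hx, ind_true hx, ind_true (show ¬ ∀ b ∈ insert a s, x ∈ D b by simp [hx])]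
        ring
    have e4 : (avg fun x => ind (x ∈ D a)) ≤ 1 := avg_le_const fun x => ind_le_one _
    rw [e3]
    nlinarith

end SzAP

namespace SzAP

/-- Turn a word with letters in `Option α` and directions `η` into one where the special
letter is a direction. -/
def unsp {α η ζ : Type} (o : ζ) (f : η → ζ) : Option α ⊕ η → α ⊕ ζ
  | Sum.inl (some a) => Sum.inl a
  | Sum.inl none => Sum.inr o
  | Sum.inr e => Sum.inr (f e)

lemma unsp_eval {α η ζ : Type} (o : ζ) (f : η → ζ) (b : Option α ⊕ η) (x : ζ → Option α)
    (hx : x o = none) : Sum.elim some x (unsp o f b) = Sum.elim id (fun e => x (f e)) b := by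
  rcases b with (_ | a) | e <;> simp [unsp, hx]

lemma lemmaG_aux (α : Type) [Finite α] (s : ℕ) : ∀ (η : Type) [Finite η],
    ∃ (ι : Type) (_ : Finite ι), ∀ good : Set (ι → Option α),
      (∃ V : ι → α ⊕ Option η, Proper V ∧ ∀ x, x none = none → ap some V x ∈ good) ∨
      (∃ U : ι → α ⊕ (Fin s ⊕ η), Proper U ∧
        ∀ x, (∃ i, x (Sum.inl i) = none) → ap some U x ∉ good) := by
  induction s with
  | zero =>
    intro η hη
    refine ⟨η, hη, fun good => Or.inr ⟨fun i => Sum.inr (Sum.inr i), ?_, ?_⟩⟩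
    · rintro (i | e)
      · exact i.elim0
      · exact ⟨e, rfl⟩
    · rintro x ⟨i, -⟩
      exact i.elim0
  | succ s ih =>
    intro η hη
    obtain ⟨κ, _, hκ⟩ := Combinatorics.Subspace.exists_mono_in_high_dimension
      (Option α) (Set (Fin s → α)) η
    have : Finite κ := inferInstance
    obtain ⟨ι, hι, h⟩ := ih (Option κ)
    refine ⟨ι, hι, fun good => ?_⟩
    rcases h good with ⟨V, hV, hVg⟩ | ⟨U, hU, hUg⟩
    · left
      obtain ⟨l, -⟩ := hκ (fun _ => ∅)
      refine ⟨comp V (fun o => o.elim (Sum.inr none) fun o => o.elim (Sum.inr none)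
        fun k => unsp none some (l.idxFun k)), hV.comp ?_, fun x hx => ?_⟩
      · rintro (_ | e)
        · exact ⟨none, rfl⟩
        · obtain ⟨k, hk⟩ := l.proper e
          exact ⟨some (some k), by simp [hk, unsp]⟩
      · rw [ap_comp]
        exact hVg _ (by simp [ap, hx])
    · let W : (Fin s → α) → (κ → Option α) → (Fin s ⊕ Option κ → Option α) := fun p z =>
        Sum.elim (fun i => some (p i)) (fun o => o.elim none z)
      obtain ⟨l, c, hc⟩ := hκ (fun z => {p | ap some U (W p z) ∈ good})
      by_cases hp : ∃ p, p ∈ c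
      · left
        obtain ⟨p, hp⟩ := hp
        refine ⟨comp U (Sum.elim (fun i => Sum.inl (p i)) (fun o => o.elim (Sum.inr none)
          fun k => unsp none some (l.idxFun k))), hU.comp ?_, fun x hx => ?_⟩
        · rintro (_ | e)
          · exact ⟨Sum.inr none, rfl⟩
          · obtain ⟨k, hk⟩ := l.proper e
            exact ⟨Sum.inr (some k), by simp [hk, unsp]⟩
        · rw [ap_comp]
          rw [← hc (fun e => x (some e))] at hp
          have hp' : ap some U (W p (l fun e => x (some e))) ∈ good := hp
          convert hp' using 2
          funext j
          rcases j with i | _ | k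
          · rfl
          · simp [ap, W, hx]
          · simp only [ap, W, Sum.elim_inr, Option.elim_some]
            rw [unsp_eval _ _ _ _ hx]; rfl
      · right
        refine ⟨comp U (Sum.elim (fun i => Sum.inr (Sum.inl i.castSucc)) (fun o =>
          o.elim (Sum.inr (Sum.inl (Fin.last s)))
          fun k => unsp (Sum.inl (Fin.last s)) Sum.inr (l.idxFun k))), hU.comp ?_, fun x hx => ?_⟩
        · rintro (i | e)
          · induction i using Fin.lastCases with
            | last => exact ⟨Sum.inr none, rfl⟩
            | cast i => exact ⟨Sum.inl i, rfl⟩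
          · obtain ⟨k, hk⟩ := l.proper e
            exact ⟨Sum.inr (some k), by simp [hk, unsp]⟩
        · rw [ap_comp]
          by_cases hx' : ∃ i : Fin s, x (Sum.inl i.castSucc) = none
          · obtain ⟨i, hi⟩ := hx'
            exact hUg _ ⟨i, by simp [ap, hi]⟩
          · push Not at hx'
            have hlast : x (Sum.inl (Fin.last s)) = none := by
              obtain ⟨i, hi⟩ := hx
              induction i using Fin.lastCases with
              | last => exact hi
              | cast i => exact absurd hi (hx' i)
            have : ∀ i : Fin s, ∃ a, x (Sum.inl i.castSucc) = some a := fun i =>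
              Option.ne_none_iff_exists'.1 (hx' i)
            choose p hp' using this
            intro hg
            apply hp
            refine ⟨p, ?_⟩
            rw [← hc (fun e => x (Sum.inr e))]
            show ap some U (W p (l fun e => x (Sum.inr e))) ∈ good
            convert hg using 2
            funext j
            rcases j with i | _ | k
            · simp [ap, W, hp']
            · simp [ap, W, hlast]
            · simp only [ap, W, Sum.elim_inr, Option.elim_some]
              rw [unsp_eval _ _ _ _ hlast]; rfl

lemma lemmaG (α : Type) [Finite α] [Nonempty α] (m : ℕ) (η : Type) [Finite η] :
    ∃ (ι : Type) (_ : Finite ι), ∀ good : Set (ι → Option α),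
      (∀ w : ι → α ⊕ Fin m, Proper w → ∃ x, PL x ∧ ap some w x ∈ good) →
      ∃ V : ι → α ⊕ Option η, Proper V ∧ ∀ x, x none = none → ap some V x ∈ good := by
  obtain ⟨ι, hι, h⟩ := lemmaG_aux α m η
  refine ⟨ι, hι, fun good hg => ?_⟩
  rcases h good with h | ⟨U, hU, hUg⟩
  · exact h
  · exfalso
    obtain ⟨x, ⟨i, hi⟩, hx⟩ := hg (comp U (Sum.elim Sum.inr
      (fun _ => Sum.inl (Classical.arbitrary α)))) (hU.comp fun e => ⟨Sum.inl e, rfl⟩)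
    rw [ap_comp] at hx
    exact hUg _ ⟨i, by simp [ap, hi]⟩ hx

end SzAP

namespace SzAP

/-- Line-free densities. -/
def LF (β : Type) [Finite β] (n : ℕ) (v : ℝ) : Prop :=
  ∃ (ι : Type) (_ : Finite ι) (A : Set (ι → β)), Nat.card ι = n ∧ ¬ HasLine A ∧ v = dens A

lemma dens_le_one {X : Type} [Finite X] [Nonempty X] (A : Set X) : dens A ≤ 1 :=
  avg_le_const fun _ => ind_le_one _

lemma dhj_step {α : Type} [Finite α] [Nonempty α] (h : DHJ α) : DHJ (Option α) := by
  classical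
  have := Fintype.ofFinite α
  intro δ hδ
  by_contra! hcon
  obtain ⟨s, hs, hup, hlow⟩ := extremal (LF (Option α)) (δ := δ) (by
      rintro n v ⟨ι, _, A, -, -, rfl⟩
      exact dens_le_one A) (by
      intro n₀
      obtain ⟨ι, hfin, hι, A, hA, hl⟩ := hcon n₀
      exact ⟨_, hι, _, hA, ι, hfin, A, rfl, hl, rfl⟩)
  have hs0 : 0 < s := lt_of_lt_of_le hδ hs
  obtain ⟨m₀, θ, hθ, hprob⟩ := prob_DHJ h (show 0 < s / 2 by positivity)
  set g := s * θ / 4 with hg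
  have hg0 : 0 < g := by positivity
  obtain ⟨m, hm⟩ := hup g hg0
  obtain ⟨M, hM⟩ := claimC h Finset.univ m hg0
  obtain ⟨ι₁, hι₁, hG⟩ := lemmaG α m₀ (Fin M)
  set K : ℝ := (Nat.card (ι₁ → Option α) : ℝ) with hK
  have hK0 : 0 < K := by
    have : 0 < Nat.card (ι₁ → Option α) := Nat.card_pos
    rw [hK]; exact_mod_cast this
  set ρ := min (s / 2) g / (2 * K) with hρ
  have hρ0 : 0 < ρ := by positivity
  obtain ⟨n₁, hn₁⟩ := hup ρ hρ0
  obtain ⟨n, hn, v, hv, ι, hfin, A, hcard, hA, rfl⟩ := hlow ρ hρ0 (Nat.card ι₁ + n₁)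
  obtain ⟨m', hm', ⟨e⟩⟩ := exists_split (ι := ι) (J := ι₁) (n := n₁) (by omega)
  set F : (ι₁ → Option α) → (Fin m' → Option α) → (ι → Option α) :=
    fun u y i => Sum.elim u y (e i) with hF
  have hsplit : dens A = avg fun u => dens {y | F u y ∈ A} := by
    rw [dens, ← avg_reindex e (fun x => ind (x ∈ A)), avg_split]; rfl
  have hsecle : ∀ t, dens {y | F t y ∈ A} ≤ s + ρ := by
    intro t
    refine hn₁ m' hm' _ ⟨Fin m', inferInstance, _, by simp, ?_, rfl⟩
    intro hl
    apply hA
    have hw : Proper (fun i => Sum.elim (fun j => Sum.inl (t j)) Sum.inr (e i) :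
        ι → Option α ⊕ Fin m') := fun d => ⟨e.symm (Sum.inr d), by simp⟩
    refine HasLine.of_ap hw ?_
    convert hl using 3
    rename_i y
    have : ap id (fun i => Sum.elim (fun j => Sum.inl (t j)) Sum.inr (e i) :
        ι → Option α ⊕ Fin m') y = F t y := by
      funext i
      simp only [ap, hF]
      cases e i <;> rfl
    rw [this]
  have hsec : ∀ t, s - min (s / 2) g ≤ dens {y | F t y ∈ A} := by
    intro t
    have h1 := avg_lower hsecle t
    rw [← hsplit, ← hK] at h1
    have h2 : K * ρ * 2 = min (s / 2) g := by rw [hρ]; field_simp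
    nlinarith
  have hsec1 : ∀ t, s / 2 ≤ dens {y | F t y ∈ A} := fun t =>
    le_trans (by linarith [min_le_left (s / 2) g]) (hsec t)
  have hsec2 : ∀ t, s - g ≤ dens {y | F t y ∈ A} := fun t =>
    le_trans (by linarith [min_le_right (s / 2) g]) (hsec t)
  obtain ⟨V, hV, hVg⟩ := hG {x | θ ≤ dens {y | ∀ a, F (fun j => some (ev x a j)) y ∈ A}} (by
    intro w hw
    obtain ⟨x, hx, hd⟩ := hprob (Fin m' → Option α)
      (fun t => {y | F (fun j => some (ap id w t j)) y ∈ A}) (fun t => hsec1 _)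
    refine ⟨x, hx, ?_⟩
    show θ ≤ _
    simp only [ev_ap]
    exact hd)
  set Z : (Fin M → Option α) → (ι₁ → Option α) :=
    fun z => ap some V (fun o => o.elim none z) with hZ
  have hZgood : ∀ z, θ ≤ dens {y | ∀ a, F (fun j => some (ev (Z z) a j)) y ∈ A} :=
    fun z => hVg _ rfl
  have hZPL : ∀ z, PL (Z z) := fun z => PL.ap hV ⟨none, rfl⟩
  have hfree : ∀ z y, F (Z z) y ∈ A → ¬ ∀ a, F (fun j => some (ev (Z z) a j)) y ∈ A := by
    intro z y h1 h2
    apply hA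
    refine ⟨fun i => Sum.elim (fun j => (Z z j).map some) (fun j => some (y j)) (e i), ?_, ?_⟩
    · obtain ⟨j, hj⟩ := hZPL z
      exact ⟨e.symm (Sum.inl j), by simp [hj]⟩
    · rintro (_ | a)
      · convert h1 using 1
        funext i
        simp only [ev, hF]
        rcases e i with j | j
        · simp only [Sum.elim_inl]
          cases Z z j <;> rfl
        · rfl
      · convert h2 a using 1
        funext i
        simp only [ev, hF]
        rcases e i with j | j
        · simp only [Sum.elim_inl]
          cases Z z j <;> rfl
        · rfl
  have hy : ∀ y, dens {z | F (Z z) y ∈ A} - (s + g) * (1 -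
      dens {z | ∀ a, F (fun j => some (ev (Z z) a j)) y ∈ A}) ≤ g := by
    intro y
    have h1 := hM (Fin M) (by simp) (fun a => {z | F (fun j => some (ev (Z z) a j)) y ∈ A})
      (fun z => ind (F (Z z) y ∈ A) - (s + g)) (by
        intro a z
        have : ev (Z z) a = ev (Z (nrm a z)) a := by
          simp only [hZ]
          rw [ev_ap, ev_ap]
          congr 1
          funext o
          cases o <;> simp [ev, nrm]
        show F _ y ∈ A ↔ F _ y ∈ A
        rw [this]) (by
        intro z
        linarith [ind_le_one (F (Z z) y ∈ A)]) (by
        intro w hw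
        rw [avg_sub, avg_const]
        have hu : Proper (fun i => Sum.elim (fun j => Sum.elim (fun a => Sum.inl (some a))
            (fun o => o.elim (Sum.inl none) Sum.inr) (V j)) (fun j => Sum.inl (y j)) (e i) :
            ι → Option α ⊕ Fin M) := by
          intro d
          obtain ⟨j, hj⟩ := hV (some d)
          exact ⟨e.symm (Sum.inl j), by simp [hj]⟩
        have hueq : ∀ z, ap id (fun i => Sum.elim (fun j => Sum.elim (fun a => Sum.inl (some a))
            (fun o => o.elim (Sum.inl none) Sum.inr) (V j)) (fun j => Sum.inl (y j)) (e i) :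
            ι → Option α ⊕ Fin M) z = F (Z z) y := by
          intro z
          funext i
          simp only [ap, hF, hZ]
          rcases e i with j | j
          · simp only [Sum.elim_inl, ap]
            rcases V j with a | _ | d <;> rfl
          · rfl
        have := hm m le_rfl (dens {x | F (Z (ap id w x)) y ∈ A}) ⟨Fin m, inferInstance, _,
          by simp, (by
            intro hl
            apply hA
            refine HasLine.of_ap hu ?_
            simp only [hueq]
            exact HasLine.of_ap hw hl), rfl⟩
        have h2 : dens {x | F (Z (ap id w x)) y ∈ A} =
          avg fun x => ind (F (Z (ap id w x)) y ∈ A) := rfl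
        linarith)
    refine le_trans ?_ h1
    have h3 : dens {z | F (Z z) y ∈ A} - (s + g) * (1 -
      dens {z | ∀ a, F (fun j => some (ev (Z z) a j)) y ∈ A}) = avg fun z =>
        (ind (F (Z z) y ∈ A) - (s + g) * (1 -
          ind (∀ a, F (fun j => some (ev (Z z) a j)) y ∈ A))) := by
      rw [avg_sub, avg_const_mul, avg_sub, avg_const]; rfl
    rw [h3]
    refine avg_mono fun z => ?_
    simp only [Set.mem_ofPred_eq, Finset.mem_univ, true_imp_iff]
    by_cases hD : ∀ a, F (fun j => some (ev (Z z) a j)) y ∈ A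
    · have h4 : ¬ F (Z z) y ∈ A := fun h5 => hfree z y h5 hD
      rw [ind_true hD, ind_false h4, ind_false (not_not.2 hD)]; linarith
    · rw [ind_false hD, ind_true hD]; linarith
  have havg : (avg fun y => dens {z | F (Z z) y ∈ A}) - (s + g) * (1 -
      avg fun y => dens {z | ∀ a, F (fun j => some (ev (Z z) a j)) y ∈ A}) ≤ g := by
    have := avg_le_const hy
    rwa [avg_sub, avg_const_mul, avg_sub, avg_const] at this
  have e1 : s - g ≤ avg fun y => dens {z | F (Z z) y ∈ A} := by
    have : (avg fun y => dens {z | F (Z z) y ∈ A}) = avg fun z => dens {y | F (Z z) y ∈ A} :=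
      avg_comm _
    rw [this]
    exact const_le_avg fun z => hsec2 _
  have e2 : θ ≤ avg fun y => dens {z | ∀ a, F (fun j => some (ev (Z z) a j)) y ∈ A} := by
    have : (avg fun y => dens {z | ∀ a, F (fun j => some (ev (Z z) a j)) y ∈ A}) =
      avg fun z => dens {y | ∀ a, F (fun j => some (ev (Z z) a j)) y ∈ A} :=
      avg_comm _
    rw [this]
    exact const_le_avg fun z => hZgood _
  nlinarith [mul_le_mul_of_nonneg_left e2 (show 0 ≤ s + g by positivity), mul_pos hg0 hθ]

lemma dhj_equiv {α β : Type} [Finite α] [Finite β] (e : α ≃ β) (h : DHJ α) : DHJ β := by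
  intro δ hδ
  obtain ⟨n, hn⟩ := h δ hδ
  refine ⟨n, fun ι _ hι A hA => ?_⟩
  obtain ⟨x, hx, hl⟩ := hn ι hι {x | (fun i => e (x i)) ∈ A} (by
    refine hA.trans_eq ?_
    exact (avg_equiv (Equiv.arrowCongr (Equiv.refl ι) e) (fun x => ind (x ∈ A))).symm)
  refine ⟨fun i => (x i).map e, ?_, fun b => ?_⟩
  · obtain ⟨i, hi⟩ := hx
    exact ⟨i, by simp [hi]⟩
  · have h1 : (fun i => e (ev x (e.symm b) i)) ∈ A := hl (e.symm b)
    convert h1 using 1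
    funext i
    simp only [ev]
    cases x i <;> simp

lemma dhj_unit : DHJ Unit := by
  intro δ hδ
  refine ⟨1, fun ι _ hι A hA => ?_⟩
  have : Nonempty ι := by
    by_contra hc
    rw [not_nonempty_iff] at hc
    simp at hι
  obtain ⟨x, hx⟩ : ∃ x, x ∈ A := by
    by_contra! hc
    have : dens A ≤ 0 := avg_le_const fun x => by rw [ind_false (hc x)]
    linarith
  refine ⟨fun _ => none, ⟨Classical.arbitrary ι, rfl⟩, fun a => ?_⟩
  convert hx using 1

/-- The density Hales-Jewett theorem. -/
theorem dhj (k : ℕ) : DHJ (Fin (k + 1)) := by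
  induction k with
  | zero => exact dhj_equiv (Equiv.ofUnique Unit (Fin 1)) dhj_unit
  | succ k ih => exact dhj_equiv (finSuccEquiv (k + 1)).symm (dhj_step ih)

end SzAP

namespace SzAP

open Finset

theorem szemeredi (k : ℕ) {δ : ℝ} (hδ : 0 < δ) : ∃ N₀ : ℕ, ∀ N : ℕ, N₀ ≤ N → ∀ A : Finset ℤ,
    (∀ x ∈ A, 0 ≤ x ∧ x < N) → δ * N ≤ A.card →
    ∃ x d : ℤ, 0 < d ∧ ∀ i : ℕ, i ≤ k → x + i * d ∈ A := by
  classical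
  obtain ⟨n, hn⟩ := dhj k (δ / 2) (by positivity)
  refine ⟨n * k + 1, fun N hN A hA hcard => ?_⟩
  set σ : (Fin n → Fin (k + 1)) → ℤ := fun w => ∑ i, ((w i : ℕ) : ℤ) with hσ
  have hσ0 : ∀ w, 0 ≤ σ w := fun w => Finset.sum_nonneg fun i _ => by positivity
  have hσ1 : ∀ w, σ w ≤ n * k := by
    intro w
    have : σ w ≤ ∑ i : Fin n, (k : ℤ) := Finset.sum_le_sum fun i _ => by
      have := (w i).2
      omega
    simpa using this
  set I : Finset ℤ := Finset.Ico (-((n * k : ℕ) : ℤ)) N with hI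
  have hIcard : (I.card : ℝ) = N + n * k := by
    rw [hI, Int.card_Ico]
    have : ((N : ℤ) - -((n * k : ℕ) : ℤ)).toNat = N + n * k := by omega
    rw [this]; push_cast; ring
  have h1 : ∀ w, ∑ a ∈ I, ind (a + σ w ∈ A) = A.card := by
    intro w
    have : ∑ a ∈ I, ind (a + σ w ∈ A) = ((I.filter fun a => a + σ w ∈ A).card : ℝ) := by
      rw [← Finset.sum_boole]
      refine Finset.sum_congr rfl fun a _ => ?_
      by_cases h : a + σ w ∈ A <;> simp [ind, h]
    rw [this]
    congr 1
    refine Finset.card_nbij' (fun a => a + σ w) (fun y => y - σ w) ?_ ?_ ?_ ?_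
    · intro a ha
      simp at ha
      simpa using ha.2
    · intro y hy
      have hy' : y ∈ A := hy
      have := hA y hy'
      have h2 := hσ0 w
      have h3 := hσ1 w
      simp only [coe_filter, Set.mem_ofPred_eq, hI, Finset.mem_Ico, sub_add_cancel]
      refine ⟨⟨?_, ?_⟩, hy'⟩
      · push_cast; linarith
      · linarith
    · intro a _; simp
    · intro a _; simp
  have h2 : ∑ a ∈ I, dens {w | a + σ w ∈ A} = A.card := by
    have := avg_sum I (fun a w => ind (a + σ w ∈ A))
    simp only [h1, avg_const] at this
    exact this.symm
  have h3 : ∃ a ∈ I, δ / 2 ≤ dens {w | a + σ w ∈ A} := by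
    by_contra! hc
    have h4 : ∑ a ∈ I, dens {w | a + σ w ∈ A} ≤ ∑ a ∈ I, δ / 2 :=
      Finset.sum_le_sum fun a ha => (hc a ha).le
    rw [h2, Finset.sum_const, nsmul_eq_mul, hIcard] at h4
    have h5 : ((n * k + 1 : ℕ) : ℝ) ≤ N := by exact_mod_cast hN
    push_cast at h5
    nlinarith
  obtain ⟨a, -, ha⟩ := h3
  obtain ⟨x, ⟨i₀, hi₀⟩, hx⟩ := hn (Fin n) (by simp) _ ha
  refine ⟨a + σ (ev x 0), ∑ i, if x i = none then 1 else 0, ?_, fun i hi => ?_⟩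
  · refine Finset.sum_pos' (fun i _ => by split_ifs <;> simp) ⟨i₀, Finset.mem_univ _, by simp [hi₀]⟩
  · have h4 : a + σ (ev x ⟨i, by omega⟩) ∈ A := hx ⟨i, by omega⟩
    convert h4 using 1
    rw [add_assoc]
    congr 1
    simp only [hσ]
    rw [Finset.mul_sum, ← Finset.sum_add_distrib]
    refine Finset.sum_congr rfl fun j _ => ?_
    simp only [ev]
    cases hj : x j <;> simp

end SzAP

namespace SzAP

open Finset MeasureTheory
open scoped Pointwise

lemma good_theta (S : Finset ℝ) (h0 : ∀ w ∈ S, w ≠ 0) {ε : ℝ} (hε : 0 < ε) (hε1 : ε ≤ 1)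
    (hS : 8 * ε * S.card ≤ 1) : ∃ θ : ℝ, ∀ w ∈ S, ∀ j : ℤ, ε ≤ |θ * w - j| := by
  classical
  by_contra! hcon
  set R : ℝ := ∑ w ∈ S, 10 * ε / |w| with hR
  have hR0 : 0 ≤ R := Finset.sum_nonneg fun w _ => by positivity
  set T : ℝ := 2 * R + 1 with hT
  have hT0 : 0 < T := by positivity
  set m : ℝ → ℤ := fun w => ⌈T * |w|⌉ + 1 with hm
  have hcover : Set.Icc (0 : ℝ) T ⊆
      ⋃ w ∈ S, ⋃ j ∈ Finset.Icc (-m w) (m w), Metric.ball ((j : ℝ) / w) (ε / |w|) := by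
    intro θ hθ
    obtain ⟨w, hw, j, hj⟩ := hcon θ
    have hw0 := h0 w hw
    have hwp : 0 < |w| := abs_pos.2 hw0
    simp only [Set.mem_iUnion]
    refine ⟨w, hw, j, ?_, ?_⟩
    · have h1 : |θ * w| ≤ T * |w| := by
        rw [abs_mul, abs_of_nonneg hθ.1]
        exact mul_le_mul_of_nonneg_right hθ.2 hwp.le
      have h2 : T * |w| ≤ ⌈T * |w|⌉ := Int.le_ceil _
      have h3 := abs_lt.1 hj
      have h4 := abs_le.1 h1
      rw [Finset.mem_Icc]
      constructor
      · have : (-(m w : ℤ) : ℝ) ≤ j := by simp only [hm]; push_cast; linarith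
        exact_mod_cast this
      · have : (j : ℝ) ≤ (m w : ℤ) := by simp only [hm]; push_cast; linarith
        exact_mod_cast this
    · rw [Metric.mem_ball, Real.dist_eq, lt_div_iff₀ hwp, ← abs_mul, sub_mul, div_mul_cancel₀ _ hw0]
      exact hj
  have hmeas : ENNReal.ofReal T ≤ ENNReal.ofReal (∑ w ∈ S, (2 * (T * |w|) + 5) * (2 * (ε / |w|))) := by
    calc ENNReal.ofReal T = volume (Set.Icc (0 : ℝ) T) := by rw [Real.volume_Icc, sub_zero]
      _ ≤ volume (⋃ w ∈ S, ⋃ j ∈ Finset.Icc (-m w) (m w), Metric.ball ((j : ℝ) / w) (ε / |w|)) :=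
        measure_mono hcover
      _ ≤ ∑ w ∈ S, volume (⋃ j ∈ Finset.Icc (-m w) (m w), Metric.ball ((j : ℝ) / w) (ε / |w|)) :=
        measure_biUnion_finset_le _ _
      _ ≤ ∑ w ∈ S, ∑ j ∈ Finset.Icc (-m w) (m w), volume (Metric.ball ((j : ℝ) / w) (ε / |w|)) :=
        Finset.sum_le_sum fun w _ => measure_biUnion_finset_le _ _
      _ ≤ ∑ w ∈ S, ENNReal.ofReal ((2 * (T * |w|) + 5) * (2 * (ε / |w|))) := by
        refine Finset.sum_le_sum fun w _ => ?_
        simp only [Real.volume_ball, Finset.sum_const]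
        rw [nsmul_eq_mul, ENNReal.ofReal_mul (p := 2 * (T * |w|) + 5) (by positivity)]
        refine mul_le_mul' ?_ le_rfl
        rw [← ENNReal.ofReal_natCast]
        apply ENNReal.ofReal_le_ofReal
        have h1 : (⌈T * |w|⌉ : ℝ) < T * |w| + 1 := Int.ceil_lt_add_one _
        have h2 : 0 ≤ ⌈T * |w|⌉ := Int.ceil_nonneg (by positivity)
        have h3 : ((Finset.Icc (-m w) (m w)).card : ℤ) = 2 * m w + 1 := by
          rw [Int.card_Icc]; simp only [hm]; omega
        have h4 : ((Finset.Icc (-m w) (m w)).card : ℝ) = 2 * m w + 1 := by exact_mod_cast h3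
        rw [h4]; simp only [hm]; push_cast; linarith
      _ = _ := (ENNReal.ofReal_sum_of_nonneg fun w _ => by positivity).symm
  have hreal : T ≤ ∑ w ∈ S, (2 * (T * |w|) + 5) * (2 * (ε / |w|)) :=
    (ENNReal.ofReal_le_ofReal_iff (Finset.sum_nonneg fun w _ => by positivity)).1 hmeas
  have heq : ∑ w ∈ S, (2 * (T * |w|) + 5) * (2 * (ε / |w|)) = 4 * ε * T * S.card + R := by
    rw [hR, mul_comm _ (S.card : ℝ), ← nsmul_eq_mul, ← Finset.sum_const, ← Finset.sum_add_distrib]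
    refine Finset.sum_congr rfl fun w hw => ?_
    have hwp : |w| ≠ 0 := (abs_pos.2 (h0 w hw)).ne'
    field_simp
    ring
  rw [heq] at hreal
  nlinarith

lemma ap_of_small (k : ℕ) {C : ℝ} (hC : 0 < C) : ∃ n₁ : ℕ, ∀ A : Finset ℝ, n₁ ≤ A.card →
    1 ≤ A.card → ((2 • A - 2 • A).card : ℝ) ≤ C * A.card →
    ∃ x d : ℝ, d ≠ 0 ∧ ∀ i : ℕ, i ≤ k + 1 → x + i * d ∈ A := by
  classical
  obtain ⟨N₀, hN₀⟩ := szemeredi (k + 1) (show 0 < 1 / (16 * C + 3) by positivity)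
  refine ⟨N₀, fun A hA hA1 hcard => ?_⟩
  set S : Finset ℝ := (2 • A - 2 • A).erase 0 with hS
  have hScard : (S.card : ℝ) ≤ C * A.card :=
    le_trans (by exact_mod_cast Finset.card_erase_le) hcard
  have hmem : ∀ x ∈ A, ∀ z ∈ A, ∀ y ∈ A, ∀ y' ∈ A, x + z - (y + y') ≠ 0 →
      x + z - (y + y') ∈ S := by
    intro x hx z hz y hy y' hy' hne
    rw [hS, Finset.mem_erase, two_nsmul]
    exact ⟨hne, Finset.sub_mem_sub (Finset.add_mem_add hx hz) (Finset.add_mem_add hy hy')⟩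
  set N : ℕ := 16 * S.card + A.card + 2 with hN
  have hNpos : (0 : ℝ) < N := by rw [hN]; positivity
  have hN2 : (2 : ℝ) ≤ N := by rw [hN]; push_cast; linarith [show (0:ℝ) ≤ S.card by positivity, show (0:ℝ) ≤ A.card by positivity]
  have hNS : (16 * S.card : ℝ) ≤ N := by rw [hN]; push_cast; linarith [show (0:ℝ) ≤ A.card by positivity]
  obtain ⟨θ, hθ⟩ := good_theta S (fun w hw => (Finset.mem_erase.1 hw).1)
    (show (0 : ℝ) < 2 / N by positivity) (by rw [div_le_one hNpos]; exact hN2) (by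
      rw [mul_div_assoc', div_mul_eq_mul_div, div_le_one hNpos]; linarith)
  set φ : ℝ → ℤ := fun x => ⌊N * Int.fract (θ * x)⌋ with hφ
  have hφ1 : ∀ x, (φ x : ℝ) ≤ N * Int.fract (θ * x) := fun x => Int.floor_le _
  have hφ2 : ∀ x, N * Int.fract (θ * x) < φ x + 1 := fun x => Int.lt_floor_add_one _
  have key : ∀ x ∈ A, ∀ z ∈ A, ∀ y ∈ A, ∀ y' ∈ A, φ x + φ z = φ y + φ y' → x + z = y + y' := by
    intro x hx z hz y hy y' hy' h
    by_contra hne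
    have h1 := hθ _ (hmem x hx z hz y hy y' hy' (sub_ne_zero.2 hne))
      (⌊θ * x⌋ + ⌊θ * z⌋ - ⌊θ * y⌋ - ⌊θ * y'⌋)
    have h2 : θ * (x + z - (y + y')) - ((⌊θ * x⌋ + ⌊θ * z⌋ - ⌊θ * y⌋ - ⌊θ * y'⌋ : ℤ) : ℝ) =
        Int.fract (θ * x) + Int.fract (θ * z) - Int.fract (θ * y) - Int.fract (θ * y') := by
      simp only [Int.fract]; push_cast; ring
    rw [h2, div_le_iff₀ hNpos] at h1
    have h' : (φ x + φ z : ℝ) = φ y + φ y' := by exact_mod_cast h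
    have h3 : |Int.fract (θ * x) + Int.fract (θ * z) - Int.fract (θ * y) - Int.fract (θ * y')| * N
        < 2 := by
      rw [← abs_of_pos hNpos, ← abs_mul, abs_lt]
      constructor <;>
      nlinarith [hφ1 x, hφ1 z, hφ1 y, hφ1 y', hφ2 x, hφ2 z, hφ2 y, hφ2 y']
    linarith
  have hinj : ∀ x ∈ A, ∀ y ∈ A, φ x = φ y → x = y := by
    intro x hx y hy h
    have := key x hx x hx y hy x hx (by rw [h])
    linarith
  obtain ⟨p, d, hd, hp⟩ := hN₀ N (by omega) (A.image φ) (by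
    intro q hq
    obtain ⟨x, -, rfl⟩ := Finset.mem_image.1 hq
    constructor
    · exact Int.floor_nonneg.2 (mul_nonneg hNpos.le (Int.fract_nonneg _))
    · rw [Int.floor_lt]
      have := Int.fract_lt_one (θ * x)
      push_cast
      nlinarith) (by
    rw [Finset.card_image_of_injOn (fun x hx y hy h => hinj x hx y hy h), div_mul_eq_mul_div,
      one_mul, div_le_iff₀ (by positivity), hN]
    push_cast
    have : (1 : ℝ) ≤ A.card := by exact_mod_cast hA1
    nlinarith)
  have : ∀ i : ℕ, ∃ x, i ≤ k + 1 → x ∈ A ∧ φ x = p + i * d := by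
    intro i
    by_cases hi : i ≤ k + 1
    · obtain ⟨x, hx, h⟩ := Finset.mem_image.1 (hp i hi)
      exact ⟨x, fun _ => ⟨hx, h⟩⟩
    · exact ⟨0, fun h => absurd h hi⟩
  choose X hX using this
  have hstep : ∀ i : ℕ, i + 1 ≤ k + 1 → X (i + 1) - X i = X 1 - X 0 := by
    intro i hi
    obtain ⟨h1, h1'⟩ := hX (i + 1) hi
    obtain ⟨h2, h2'⟩ := hX i (by omega)
    obtain ⟨h3, h3'⟩ := hX 1 (by omega)
    obtain ⟨h4, h4'⟩ := hX 0 (by omega)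
    have := key _ h1 _ h4 _ h2 _ h3 (by rw [h1', h2', h3', h4']; push_cast; ring)
    linarith
  have hall : ∀ i : ℕ, i ≤ k + 1 → X i = X 0 + i * (X 1 - X 0) := by
    intro i
    induction i with
    | zero => intro _; simp
    | succ i ih =>
      intro hi
      have h1 := hstep i hi
      have h2 := ih (by omega)
      push_cast
      linarith
  refine ⟨X 0, X 1 - X 0, ?_, fun i hi => ?_⟩
  · intro h
    have h1 := (hX 1 (by omega)).2
    have h0 := (hX 0 (by omega)).2
    rw [sub_eq_zero.1 h, h0] at h1
    push_cast at h1
    omega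
  · rw [← hall i hi]
    exact (hX i hi).1

end SzAP

namespace SzAP

open Finset
open scoped Pointwise

open Classical in
lemma drc {V : Type} (A : Finset V) (hA : A.Nonempty) (R : V → V → Prop) {c : ℝ} (hc : 0 < c)
    (hE : c * (A.card : ℝ) ^ 2 ≤ (((A ×ˢ A).filter fun p => R p.1 p.2).card : ℝ)) :
    ∃ N A' : Finset V, N ⊆ A ∧ A' ⊆ N ∧ c / 2 * A.card ≤ N.card ∧ (3 / 4 : ℝ) * N.card ≤ A'.card ∧
      ∀ a ∈ A', ∀ a' ∈ A', (N.card : ℝ) / 2 ≤ ((N.filter fun x =>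
        c ^ 2 / 32 * A.card ≤ ((A.filter fun y => R a y ∧ R x y).card : ℝ) ∧
        c ^ 2 / 32 * A.card ≤ ((A.filter fun y => R x y ∧ R a' y).card : ℝ)).card : ℝ) := by
  set n : ℝ := (A.card : ℝ) with hn
  have hn0 : 0 < n := by rw [hn]; exact_mod_cast hA.card_pos
  set ε : ℝ := c ^ 2 / 32 with hε
  set bad : V → V → Prop := fun x x' => ((A.filter fun y => R x y ∧ R x' y).card : ℝ) < ε * n
    with hbad
  set Nb : V → Finset V := fun y => A.filter fun x => R x y with hNb
  set t : Finset (V × V) := (A ×ˢ A).filter fun p => bad p.1 p.2 with ht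
  set b : V → ℕ := fun y => (t.filter fun p => R p.1 y ∧ R p.2 y).card with hb
  have h1 : c * n ^ 2 ≤ ∑ y ∈ A, ((Nb y).card : ℝ) := by
    refine hE.trans_eq ?_
    simp only [hNb, Finset.card_filter, Finset.sum_product_right]
    push_cast
    rfl
  have h2 : c ^ 2 * n ^ 3 ≤ ∑ y ∈ A, ((Nb y).card : ℝ) ^ 2 := by
    have h := sq_sum_le_card_mul_sum_sq (s := A) (f := fun y => ((Nb y).card : ℝ))
    have h' : (c * n ^ 2) ^ 2 ≤ (∑ y ∈ A, ((Nb y).card : ℝ)) ^ 2 := by gcongr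
    have h'' := h'.trans h
    rw [← hn] at h''
    have : n * (c ^ 2 * n ^ 3) ≤ n * ∑ y ∈ A, ((Nb y).card : ℝ) ^ 2 := by
      refine le_trans (le_of_eq (by ring)) h''
    exact le_of_mul_le_mul_left this hn0
  have h3 : ∑ y ∈ A, (b y : ℝ) ≤ ε * n ^ 3 := by
    have h := Finset.sum_card_bipartiteAbove_eq_sum_card_bipartiteBelow (s := A) (t := t)
      (fun y p => R p.1 y ∧ R p.2 y)
    have h' : ∑ y ∈ A, (b y : ℝ) =
        ∑ p ∈ t, ((A.filter fun y => R p.1 y ∧ R p.2 y).card : ℝ) := by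
      exact_mod_cast h
    rw [h']
    have h4 : ∑ p ∈ t, ((A.filter fun y => R p.1 y ∧ R p.2 y).card : ℝ) ≤ ∑ p ∈ t, ε * n :=
      Finset.sum_le_sum fun p hp => (Finset.mem_filter.1 hp).2.le
    have h5 : (t.card : ℝ) ≤ n ^ 2 := by
      have : t.card ≤ A.card * A.card := by
        rw [← Finset.card_product]; exact Finset.card_filter_le _ _
      rw [hn, sq]; exact_mod_cast this
    rw [Finset.sum_const, nsmul_eq_mul] at h4
    refine h4.trans ?_
    have : 0 ≤ ε * n := by positivity
    nlinarith
  obtain ⟨y, hy, hyy⟩ := Finset.exists_le_of_sum_le hA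
    (f := fun _ => c ^ 2 * n ^ 2 / 2) (g := fun y => ((Nb y).card : ℝ) ^ 2 - 16 * b y) (by
      rw [Finset.sum_const, nsmul_eq_mul, Finset.sum_sub_distrib, ← Finset.mul_sum, ← hn]
      have : ε * 32 = c ^ 2 := by rw [hε]; ring
      nlinarith [pow_pos hn0 3])
  have hb0 : (0 : ℝ) ≤ b y := by positivity
  set N := Nb y with hN
  have hNA : N ⊆ A := Finset.filter_subset _ _
  have hNc : c / 2 * n ≤ N.card := by
    refine le_of_sq_le_sq ?_ (by positivity)
    nlinarith [sq_nonneg (c * n)]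
  have hNpos : (0 : ℝ) < N.card := lt_of_lt_of_le (by positivity) hNc
  have hbN : 16 * (b y : ℝ) ≤ (N.card : ℝ) ^ 2 := by nlinarith [sq_nonneg (c * n)]
  set β : V → ℕ := fun x => (N.filter fun x' => bad x x').card with hβ
  have hβb : ∑ x ∈ N, (β x : ℝ) ≤ b y := by
    have h : ∑ x ∈ N, β x = ((N ×ˢ N).filter fun p => bad p.1 p.2).card := by
      simp only [hβ, Finset.card_filter, Finset.sum_product]
    have h' : ((N ×ˢ N).filter fun p => bad p.1 p.2).card ≤ b y := by
      refine Finset.card_le_card fun p hp => ?_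
      simp only [hN, hNb, ht, Finset.mem_filter, Finset.mem_product] at hp ⊢
      tauto
    rw [← h] at h'
    exact_mod_cast h'
  set A' := N.filter fun x => (β x : ℝ) ≤ N.card / 4 with hA'
  refine ⟨N, A', hNA, Finset.filter_subset _ _, hNc, ?_, ?_⟩
  · have h4 : ∑ x ∈ N.filter (fun x => ¬ (β x : ℝ) ≤ N.card / 4), (N.card / 4 : ℝ) ≤
        ∑ x ∈ N, (β x : ℝ) := by
      refine le_trans (Finset.sum_le_sum (g := fun x => (β x : ℝ)) fun x hx =>
        (not_le.1 (Finset.mem_filter.1 hx).2).le) ?_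
      exact Finset.sum_le_sum_of_subset_of_nonneg (Finset.filter_subset _ _)
        fun _ _ _ => by positivity
    rw [Finset.sum_const, nsmul_eq_mul] at h4
    have h5 : (A'.card : ℝ) + ((N.filter (fun x => ¬ (β x : ℝ) ≤ N.card / 4)).card : ℝ) =
        N.card := by
      exact_mod_cast Finset.card_filter_add_card_filter_not (s := N)
        (fun x => (β x : ℝ) ≤ N.card / 4)
    nlinarith
  · intro a ha a' ha'
    have ha2 := (Finset.mem_filter.1 ha).2
    have ha2' := (Finset.mem_filter.1 ha').2
    set G := N.filter fun x => ε * n ≤ ((A.filter fun y => R a y ∧ R x y).card : ℝ) ∧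
        ε * n ≤ ((A.filter fun y => R x y ∧ R a' y).card : ℝ) with hG
    have hsub : N ⊆ G ∪ ((N.filter fun x' => bad a x') ∪ (N.filter fun x' => bad a' x')) := by
      intro x hx
      simp only [Finset.mem_union, Finset.mem_filter, hG, hbad, hx, true_and]
      have : (A.filter fun y => R x y ∧ R a' y) = (A.filter fun y => R a' y ∧ R x y) := by
        ext; simp [and_comm]
      rw [this]
      by_contra! hcon
      obtain ⟨h5, h6, h7⟩ := hcon
      linarith [h5 h6]
    have h4 : N.card ≤ G.card + (β a + β a') :=
      (Finset.card_le_card hsub).trans ((Finset.card_union_le _ _).trans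
        (Nat.add_le_add_left (Finset.card_union_le _ _) _))
    have h5 : (N.card : ℝ) ≤ G.card + (β a + β a') := by exact_mod_cast h4
    linarith

open Classical in
lemma bsg {c : ℝ} (hc : 0 < c) (A : Finset ℝ) (hA : A.Nonempty)
    (hE : c * (A.card : ℝ) ^ 2 ≤
      (((A ×ˢ A).filter fun p => (p.1 + p.2) / 2 ∈ A).card : ℝ)) :
    ∃ A' ⊆ A, c / 4 * A.card ≤ A'.card ∧
      ((A' - A').card : ℝ) * (c ^ 5 / 4096) ≤ A.card := by
  obtain ⟨R, hR⟩ : ∃ R : ℝ → ℝ → Prop, ∀ x y, R x y ↔ (x + y) / 2 ∈ A :=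
    ⟨fun x y => (x + y) / 2 ∈ A, fun _ _ => Iff.rfl⟩
  have hE' : c * (A.card : ℝ) ^ 2 ≤ (((A ×ˢ A).filter fun p => R p.1 p.2).card : ℝ) := by
    refine hE.trans ?_
    norm_cast
    refine Finset.card_le_card fun p hp => ?_
    rw [Finset.mem_filter] at hp ⊢
    exact ⟨hp.1, (hR _ _).2 hp.2⟩
  obtain ⟨N, A', hNA, hA'N, hNc, hA'c, hpath⟩ := drc A hA R hc hE'
  have hn0 : (0 : ℝ) < A.card := by exact_mod_cast hA.card_pos
  refine ⟨A', hA'N.trans hNA, by linarith [show 0 ≤ c * (A.card : ℝ) by positivity], ?_⟩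
  set ε : ℝ := c ^ 2 / 32 with hε
  set Q : Finset (ℝ × ℝ × ℝ × ℝ) := A ×ˢ A ×ˢ A ×ˢ A with hQ
  set D : ℝ × ℝ × ℝ × ℝ → ℝ := fun q => 2 * (q.1 - q.2.1 + q.2.2.1 - q.2.2.2) with hD
  have hfib : ∀ d ∈ A' - A', (N.card : ℝ) / 2 * (ε * A.card) ^ 2 ≤
      ((Q.filter fun q => D q = d).card : ℝ) := by
    intro d hd
    obtain ⟨a, ha, a', ha', rfl⟩ := Finset.mem_sub.1 hd
    set G := N.filter fun x =>
        ε * A.card ≤ ((A.filter fun y => R a y ∧ R x y).card : ℝ) ∧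
        ε * A.card ≤ ((A.filter fun y => R x y ∧ R a' y).card : ℝ) with hG
    set P : Finset (Σ _ : ℝ, ℝ × ℝ) := G.sigma fun x =>
      (A.filter fun y => R a y ∧ R x y) ×ˢ
      (A.filter fun y => R x y ∧ R a' y) with hP
    have hPc : (N.card : ℝ) / 2 * (ε * A.card) ^ 2 ≤ P.card := by
      rw [hP, Finset.card_sigma]
      push_cast
      calc (N.card : ℝ) / 2 * (ε * A.card) ^ 2 ≤ G.card * (ε * A.card) ^ 2 := by
            gcongr; exact hpath a ha a' ha'
        _ = ∑ x ∈ G, (ε * A.card) ^ 2 := by rw [Finset.sum_const, nsmul_eq_mul]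
        _ ≤ _ := by
          refine Finset.sum_le_sum fun x hx => ?_
          have := (Finset.mem_filter.1 hx).2
          rw [Finset.card_product, sq]
          push_cast
          exact mul_le_mul this.1 this.2 (by positivity) (by positivity)
    refine hPc.trans ?_
    norm_cast
    refine Finset.card_le_card_of_injOn
      (fun p => ((a + p.2.1) / 2, (p.1 + p.2.1) / 2, (p.1 + p.2.2) / 2, (a' + p.2.2) / 2)) ?_ ?_
    · rintro ⟨x, y₁, y₂⟩ hp
      simp only [hP, Finset.coe_sigma, Set.mem_sigma_iff, Finset.mem_coe, Finset.mem_product,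
        Finset.mem_filter, hR] at hp
      simp only [Finset.mem_coe, Finset.mem_filter, hQ, Finset.mem_product, hD]
      refine ⟨⟨hp.2.1.2.1, hp.2.1.2.2, hp.2.2.2.1, hp.2.2.2.2⟩, by ring⟩
    · rintro ⟨x, y₁, y₂⟩ - ⟨x', y₁', y₂'⟩ - h
      simp only [Prod.mk.injEq] at h
      obtain ⟨h1, h2, h3, h4⟩ := h
      have e1 : y₁ = y₁' := by linarith
      have e2 : x = x' := by linarith
      have e3 : y₂ = y₂' := by linarith
      rw [e1, e2, e3]
  have hsum : ∑ d ∈ A' - A', ((Q.filter fun q => D q = d).card : ℝ) ≤ Q.card := by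
    have : ∑ d ∈ A' - A', (Q.filter fun q => D q = d).card ≤ Q.card := by
      rw [← Finset.card_biUnion]
      · exact Finset.card_le_card (Finset.biUnion_subset.2 fun d _ => Finset.filter_subset _ _)
      · intro d _ d' _ hdd
        refine Finset.disjoint_left.2 fun q hq hq' => hdd ?_
        rw [← (Finset.mem_filter.1 hq).2, ← (Finset.mem_filter.1 hq').2]
    exact_mod_cast this
  have hQc : (Q.card : ℝ) = (A.card : ℝ) ^ 4 := by
    rw [hQ]; simp only [Finset.card_product]; push_cast; ring
  have h1 := (Finset.sum_le_sum hfib).trans hsum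
  rw [Finset.sum_const, nsmul_eq_mul, hQc] at h1
  have h2 : (c * A.card / 4) * (ε * A.card) ^ 2 ≤ (N.card : ℝ) / 2 * (ε * A.card) ^ 2 := by
    exact mul_le_mul_of_nonneg_right (by linarith) (by positivity)
  have h3 := (mul_le_mul_of_nonneg_left h2 (show (0:ℝ) ≤ (A' - A').card by positivity)).trans h1
  have h4 : (A.card : ℝ) ^ 3 * ((A' - A').card * (c ^ 5 / 4096)) ≤ (A.card : ℝ) ^ 3 * A.card := by
    refine le_trans (le_of_eq ?_) (h3.trans (le_of_eq (by ring)))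
    rw [hε]; ring
  exact le_of_mul_le_mul_left h4 (by positivity)

end SzAP

namespace SzAP

open Finset
open scoped Pointwise

lemma pr (A : Finset ℝ) (hA : A.Nonempty) {K : ℝ}
    (h : ((A - A).card : ℝ) ≤ K * A.card) : ((2 • A - 2 • A).card : ℝ) ≤ K ^ 4 * A.card := by
  have h1 := Finset.pluennecke_ruzsa_inequality_nsmul_sub_nsmul_sub hA A 2 2
  have h2 : ((2 • A - 2 • A).card : ℝ) ≤ (((A - A).card : ℝ) / A.card) ^ (2 + 2) * A.card := by
    have h1' := (NNRat.cast_le (K := ℝ)).2 h1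
    push_cast at h1'
    exact h1'
  have hpos : (0 : ℝ) < A.card := by exact_mod_cast hA.card_pos
  refine h2.trans ?_
  have h3 : ((A - A).card : ℝ) / A.card ≤ K := by rwa [div_le_iff₀ hpos]
  exact mul_le_mul_of_nonneg_right (pow_le_pow_left₀ (by positivity) h3 _) hpos.le

open Classical in
lemma count_le (A : Finset ℝ) :
    {q : ℝ × ℝ | q.2 ≠ 0 ∧ q.1 ∈ A ∧ q.1 + q.2 ∈ A ∧ q.1 + 2 * q.2 ∈ A}.ncard ≤
      ((A ×ˢ A).filter fun p => (p.1 + p.2) / 2 ∈ A).card := by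
  rw [← Set.ncard_coe_finset]
  refine Set.ncard_le_ncard_of_injOn (fun q => (q.1, q.1 + 2 * q.2)) ?_ ?_ (Finset.finite_toSet _)
  · rintro ⟨x, d⟩ ⟨-, h1, h2, h3⟩
    simp only [Finset.coe_filter, Finset.mem_product]
    refine ⟨⟨h1, h3⟩, ?_⟩
    have : (x + (x + 2 * d)) / 2 = x + d := by ring
    show (x + (x + 2 * d)) / 2 ∈ A
    rw [this]; exact h2
  · rintro ⟨x, d⟩ - ⟨x', d'⟩ - h
    simp only [Prod.mk.injEq] at h
    obtain ⟨h1, h2⟩ := h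
    rw [Prod.mk.injEq]
    exact ⟨h1, by linarith⟩

end SzAP

theorem stmt_6 (c : ℝ) (hc : 0 < c) (k : ℕ) (hk : 3 < k) :
    ∃ n₀ : ℕ, ∀ A : Finset ℝ,
      n₀ ≤ A.card →
      c * (A.card : ℝ) ^ 2 ≤
        ({q : ℝ × ℝ | q.2 ≠ 0 ∧ q.1 ∈ A ∧ q.1 + q.2 ∈ A ∧ q.1 + 2 * q.2 ∈ A}.ncard : ℝ) →
      ∃ x d : ℝ, d ≠ 0 ∧ ∀ i : ℕ, i ≤ k - 1 → x + (i : ℝ) * d ∈ A := by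
  classical
  obtain ⟨n₁, hn₁⟩ := SzAP.ap_of_small (k - 2) (show 0 < (16384 / c ^ 6) ^ 4 by positivity)
  refine ⟨⌈4 * (n₁ + 1) / c⌉₊, fun A hA hcount => ?_⟩
  have hA' : 4 * (n₁ + 1) / c ≤ (A.card : ℝ) := (Nat.le_ceil _).trans (by exact_mod_cast hA)
  have hpos : (0 : ℝ) < A.card := lt_of_lt_of_le (by positivity) hA'
  have hne : A.Nonempty := Finset.card_pos.1 (by exact_mod_cast hpos)
  obtain ⟨B, hBA, hB, hBB⟩ := SzAP.bsg hc A hne (hcount.trans (by exact_mod_cast SzAP.count_le A))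
  have hBn : (n₁ : ℝ) + 1 ≤ B.card := by
    refine le_trans ?_ hB
    rw [div_le_iff₀ hc] at hA'
    linarith
  have hBn' : n₁ + 1 ≤ B.card := by exact_mod_cast hBn
  obtain ⟨x, d, hd, hx⟩ := hn₁ B (by omega) (by omega)
    (SzAP.pr B (Finset.card_pos.1 (by omega)) (by
      rw [div_mul_eq_mul_div, le_div_iff₀ (by positivity)]
      have h1 := mul_le_mul_of_nonneg_right hBB (show 0 ≤ 4096 * c by positivity)
      nlinarith))
  exact ⟨x, d, hd, fun i hi => hBA (hx i (by omega))⟩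
end

section
/- For every real constant c > 0 and every integer k ≥ 3 there exist a threshold n₀ and a constant δ′ > 0 depending only on c and k such that the following holds. If A is a finite set of real numbers with |A| ≥ n₀ containing at least c·|A|² k-term arithmetic progressions (pairs (x, d) with d ≠ 0 and x + i·d ∈ A for all 0 ≤ i ≤ k−1), then A contains at least δ′·|A|² (k+1)-term arithmetic progressions (pairs (x, d) with d ≠ 0 and x + i·d ∈ A for all 0 ≤ i ≤ k). -/
namespace DHJ

/-- Average of a real function over a finite type. -/
noncomputable def av {X : Type*} (f : X → ℝ) : ℝ := (∑ᶠ x, f x) / (Nat.card X : ℝ)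

open Classical in
/-- Indicator of a proposition. -/
noncomputable def ind (p : Prop) : ℝ := if p then 1 else 0

/-- Density of a set in a finite type. -/
noncomputable def den {X : Type*} (A : Set X) : ℝ := av (fun x => ind (x ∈ A))

lemma ind_true {p : Prop} (h : p) : ind p = 1 := by simp [ind, h]
lemma ind_false {p : Prop} (h : ¬ p) : ind p = 0 := by simp [ind, h]
lemma ind_nonneg (p : Prop) : 0 ≤ ind p := by unfold ind; split_ifs <;> norm_num
lemma ind_le_one (p : Prop) : ind p ≤ 1 := by unfold ind; split_ifs <;> norm_num
lemma ind_mono {p q : Prop} (h : p → q) : ind p ≤ ind q := by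
  by_cases hp : p
  · rw [ind_true hp, ind_true (h hp)]
  · rw [ind_false hp]; exact ind_nonneg _
lemma ind_congr {p q : Prop} (h : p ↔ q) : ind p = ind q := by rw [propext h]

section av
variable {X Y : Type*}

lemma av_def [Fintype X] (f : X → ℝ) : av f = (∑ x, f x) / (Fintype.card X : ℝ) := by
  rw [av, finsum_eq_sum_of_fintype, Nat.card_eq_fintype_card]

lemma av_mono [Finite X] {f g : X → ℝ} (h : ∀ x, f x ≤ g x) : av f ≤ av g := by
  have := Fintype.ofFinite X
  rw [av_def, av_def]
  gcongr with i
  exact h i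

lemma av_const [Finite X] [Nonempty X] (c : ℝ) : av (fun _ : X => c) = c := by
  have := Fintype.ofFinite X
  rw [av_def]
  have : (Fintype.card X : ℝ) ≠ 0 := by exact_mod_cast Fintype.card_ne_zero
  simp

lemma av_add [Finite X] (f g : X → ℝ) : av (fun x => f x + g x) = av f + av g := by
  have := Fintype.ofFinite X
  simp only [av_def, Finset.sum_add_distrib, add_div]

lemma av_sub [Finite X] (f g : X → ℝ) : av (fun x => f x - g x) = av f - av g := by
  have := Fintype.ofFinite X
  simp only [av_def, Finset.sum_sub_distrib, sub_div]

lemma av_mul_left [Finite X] (c : ℝ) (f : X → ℝ) : av (fun x => c * f x) = c * av f := by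
  have := Fintype.ofFinite X
  simp only [av_def, ← Finset.mul_sum, mul_div_assoc]

lemma av_sum [Finite X] [Fintype Y] (f : Y → X → ℝ) :
    av (fun x => ∑ y, f y x) = ∑ y, av (f y) := by
  have := Fintype.ofFinite X
  simp only [av_def]
  rw [Finset.sum_comm, Finset.sum_div]

lemma av_equiv [Finite X] (e : X ≃ Y) (f : Y → ℝ) : av (fun x => f (e x)) = av f := by
  have := Fintype.ofFinite X
  have := Fintype.ofEquiv X e
  rw [av_def, av_def, Fintype.card_congr e, Equiv.sum_comp e f]

lemma av_prod [Finite X] [Finite Y] (f : X × Y → ℝ) :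
    av f = av (fun x => av (fun y => f (x, y))) := by
  have := Fintype.ofFinite X
  have := Fintype.ofFinite Y
  simp only [av_def]
  rw [Fintype.sum_prod_type, Fintype.card_prod, ← Finset.sum_div, div_div]
  push_cast
  rw [mul_comm]

lemma av_comm [Finite X] [Finite Y] (f : X → Y → ℝ) :
    av (fun x => av (fun y => f x y)) = av (fun y => av (fun x => f x y)) := by
  rw [← av_prod (fun p : X × Y => f p.1 p.2), ← av_prod (fun p : Y × X => f p.2 p.1),
    ← av_equiv (Equiv.prodComm X Y)]
  rfl

lemma av_nonneg [Finite X] {f : X → ℝ} (h : ∀ x, 0 ≤ f x) : 0 ≤ av f := by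
  have := Fintype.ofFinite X
  rw [av_def]
  exact div_nonneg (Finset.sum_nonneg fun i _ => h i) (by positivity)

lemma av_le [Finite X] [Nonempty X] {f : X → ℝ} {c : ℝ} (h : ∀ x, f x ≤ c) : av f ≤ c := by
  rw [← av_const (X := X) c]; exact av_mono h

lemma le_av [Finite X] [Nonempty X] {f : X → ℝ} {c : ℝ} (h : ∀ x, c ≤ f x) : c ≤ av f := by
  rw [← av_const (X := X) c]; exact av_mono h

lemma exists_ge [Finite X] [Nonempty X] {f : X → ℝ} {c : ℝ} (h : c ≤ av f) : ∃ x, c ≤ f x := by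
  by_contra! hc
  have := Fintype.ofFinite X
  rw [av_def, le_div_iff₀ (by exact_mod_cast Fintype.card_pos)] at h
  have h2 : ∑ x, f x < ∑ _x : X, c :=
    Finset.sum_lt_sum_of_nonempty Finset.univ_nonempty fun i _ => hc i
  simp at h2
  linarith

/-- Sum over a finite type in terms of the average. -/
lemma sum_eq_av [Fintype X] (f : X → ℝ) : ∑ x, f x = (Fintype.card X : ℝ) * av f := by
  rcases isEmpty_or_nonempty X with h | h
  · simp
  · have : (Fintype.card X : ℝ) ≠ 0 := by exact_mod_cast Fintype.card_ne_zero
    rw [av_def]; field_simp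

lemma markov [Finite X] [Nonempty X] {f : X → ℝ} {δ : ℝ} (h1 : ∀ x, f x ≤ 1) (hδ : δ ≤ av f)
    (hδ0 : 0 ≤ δ) : δ / 2 ≤ av (fun x => ind (δ / 2 ≤ f x)) := by
  have h : av f ≤ av (fun x => ind (δ / 2 ≤ f x) + δ / 2) := by
    refine av_mono fun x => ?_
    by_cases hx : δ / 2 ≤ f x
    · rw [ind_true hx]; linarith [h1 x]
    · rw [ind_false hx]; push Not at hx; linarith
  rw [av_add, av_const] at h
  linarith

lemma pigeon [Finite X] [Finite Y] (p : X → Prop) (q : Y → X → Prop)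
    (h : ∀ x, p x → ∃ y, q y x) {δ : ℝ} (hδ : 0 < δ) (hp : δ ≤ av (fun x => ind (p x))) :
    ∃ y, δ / (Nat.card Y : ℝ) ≤ av (fun x => ind (q y x)) := by
  have := Fintype.ofFinite Y
  have h1 : av (fun x => ind (p x)) ≤ ∑ y, av (fun x => ind (q y x)) := by
    rw [← av_sum]
    refine av_mono fun x => ?_
    by_cases hx : p x
    · obtain ⟨y, hy⟩ := h x hx
      rw [ind_true hx, ← ind_true hy]
      exact Finset.single_le_sum (f := fun y => ind (q y x)) (fun i _ => ind_nonneg _)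
        (Finset.mem_univ y)
    · rw [ind_false hx]; exact Finset.sum_nonneg fun i _ => ind_nonneg _
  by_contra! hc
  rcases isEmpty_or_nonempty Y with hY | hY
  · simp at h1; linarith
  have h2 : ∑ y, av (fun x => ind (q y x)) < ∑ _y : Y, δ / (Nat.card Y : ℝ) :=
    Finset.sum_lt_sum_of_nonempty Finset.univ_nonempty fun i _ => hc i
  have : (Fintype.card Y : ℝ) ≠ 0 := by exact_mod_cast Fintype.card_ne_zero
  simp only [Finset.sum_const, Finset.card_univ, nsmul_eq_mul, Nat.card_eq_fintype_card] at h2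
  rw [mul_div_cancel₀ _ this] at h2
  linarith

lemma den_le_one [Finite X] (A : Set X) : den A ≤ 1 := by
  rcases isEmpty_or_nonempty X with h | h
  · simp [den, av]
  · exact av_le fun x => ind_le_one _

lemma den_nonneg [Finite X] (A : Set X) : 0 ≤ den A := av_nonneg fun _ => ind_nonneg _

/-- Averaging over words on a disjoint union of positions. -/
lemma av_split {ι κ β : Type*} [Finite ι] [Finite κ] [Finite β] (f : (ι ⊕ κ → β) → ℝ) :
    av f = av (fun x : ι → β => av (fun y : κ → β => f (Sum.elim x y))) := by
  rw [← av_prod (fun p : (ι → β) × (κ → β) => f (Sum.elim p.1 p.2)),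
    ← av_equiv (Equiv.sumArrowEquivProdArrow ι κ β)]
  congr 1
  funext x
  congr 1
  funext i
  cases i <;> rfl

lemma av_reindex {ι κ β : Type*} [Finite ι] [Finite κ] [Finite β] (e : ι ≃ κ)
    (f : (ι → β) → ℝ) : av (fun x : κ → β => f (x ∘ e)) = av f := by
  have := av_equiv (Equiv.arrowCongr e.symm (Equiv.refl β)) f
  rw [← this]
  rfl

end av

/-- Evaluation of a combinatorial subspace. -/
def ap {ι β η : Type*} (g : ι → β ⊕ η) (x : η → β) : ι → β := fun i => Sum.elim id x (g i)

/-- Every parameter of the subspace occurs. -/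
def Pr {ι β η : Type*} (g : ι → β ⊕ η) : Prop := ∀ e, ∃ i, g i = Sum.inr e

/-- The set contains a combinatorial line. -/
def HasLine {ι β : Type*} (A : Set (ι → β)) : Prop :=
  ∃ l : ι → Option β, (∃ i, l i = none) ∧ ∀ b, (fun i => (l i).getD b) ∈ A

/-- Density Hales-Jewett at one density. -/
def Good (β : Type) (δ : ℝ) : Prop :=
  ∃ N : ℕ, ∀ (ι : Type) [Finite ι], N ≤ Nat.card ι → ∀ A : Set (ι → β), δ ≤ den A → HasLine A

/-- Density Hales-Jewett. -/
def Dhj (β : Type) : Prop := ∀ δ : ℝ, 0 < δ → Good β δ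

/-- Multidimensional density Hales-Jewett. -/
def Mdhj (β : Type) : Prop := ∀ δ : ℝ, 0 < δ → ∀ M : ℕ, ∃ N : ℕ, ∀ (ι : Type) [Finite ι],
  N ≤ Nat.card ι → ∀ A : Set (ι → β), δ ≤ den A → ∃ g : ι → β ⊕ Fin M, Pr g ∧ ∀ x, ap g x ∈ A

lemma exists_split (ι : Type) [Finite ι] (n : ℕ) (h : n ≤ Nat.card ι) :
    ∃ m, n + m = Nat.card ι ∧ Nonempty (ι ≃ Fin n ⊕ Fin m) := by
  refine ⟨Nat.card ι - n, by omega, ⟨?_⟩⟩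
  refine (Finite.equivFin ι).trans ((finCongr (by omega)).trans finSumFinEquiv.symm)

lemma HasLine.pull {ι β η : Type*} {A : Set (ι → β)} (g : ι → β ⊕ η) (hg : Pr g)
    (h : HasLine {x : η → β | ap g x ∈ A}) : HasLine A := by
  obtain ⟨l, ⟨e, he⟩, hl⟩ := h
  refine ⟨fun i => Sum.elim some l (g i), ?_, fun b => ?_⟩
  · obtain ⟨i, hi⟩ := hg e
    exact ⟨i, by simp [hi, he]⟩
  · have := hl b
    change (ap g fun i => (l i).getD b) ∈ A at this
    convert this using 2 with i
    change (Sum.elim some l (g i)).getD b = Sum.elim id (fun i => (l i).getD b) (g i)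
    generalize g i = t
    cases t <;> simp

lemma ap_injective {ι β η : Type*} {g : ι → β ⊕ η} (hg : Pr g) : Function.Injective (ap g) := by
  intro x y h
  funext e
  obtain ⟨i, hi⟩ := hg e
  have := congrFun h i
  simpa [ap, hi] using this

theorem Dhj.mdhj {β : Type} [Finite β] [Nonempty β] (h : Dhj β) : Mdhj β := by
  intro δ hδ M
  induction M generalizing δ with
  | zero =>
    refine ⟨0, fun ι _ _ A hA => ?_⟩
    obtain ⟨x, hx⟩ := exists_ge hA
    have hxA : x ∈ A := by
      by_contra hn
      rw [ind_false hn] at hx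
      linarith
    refine ⟨fun i => Sum.inl (x i), fun e => e.elim0, fun y => ?_⟩
    exact hxA
  | succ M ih =>
    obtain ⟨n1, hn1⟩ := h (δ / 2) (by linarith)
    set L := Nat.card (Fin n1 → Option β) with hL
    have hLpos : 0 < L := Nat.card_pos
    obtain ⟨N2, hN2⟩ := ih (δ / 2 / L) (by positivity)
    refine ⟨n1 + N2, fun ι _ hι A hA => ?_⟩
    obtain ⟨m, hm, ⟨e⟩⟩ := exists_split ι n1 (by omega)
    rw [den, ← av_reindex e, av_split, av_comm] at hA
    have hmk := markov (fun y => av_le fun x => ind_le_one _) hA hδ.le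
    obtain ⟨l, hl⟩ := pigeon _ (fun (l : Fin n1 → Option β) (y : Fin m → β) =>
      (∃ i, l i = none) ∧ ∀ b, Sum.elim (fun i => (l i).getD b) y ∘ e ∈ A) (by
        intro y hy
        obtain ⟨l, h1, h2⟩ := hn1 (Fin n1) (by simp) {x | Sum.elim x y ∘ e ∈ A} hy
        exact ⟨l, h1, h2⟩) (by linarith) hmk
    obtain ⟨g, hg, hgA⟩ := hN2 (Fin m) (by simp; omega) {y | (∃ i, l i = none) ∧
      ∀ b, Sum.elim (fun i => (l i).getD b) y ∘ e ∈ A} hl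
    obtain ⟨i0, hi0⟩ : ∃ i, l i = none := (hgA (fun _ => Classical.arbitrary β)).1
    refine ⟨Sum.elim (fun i => (l i).elim (Sum.inr 0) Sum.inl)
      (fun j => Sum.map id Fin.succ (g j)) ∘ e, ?_, ?_⟩
    · intro k
      refine Fin.cases ?_ (fun k => ?_) k
      · exact ⟨e.symm (Sum.inl i0), by simp [hi0]⟩
      · obtain ⟨j, hj⟩ := hg k
        exact ⟨e.symm (Sum.inr j), by simp [hj]⟩
    · intro x
      have := (hgA (fun k => x k.succ)).2 (x 0)
      convert this using 1
      funext i
      simp only [ap, Function.comp]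
      rcases e i with j | j
      · simp only [Sum.elim_inl]
        cases l j <;> simp
      · simp only [Sum.elim_inr, ap]
        generalize g j = t
        cases t <;> simp

end DHJ

namespace DHJ

open Classical in
/-- Fill the positions of `S` with letters `e (z p)`, the other ones with `r p`. -/
noncomputable def fill {P B Γ : Type*} (S : Set P) (e : B → Γ) (r : P → Γ) (z : S → B) : P → Γ :=
  fun p => if h : p ∈ S then e (z ⟨p, h⟩) else r p

lemma av_restrict {P B : Type*} [Finite P] [Finite B] [Nonempty B] (S : Set P)
    (f : (S → B) → ℝ) : av (fun z : P → B => f (fun p => z p)) = av f := by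
  classical
  have h1 := av_equiv (Equiv.piEquivPiSubtypeProd (fun p => p ∈ S) (fun _ : P => B))
    (fun w => f w.1)
  have h2 := av_prod (fun w : ((p : {p // p ∈ S}) → B) × ((p : {p // p ∉ S}) → B) => f w.1)
  simp only [av_const] at h2
  rw [h2] at h1
  exact h1

lemma av_pow {P Γ : Type*} [Finite P] [Finite Γ] (h : Γ → ℝ) [Fintype P] :
    av (fun v : P → Γ => ∏ p, h (v p)) = (av h) ^ (Nat.card P) := by
  classical
  have := Fintype.ofFinite Γ
  rw [av_def, av_def, div_pow, Nat.card_eq_fintype_card, Fintype.card_fun]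
  push_cast
  congr 1
  have := Finset.prod_univ_sum (fun _ : P => (Finset.univ : Finset Γ)) (fun _ γ => h γ)
  rw [Fintype.piFinset_univ] at this
  rw [← this]
  simp

open Classical in
/-- Swap of the letter and the resampled letter. -/
noncomputable def swp {B Γ : Type*} (e : B → Γ) (w : Γ × B) : Γ × B :=
  if h : w.1 ∈ Set.range e then (e w.2, h.choose) else w

lemma swp_invol {B Γ : Type*} {e : B → Γ} (he : Function.Injective e) :
    Function.Involutive (swp e) := by
  intro ⟨γ, b⟩
  by_cases h : γ ∈ Set.range e
  · have h1 : swp e (γ, b) = (e b, h.choose) := by simp only [swp]; rw [dif_pos h]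
    have h2 : e b ∈ Set.range e := ⟨b, rfl⟩
    rw [h1]
    simp only [swp]
    rw [dif_pos h2]
    ext
    · exact h.choose_spec
    · exact he h2.choose_spec
  · have h1 : swp e (γ, b) = (γ, b) := by simp only [swp]; rw [dif_neg h]
    rw [h1, h1]

theorem resample {B Γ : Type} [Finite B] [Nonempty B] [Finite Γ] {e : B → Γ}
    (he : Function.Injective e) {θ : ℝ} (hθ : 0 < θ) (M : ℕ) :
    ∃ N : ℕ, ∀ (P : Type) [Finite P], N ≤ Nat.card P → ∀ F : (P → Γ) → ℝ, (∀ u, F u ≤ 1) →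
      θ ≤ av F → ∃ (S : Set P) (r : P → Γ), M ≤ Nat.card S ∧ (∀ p, p ∉ S → r p ∉ Set.range e) ∧
        θ / 2 ≤ av (fun z : S → B => F (fill S e r z)) := by
  classical
  have hΓ : Nonempty Γ := ⟨e (Classical.arbitrary B)⟩
  let h : Γ → ℝ := fun γ => if γ ∈ Set.range e then 1 / 2 else 1
  set ρ := av h with hρ
  have hρ0 : 0 ≤ ρ := av_nonneg fun γ => by simp only [h]; split_ifs <;> norm_num
  have hρ1 : ρ < 1 := by
    have := Fintype.ofFinite Γ
    rw [hρ, av_def, div_lt_one (by exact_mod_cast Fintype.card_pos)]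
    have : ∑ x, h x < ∑ _x : Γ, (1 : ℝ) := by
      refine Finset.sum_lt_sum (fun i _ => ?_) ⟨e (Classical.arbitrary B), Finset.mem_univ _, ?_⟩
      · simp only [h]; split_ifs <;> norm_num
      · simp only [h]; rw [if_pos ⟨_, rfl⟩]; norm_num
    simpa using this
  obtain ⟨N, hN⟩ := exists_pow_lt_of_lt_one (show 0 < θ / 2 / 2 ^ M by positivity) hρ1
  refine ⟨N, fun P _ hP F hF hav => ?_⟩
  have := Fintype.ofFinite P
  -- step a
  have ha : av F = av (fun v : P → Γ => av (fun z : P → B =>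
      F (fun p => if v p ∈ Set.range e then e (z p) else v p))) := by
    have h1 := av_prod (fun w : (P → Γ) × (P → B) => F w.1)
    simp only [av_const] at h1
    have h2 := av_equiv (Equiv.arrowProdEquivProdArrow P (fun _ => Γ) (fun _ => B))
      (fun w : (P → Γ) × (P → B) => F w.1)
    have h3 := av_equiv (Equiv.arrowCongr (Equiv.refl P) (swp_invol he).toPerm)
      (fun w : P → Γ × B => F (fun p => (w p).1))
    have h4 := av_equiv (Equiv.arrowProdEquivProdArrow P (fun _ => Γ) (fun _ => B))
      (fun w : (P → Γ) × (P → B) => F (fun p => if w.1 p ∈ Set.range e then e (w.2 p) else w.1 p))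
    rw [av_prod] at h4
    rw [← h1, ← h2, ← h4]
    refine Eq.trans h3.symm ?_
    congr 1
    funext w
    congr 1
    funext p
    change (swp e (w p)).1 = _
    change _ = if (w p).1 ∈ Set.range e then e (w p).2 else (w p).1
    unfold swp
    split_ifs <;> rfl
  -- step b
  have hb : av (fun v : P → Γ => ind (Nat.card {p | v p ∈ Set.range e} < M)) ≤ θ / 2 := by
    have h1 : av (fun v : P → Γ => ind (Nat.card {p | v p ∈ Set.range e} < M)) ≤
        av (fun v : P → Γ => 2 ^ M * ∏ p, h (v p)) := by
      refine av_mono fun v => ?_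
      have hprod : ∏ p, h (v p) = (1 / 2) ^ (Nat.card {p | v p ∈ Set.range e}) := by
        simp only [h]
        rw [Finset.prod_ite, Finset.prod_const, Finset.prod_const_one, mul_one,
          Nat.card_eq_fintype_card]
        congr 1
        exact (Fintype.card_subtype _).symm
      rw [hprod]
      by_cases hv : Nat.card {p | v p ∈ Set.range e} < M
      · rw [ind_true hv, one_div, inv_pow, ← div_eq_mul_inv, one_le_div (by positivity)]
        exact pow_le_pow_right₀ (by norm_num) hv.le
      · rw [ind_false hv]; positivity
    rw [av_mul_left, av_pow] at h1
    have h2 : ρ ^ Nat.card P ≤ ρ ^ N := pow_le_pow_of_le_one hρ0 hρ1.le hP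
    have h3 : (2 : ℝ) ^ M * (θ / 2 / 2 ^ M) = θ / 2 := by field_simp
    have h4 : (2 : ℝ) ^ M * ρ ^ Nat.card P ≤ 2 ^ M * (θ / 2 / 2 ^ M) := by
      gcongr; linarith
    linarith
  -- step c
  have hc : θ / 2 ≤ av (fun v : P → Γ => av (fun z : P → B =>
      F (fun p => if v p ∈ Set.range e then e (z p) else v p)) -
      ind (Nat.card {p | v p ∈ Set.range e} < M)) := by
    rw [av_sub, ← ha]; linarith
  obtain ⟨v, hv⟩ := exists_ge hc
  refine ⟨{p | v p ∈ Set.range e}, v, ?_, fun p hp => hp, ?_⟩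
  · by_contra hcon
    push Not at hcon
    rw [ind_true hcon] at hv
    have : av (fun z : P → B =>
      F (fun p => if v p ∈ Set.range e then e (z p) else v p)) ≤ 1 := av_le fun z => hF _
    linarith
  · rw [← av_restrict]
    have h5 := ind_nonneg (Nat.card {p | v p ∈ Set.range e} < M)
    have h6 : θ / 2 ≤ av (fun z : P → B =>
      F (fun p => if v p ∈ Set.range e then e (z p) else v p)) := by linarith
    exact h6

/-- Insensitivity: the letter `none` may be exchanged with `a`. -/
def Ins {ι α : Type*} (a : α) (D : Set (ι → Option α)) : Prop :=
  ∀ x x', (∀ i, (x i).getD a = (x' i).getD a) → x ∈ D → x' ∈ D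

lemma Ins.compl {ι α : Type*} {a : α} {D : Set (ι → Option α)} (h : Ins a D) : Ins a Dᶜ :=
  fun x x' hx hD hD' => hD (h x' x (fun i => (hx i).symm) hD')

lemma Ins.pull {ι η α : Type*} {a : α} {D : Set (ι → Option α)} (h : Ins a D)
    (g : ι → Option α ⊕ η) : Ins a {x | ap g x ∈ D} := by
  intro x x' hx hD
  refine h _ _ (fun i => ?_) hD
  unfold ap
  generalize g i = t
  cases t
  · rfl
  · exact hx _

theorem insMdhj {α : Type} [Finite α] [Nonempty α] (hM : Mdhj α) {ε : ℝ} (hε : 0 < ε)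
    (M : ℕ) : ∃ N : ℕ, ∀ (ι : Type) [Finite ι], N ≤ Nat.card ι → ∀ (a : α)
      (D : Set (ι → Option α)), Ins a D → ε ≤ den D →
      ∃ g : ι → Option α ⊕ Fin M, Pr g ∧ ∀ x, ap g x ∈ D := by
  classical
  obtain ⟨N1, hN1⟩ := hM (ε / 2) (by linarith) M
  obtain ⟨N, hN⟩ := resample (Option.some_injective α) hε N1
  refine ⟨N, fun ι _ hι a D hD hden => ?_⟩
  obtain ⟨S, r, hS, hr, hF⟩ := hN ι hι (fun u => ind (u ∈ D)) (fun u => ind_le_one _) hden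
  obtain ⟨g, hg, hgD⟩ := hN1 S hS {z | fill S some r z ∈ D} hF
  refine ⟨fun p => if h : p ∈ S then Sum.map some id (g ⟨p, h⟩) else Sum.inl (r p), ?_, ?_⟩
  · intro k
    obtain ⟨p, hp⟩ := hg k
    exact ⟨p, by simp [hp]⟩
  · intro x
    refine hD _ _ (fun i => ?_) (hgD (fun k => (x k).getD a))
    unfold ap fill
    by_cases h : i ∈ S
    · simp only [dif_pos h]
      generalize g ⟨i, h⟩ = t
      cases t <;> simp
    · simp only [dif_neg h]
      simp

lemma av_range {X Y : Type*} [Finite X] [Nonempty X] [Finite Y] (φ : X → Y) (hφ : Function.Injective φ)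
    (h : Y → ℝ) : av (fun y => ind (y ∈ Set.range φ) * h y) =
      ((Nat.card X : ℝ) / Nat.card Y) * av (fun x => h (φ x)) := by
  classical
  have := Fintype.ofFinite X
  have := Fintype.ofFinite Y
  have hX : (Fintype.card X : ℝ) ≠ 0 := by exact_mod_cast Fintype.card_ne_zero
  rw [av_def, av_def, Nat.card_eq_fintype_card, Nat.card_eq_fintype_card]
  have : ∑ y, ind (y ∈ Set.range φ) * h y = ∑ x, h (φ x) := by
    have h1 : ∑ x, h (φ x) = ∑ y ∈ Finset.univ.image φ, h y := by
      rw [Finset.sum_image (fun a _ b _ hab => hφ hab)]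
    rw [h1, ← Finset.sum_subset (Finset.subset_univ (Finset.univ.image φ))]
    · refine Finset.sum_congr rfl fun y hy => ?_
      rw [ind_true (by simpa using hy), one_mul]
    · intro y _ hy
      rw [ind_false (by simpa using hy), zero_mul]
  rw [this]
  field_simp

/-- One removal step. -/
lemma exists_U {α : Type} [Finite α] [Nonempty α] (a : α) {ε : ℝ} (M n : ℕ)
    (hn : ∀ (D : Set (Fin n → Option α)), Ins a D → ε / 2 ≤ den D →
      ∃ g : Fin n → Option α ⊕ Fin M, Pr g ∧ ∀ x, ap g x ∈ D) (E : Set (Fin n → Option α)) :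
    ∃ U ⊆ E, (∀ h : (Fin n → Option α) → ℝ,
      (∀ g : Fin n → Option α ⊕ Fin M, Pr g → av (fun x => h (ap g x)) ≤ ε) →
      av (fun x => ind (x ∈ U) * h x) ≤ ε * den U) ∧
      (Ins a E → ε / 2 ≤ den E → 1 / (Nat.card (Fin n → Option α) : ℝ) ≤ den U) := by
  by_cases hE : Ins a E ∧ ε / 2 ≤ den E
  · obtain ⟨g, hg, hgE⟩ := hn E hE.1 hE.2
    have hden : den (Set.range (ap g)) =
        ((Nat.card (Fin M → Option α) : ℝ) / Nat.card (Fin n → Option α)) := by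
      have := av_range (ap g) (ap_injective hg) (fun _ => 1)
      simp only [mul_one, av_const] at this
      exact this
    refine ⟨Set.range (ap g), ?_, fun h hh => ?_, fun _ _ => ?_⟩
    · rintro _ ⟨x, rfl⟩; exact hgE x
    · rw [av_range (ap g) (ap_injective hg), hden, mul_comm]
      gcongr
      exact hh g hg
    · rw [hden]
      gcongr
      exact_mod_cast Nat.card_pos
  · refine ⟨∅, by simp, fun h _ => ?_, fun h1 h2 => absurd ⟨h1, h2⟩ hE⟩
    simp [den, ind, av]

theorem single {α : Type} [Finite α] [Nonempty α] (hM : Mdhj α) (a : α) {ε : ℝ} (hε : 0 < ε)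
    (M : ℕ) : ∃ N : ℕ, ∀ (ι : Type) [Finite ι], N ≤ Nat.card ι → ∀ f : (ι → Option α) → ℝ,
      (∀ x, f x ≤ 1) →
      (∀ g : ι → Option α ⊕ Fin M, Pr g → av (fun x => f (ap g x)) ≤ ε) →
      ∀ D : Set (ι → Option α), Ins a D → av (fun x => ind (x ∈ D) * f x) ≤ 2 * ε := by
  classical
  obtain ⟨n, hn⟩ := insMdhj hM (show 0 < ε / 2 by linarith) M
  choose U hUE hU1 hU2 using exists_U a M n (fun D => hn (Fin n) (by simp) a D)
  set κ : ℝ := 1 / (Nat.card (Fin n → Option α) : ℝ) with hκ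
  have hcard : (1 : ℝ) ≤ (Nat.card (Fin n → Option α) : ℝ) := by exact_mod_cast Nat.card_pos
  have hκ0 : 0 < κ := by positivity
  have hκ1 : κ ≤ 1 := by rw [hκ, div_le_one (by linarith)]; exact hcard
  have key : ∀ (j : ℕ) (ι : Type) [Finite ι], j * n ≤ Nat.card ι → ∀ f : (ι → Option α) → ℝ,
      (∀ x, f x ≤ 1) →
      (∀ g : ι → Option α ⊕ Fin M, Pr g → av (fun x => f (ap g x)) ≤ ε) →
      ∀ D : Set (ι → Option α), Ins a D → av (fun x => ind (x ∈ D) * f x) ≤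
        ε * den D + ε / 2 + (1 - κ) ^ j * (den D - ε / 2) := by
    intro j
    induction j with
    | zero =>
      intro ι _ _ f hf _ D _
      have h1 : av (fun x => ind (x ∈ D) * f x) ≤ den D := by
        refine av_mono fun x => ?_
        nlinarith [ind_nonneg (x ∈ D), hf x]
      have := mul_nonneg hε.le (den_nonneg D)
      simp; linarith
    | succ j ih =>
      intro ι _ hι f hf hsub D hD
      obtain ⟨m, hm, ⟨e⟩⟩ := exists_split ι n (by nlinarith)
      have hjm : j * n ≤ m := by nlinarith
      -- the slices
      let Dy : (Fin m → Option α) → Set (Fin n → Option α) := fun y => {x | Sum.elim x y ∘ e ∈ D}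
      let Dx : (Fin n → Option α) → Set (Fin m → Option α) :=
        fun x => {y | x ∈ Dy y ∧ x ∉ U (Dy y)}
      have hDyIns : ∀ y, Ins a (Dy y) := by
        intro y x x' hx hxD
        refine hD _ _ (fun i => ?_) hxD
        simp only [Function.comp]
        generalize e i = t
        cases t
        · exact hx _
        · rfl
      have hDyEq : ∀ y y', (∀ i, (y i).getD a = (y' i).getD a) → Dy y = Dy y' := by
        intro y y' hy
        ext x
        constructor
        · intro hxD
          refine hD _ _ (fun i => ?_) hxD
          simp only [Function.comp]
          generalize e i = t
          cases t
          · rfl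
          · exact hy _
        · intro hxD
          refine hD _ _ (fun i => ?_) hxD
          simp only [Function.comp]
          generalize e i = t
          cases t
          · rfl
          · exact (hy _).symm
      have hDxIns : ∀ x, Ins a (Dx x) := by
        intro x y y' hy hyD
        change x ∈ Dy y' ∧ x ∉ U (Dy y')
        rw [← hDyEq y y' hy]
        exact hyD
      have hsplit : av (fun x => ind (x ∈ D) * f x) = av (fun y => av (fun x =>
          ind (x ∈ U (Dy y)) * f (Sum.elim x y ∘ e))) + av (fun x => av (fun y =>
          ind (y ∈ Dx x) * f (Sum.elim x y ∘ e))) := by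
        rw [av_comm (fun x y => ind (y ∈ Dx x) * f (Sum.elim x y ∘ e)), ← av_add,
          ← av_reindex e, av_split, av_comm]
        congr 1; funext y
        rw [← av_add]
        congr 1; funext x
        rw [← add_mul]
        congr 1
        by_cases h1 : x ∈ U (Dy y)
        · rw [ind_true h1, ind_false (fun h : y ∈ Dx x => h.2 h1),
            ind_true (show Sum.elim x y ∘ e ∈ D from hUE _ h1), add_zero]
        · rw [ind_false h1, zero_add]
          exact ind_congr ⟨fun h => ⟨h, h1⟩, fun h => h.1⟩
      have hsplitd : den D = av (fun y => den (U (Dy y))) + av (fun x => den (Dx x)) := by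
        unfold den
        rw [av_comm (fun x y => ind (y ∈ Dx x)), ← av_add,
          ← av_reindex e, av_split, av_comm]
        congr 1; funext y
        rw [← av_add]
        congr 1; funext x
        by_cases h1 : x ∈ U (Dy y)
        · rw [ind_true h1, ind_false (fun h : y ∈ Dx x => h.2 h1),
            ind_true (show Sum.elim x y ∘ e ∈ D from hUE _ h1), add_zero]
        · rw [ind_false h1, zero_add]
          exact ind_congr ⟨fun h => ⟨h, h1⟩, fun h => h.1⟩
      have hden : den D = av (fun y => den (Dy y)) := by
        unfold den
        rw [← av_reindex e, av_split, av_comm]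
        rfl
      have hu : κ * (den D - ε / 2) ≤ av (fun y => den (U (Dy y))) := by
        have : κ * (den D - ε / 2) = av (fun y => κ * (den (Dy y) - ε / 2)) := by
          rw [av_mul_left, av_sub, av_const, hden]
        rw [this]
        refine av_mono fun y => ?_
        by_cases hy : ε / 2 ≤ den (Dy y)
        · have h1 := hU2 (Dy y) (hDyIns y) hy
          have h2 := den_le_one (Dy y)
          nlinarith
        · have h1 := den_nonneg (U (Dy y))
          push Not at hy
          nlinarith
      have hb1 : av (fun y => av (fun x =>
          ind (x ∈ U (Dy y)) * f (Sum.elim x y ∘ e))) ≤ ε * av (fun y => den (U (Dy y))) := by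
        rw [← av_mul_left]
        refine av_mono fun y => hU1 (Dy y) (fun x => f (Sum.elim x y ∘ e)) fun g hg => ?_
        refine le_of_eq_of_le ?_ (hsub (Sum.elim g (fun i => Sum.inl (y i)) ∘ e) ?_)
        · congr 1; funext x; congr 1; funext i
          simp only [Function.comp, ap]
          generalize e i = t
          cases t <;> rfl
        · intro k
          obtain ⟨i, hi⟩ := hg k
          exact ⟨e.symm (Sum.inl i), by simp [hi]⟩
      have hb2 : av (fun x => av (fun y =>
          ind (y ∈ Dx x) * f (Sum.elim x y ∘ e))) ≤ av (fun x => ε * den (Dx x) + ε / 2 +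
            (1 - κ) ^ j * (den (Dx x) - ε / 2)) := by
        refine av_mono fun x => ih (Fin m) (by simpa using hjm) (fun y => f (Sum.elim x y ∘ e))
          (fun y => hf _) (fun g hg => ?_) (Dx x) (hDxIns x)
        refine le_of_eq_of_le ?_ (hsub (Sum.elim (fun i => Sum.inl (x i)) g ∘ e) ?_)
        · congr 1; funext x; congr 1; funext i
          simp only [Function.comp, ap]
          generalize e i = t
          cases t <;> rfl
        · intro k
          obtain ⟨i, hi⟩ := hg k
          exact ⟨e.symm (Sum.inr i), by simp [hi]⟩
      rw [av_add, av_add, av_mul_left, av_mul_left, av_sub, av_const] at hb2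
      set u := av (fun y => den (U (Dy y)))
      set d' := av (fun x => den (Dx x))
      rw [hsplit]
      have hp : 0 ≤ (1 - κ) ^ j := pow_nonneg (by linarith) j
      have : (1 - κ) ^ j * (d' - ε / 2) ≤ (1 - κ) ^ (j + 1) * (den D - ε / 2) := by
        rw [pow_succ, mul_assoc]
        refine mul_le_mul_of_nonneg_left ?_ hp
        nlinarith
      have h3 : ε * den D = ε * u + ε * d' := by rw [hsplitd]; ring
      linarith
  obtain ⟨j, hj⟩ := exists_pow_lt_of_lt_one (show 0 < ε / 2 by linarith)
    (show 1 - κ < 1 by linarith)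
  refine ⟨j * n, fun ι _ hι f hf hsub D hD => ?_⟩
  have h1 := key j ι hι f hf hsub D hD
  have h2 := den_le_one D
  have hp : 0 ≤ (1 - κ) ^ j := pow_nonneg (by linarith) j
  have h3 : (1 - κ) ^ j * (den D - ε / 2) ≤ (1 - κ) ^ j * 1 :=
    mul_le_mul_of_nonneg_left (by linarith) hp
  nlinarith

lemma ap_comp {ι η ζ β : Type*} (g : ι → β ⊕ η) (g' : η → β ⊕ ζ) (x : ζ → β) :
    ap (fun i => Sum.elim Sum.inl g' (g i)) x = ap g (ap g' x) := by
  funext i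
  change Sum.elim id x (Sum.elim Sum.inl g' (g i)) = Sum.elim id (ap g' x) (g i)
  generalize g i = t
  cases t <;> rfl

lemma Pr.comp {ι η ζ β : Type*} {g : ι → β ⊕ η} {g' : η → β ⊕ ζ} (hg : Pr g) (hg' : Pr g') :
    Pr (fun i => Sum.elim Sum.inl g' (g i)) := by
  intro k
  obtain ⟨e, he⟩ := hg' k
  obtain ⟨i, hi⟩ := hg e
  exact ⟨i, by simp [hi, he]⟩

theorem multi {α : Type} [Finite α] [Nonempty α] (hM : Mdhj α) (s : Finset α) {ε : ℝ}
    (hε : 0 < ε) (M : ℕ) : ∃ N : ℕ, ∀ (ι : Type) [Finite ι], N ≤ Nat.card ι →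
      ∀ f : (ι → Option α) → ℝ, (∀ x, f x ≤ 1) →
      (∀ g : ι → Option α ⊕ Fin M, Pr g → av (fun x => f (ap g x)) ≤ ε) →
      ∀ D : α → Set (ι → Option α), (∀ a, Ins a (D a)) →
      av (fun x => ind (∀ a ∈ s, x ∈ D a) * f x) ≤ 2 ^ s.card * ε := by
  classical
  induction s using Finset.induction_on with
  | empty =>
    refine ⟨M, fun ι _ hι f hf hsub D hD => ?_⟩
    obtain ⟨m, hm, ⟨e⟩⟩ := exists_split ι M hι
    simp only [Finset.card_empty, pow_zero, one_mul]
    have : av (fun x => ind (∀ a ∈ (∅ : Finset α), x ∈ D a) * f x) = av f := by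
      congr 1; funext x; rw [ind_true (by simp), one_mul]
    rw [this, ← av_reindex e, av_split, av_comm]
    refine av_le fun y => ?_
    refine le_of_eq_of_le ?_ (hsub (Sum.elim (fun i => Sum.inr i) (fun i => Sum.inl (y i)) ∘ e) ?_)
    · congr 1; funext x; congr 1; funext i
      simp only [Function.comp, ap]
      generalize e i = t
      cases t <;> rfl
    · intro k
      exact ⟨e.symm (Sum.inl k), by simp⟩
  | insert a s has ih =>
    obtain ⟨N1, hN1⟩ := ih
    obtain ⟨N, hN⟩ := single hM a (show 0 < 2 ^ s.card * ε by positivity) N1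
    refine ⟨N, fun ι _ hι f hf hsub D hD => ?_⟩
    have := hN ι hι (fun x => ind (∀ b ∈ s, x ∈ D b) * f x) (fun x => by
      nlinarith [ind_nonneg (∀ b ∈ s, x ∈ D b), ind_le_one (∀ b ∈ s, x ∈ D b), hf x])
      (fun g hg => ?_) (D a) (hD a)
    · rw [Finset.card_insert_of_notMem has, pow_succ]
      refine le_of_eq_of_le ?_ (this.trans (le_of_eq (by ring)))
      congr 1; funext x
      rw [← mul_assoc]
      congr 1
      by_cases h1 : x ∈ D a
      · rw [ind_true h1, one_mul]
        exact ind_congr (by simp [h1])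
      · rw [ind_false h1, zero_mul]
        exact ind_false (by simp [h1])
    · exact hN1 (Fin N1) (by simp) (fun x => f (ap g x)) (fun x => hf _)
        (fun g' hg' => by
          have := hsub _ (hg.comp hg')
          simpa only [ap_comp] using this)
        (fun b => {x | ap g x ∈ D b}) (fun b => (hD b).pull g)

theorem complement {α : Type} [Finite α] [Nonempty α] (hM : Mdhj α) {ε : ℝ}
    (hε : 0 < ε) (M : ℕ) : ∃ N : ℕ, ∀ (ι : Type) [Finite ι], N ≤ Nat.card ι →
      ∀ f : (ι → Option α) → ℝ, (∀ x, f x ≤ 1) →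
      (∀ g : ι → Option α ⊕ Fin M, Pr g → av (fun x => f (ap g x)) ≤ ε) →
      ∀ C : α → Set (ι → Option α), (∀ a, Ins a (C a)) →
      av (fun x => ind (¬ ∀ a, x ∈ C a) * f x) ≤ Nat.card α * (2 ^ Nat.card α * ε) := by
  classical
  have := Fintype.ofFinite α
  obtain ⟨N, hN⟩ := multi hM Finset.univ hε M
  refine ⟨N, fun ι _ hι f hf hsub C hC => ?_⟩
  have key : ∀ s : Finset α, av (fun x => ind (¬ ∀ a ∈ s, x ∈ C a) * f x) ≤
      s.card * (2 ^ Nat.card α * ε) := by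
    intro s
    induction s using Finset.induction_on with
    | empty =>
      have : (fun x : ι → Option α => ind (¬ ∀ a ∈ (∅ : Finset α), x ∈ C a) * f x) =
          fun _ => 0 := by
        funext x; rw [ind_false (by simp), zero_mul]
      rw [this, av_const]; simp
    | insert a s has ih =>
      have h1 := hN ι hι f hf hsub
        (fun b => if b ∈ s then C b else if b = a then (C b)ᶜ else Set.univ) (fun b => by
          split_ifs
          · exact hC b
          · exact (hC b).compl
          · intro _ _ _ _; trivial)
      have h2 : av (fun x => ind (¬ ∀ b ∈ insert a s, x ∈ C b) * f x) =
          av (fun x => ind (¬ ∀ a ∈ s, x ∈ C a) * f x) +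
          av (fun x => ind (∀ b ∈ Finset.univ,
            x ∈ (if b ∈ s then C b else if b = a then (C b)ᶜ else Set.univ)) * f x) := by
        rw [← av_add]
        congr 1; funext x
        rw [← add_mul]
        congr 1
        have h3 : (∀ b ∈ Finset.univ,
            x ∈ (if b ∈ s then C b else if b = a then (C b)ᶜ else Set.univ)) ↔
            (∀ b ∈ s, x ∈ C b) ∧ x ∉ C a := by
          constructor
          · intro h
            refine ⟨fun b hb => ?_, ?_⟩
            · have := h b (Finset.mem_univ b)
              rwa [if_pos hb] at this
            · have := h a (Finset.mem_univ a)
              rwa [if_neg has, if_pos rfl] at this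
          · rintro ⟨h1, h2⟩ b -
            split_ifs with hb hba
            · exact h1 b hb
            · subst hba; exact h2
            · trivial
        rw [ind_congr h3]
        by_cases h4 : ∀ b ∈ s, x ∈ C b
        · rw [ind_false (not_not.2 h4), zero_add]
          refine ind_congr ?_
          simp only [Finset.forall_mem_insert]
          tauto
        · rw [ind_true h4, ind_false (p := _ ∧ _) (fun h => h4 h.1), add_zero]
          refine ind_true ?_
          simp only [Finset.forall_mem_insert]
          tauto
      rw [h2, Finset.card_insert_of_notMem has]
      rw [Finset.card_univ, ← Nat.card_eq_fintype_card] at h1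
      push_cast
      linarith
  have h := key Finset.univ
  rw [Finset.card_univ, ← Nat.card_eq_fintype_card] at h
  simpa using h

end DHJ

namespace DHJ

lemma HasLine.reindex {ι κ β : Type*} {A : Set (ι → β)} (e : ι ≃ κ)
    (h : HasLine {w : κ → β | w ∘ e ∈ A}) : HasLine A := by
  obtain ⟨l, ⟨i, hi⟩, hl⟩ := h
  exact ⟨l ∘ e, ⟨e.symm i, by simp [hi]⟩, fun b => hl b⟩

lemma le_card_mul_av {X : Type*} [Finite X] {f : X → ℝ} (hf : ∀ x, 0 ≤ f x) (x : X) :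
    f x ≤ Nat.card X * av f := by
  have := Fintype.ofFinite X
  rw [Nat.card_eq_fintype_card, ← sum_eq_av]
  exact Finset.single_le_sum (fun i _ => hf i) (Finset.mem_univ x)

/-- The embedding of the letters used for resampling. -/
def emb {α I : Type*} (i0 : I) (b : Option α) : α ⊕ I := b.elim (Sum.inr i0) Sum.inl

lemma emb_injective {α I : Type*} (i0 : I) : Function.Injective (emb (α := α) i0) := by
  intro a b h
  cases a <;> cases b <;> simp_all [emb]

/-- The words over the smaller alphabet. -/
def wd {α I P R : Type*} (x : I → α) (u : P → α ⊕ I) (y : R → Option α) :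
    (I ⊕ P) ⊕ R → Option α :=
  Sum.elim (Sum.elim (fun i => some (x i)) (fun p => some (ap u x p))) y

/-- Selection of a good slice. -/
lemma select {Y : Type*} [Finite Y] [Nonempty Y] {f g : Y → ℝ} {δ η θ : ℝ} (hη : 0 < η)
    (hθ : 0 < θ) (hf : ∀ y, f y ≤ δ + η) (hfa : δ - 2 * η ≤ av f) (hg : ∀ y, g y ≤ 1)
    (hga : θ / 2 ≤ av g) : ∃ y, θ / 4 ≤ g y ∧ δ - 12 * η / θ ≤ f y := by
  have h1 : θ / 2 - 3 * η * (θ / (12 * η)) ≤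
      av (fun y => g y - θ / (12 * η) * ((δ + η) - f y)) := by
    rw [av_sub, av_mul_left, av_sub, av_const]
    have : θ / (12 * η) * (δ + η - av f) ≤ θ / (12 * η) * (3 * η) := by
      gcongr; linarith
    linarith
  have h2 : 3 * η * (θ / (12 * η)) = θ / 4 := by field_simp; norm_num
  obtain ⟨y, hy⟩ := exists_ge h1
  have hpos : 0 < θ / (12 * η) := by positivity
  have h3 : 0 ≤ θ / (12 * η) * (δ + η - f y) := mul_nonneg hpos.le (by linarith [hf y])
  refine ⟨y, by linarith, ?_⟩
  have h4 : θ / (12 * η) * (δ + η - f y) ≤ 1 := by linarith [hg y]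
  have h5 : δ + η - f y ≤ 12 * η / θ := by
    rw [le_div_iff₀ hθ]
    rw [div_mul_eq_mul_div, div_le_one (by positivity)] at h4
    linarith
  linarith

theorem step {α : Type} [Finite α] [Nonempty α] (h : Dhj α) {δ : ℝ} (hδ : 0 < δ)
    (hgood : ∀ ε : ℝ, 0 < ε → Good (Option α) (δ + ε)) :
    ∃ ε : ℝ, 0 < ε ∧ Good (Option α) (δ - ε) := by
  classical
  obtain ⟨n1, hn1⟩ := h (δ / 2 / 2) (by linarith)
  set L : ℕ := Nat.card (Fin n1 → Option α) with hL
  have hLpos : 0 < L := Nat.card_pos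
  set θ : ℝ := δ / 2 / 2 / L with hθdef
  have hθ : 0 < θ := by positivity
  set γ : ℝ := δ * θ / 16 with hγdef
  have hγ : 0 < γ := by positivity
  obtain ⟨M, hM⟩ := hgood γ hγ
  set K : ℝ := Nat.card α * 2 ^ Nat.card α with hK
  have hKpos : 0 < K := by
    have : 0 < Nat.card α := Nat.card_pos
    positivity
  obtain ⟨N2, hN2⟩ := complement h.mdhj (show 0 < γ / K by positivity) M
  set η : ℝ := min (δ * θ ^ 2 / 192) (δ / 4) with hηdef
  have hη : 0 < η := lt_min (by positivity) (by positivity)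
  have hη1 : η ≤ δ * θ ^ 2 / 192 := min_le_left _ _
  have hη2 : η ≤ δ / 4 := min_le_right _ _
  obtain ⟨N3, hN3⟩ := hgood η hη
  choose Nf hNf using fun i0 : Fin n1 =>
    resample (emb_injective (α := α) i0) hθ (max N2 N3)
  set m' : ℕ := ∑ i0, Nf i0 with hm'
  have hNfle : ∀ i0, Nf i0 ≤ m' := fun i0 =>
    Finset.single_le_sum (fun i _ => Nat.zero_le _) (Finset.mem_univ i0)
  set Q : ℕ := Nat.card ((Fin n1 ⊕ Fin m') → Option α) with hQ
  have hQpos : 0 < Q := Nat.card_pos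
  have hQ1 : (1 : ℝ) ≤ Q := by exact_mod_cast hQpos
  set ε : ℝ := η / Q with hεdef
  have hε : 0 < ε := by positivity
  have hQε : Q * ε = η := by rw [hεdef]; field_simp
  obtain ⟨N4, hN4⟩ := hgood ε hε
  refine ⟨ε, hε, (n1 + m') + N4, fun ι _ hι A hA => ?_⟩
  by_contra hno
  obtain ⟨m, hm, ⟨e1⟩⟩ := exists_split ι (n1 + m') (by omega)
  let e0 : ι ≃ (Fin n1 ⊕ Fin m') ⊕ Fin m :=
    e1.trans (Equiv.sumCongr finSumFinEquiv.symm (Equiv.refl _))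
  let A0 : Set ((Fin n1 ⊕ Fin m') ⊕ Fin m → Option α) := {w | w ∘ e0 ∈ A}
  have hno0 : ¬ HasLine A0 := fun hl => hno (hl.reindex e0)
  have hA0 : δ - ε ≤ den A0 := by
    have : den A0 = den A := av_reindex e0 (fun x => ind (x ∈ A))
    rw [this]; exact hA
  let μ : (Fin n1 ⊕ Fin m' → Option α) → ℝ := fun z => av (fun y => ind (Sum.elim z y ∈ A0))
  have hμup : ∀ z, μ z ≤ δ + ε := by
    intro z
    by_contra hcon
    push Not at hcon
    have hl := hN4 (Fin m) (by simp; omega) {y | Sum.elim z y ∈ A0} hcon.le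
    refine hno0 (HasLine.pull (Sum.elim (fun i => Sum.inl (z i)) Sum.inr)
      (fun k => ⟨Sum.inr k, rfl⟩) ?_)
    convert hl using 2
    funext y
    congr 1
    funext i
    cases i <;> rfl
  have hμavg : δ - ε ≤ av μ := by
    unfold den at hA0; rw [av_split] at hA0; exact hA0
  have hμlow : ∀ z, δ - 2 * η ≤ μ z := by
    intro z
    have h1 := le_card_mul_av (f := fun z => (δ + ε) - μ z) (fun z => by linarith [hμup z]) z
    rw [av_sub, av_const, ← hQ] at h1
    have h2 : (Q : ℝ) * (δ + ε - av μ) ≤ Q * (2 * ε) := by gcongr; linarith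
    linarith
  -- many lines
  have hpairs : δ / 2 ≤ av (fun w : (Fin m' → α ⊕ Fin n1) × (Fin m → Option α) =>
      av (fun x : Fin n1 → α => ind (wd x w.1 w.2 ∈ A0))) := by
    have : Nonempty (Fin m' → α ⊕ Fin n1) := ⟨fun _ => Sum.inl (Classical.arbitrary α)⟩
    rw [av_prod]
    refine le_av fun u => ?_
    dsimp only
    rw [av_comm]
    refine le_av fun x => ?_
    have := hμlow (Sum.elim (fun i => some (x i)) (fun p => some (ap u x p)))
    refine le_trans (by linarith) this
  have hNEu : Nonempty (Fin m' → α ⊕ Fin n1) := ⟨fun _ => Sum.inl (Classical.arbitrary α)⟩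
  have hmk := markov (fun w => av_le fun x => ind_le_one _) hpairs (by linarith)
  obtain ⟨l, hl⟩ := pigeon _ (fun (l : Fin n1 → Option α)
    (w : (Fin m' → α ⊕ Fin n1) × (Fin m → Option α)) =>
      (∃ i, l i = none) ∧ ∀ a, wd (fun i => (l i).getD a) w.1 w.2 ∈ A0) (by
        intro w hw
        exact hn1 (Fin n1) (by simp) {x | wd x w.1 w.2 ∈ A0} hw) (by linarith) hmk
  rw [← hL, ← hθdef] at hl
  obtain ⟨i0, hi0⟩ : ∃ i, l i = none := by
    obtain ⟨w, hw⟩ := exists_ge hl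
    by_contra hcon
    rw [ind_false (fun h => hcon h.1)] at hw
    linarith
  let F : (Fin m' → α ⊕ Fin n1) → ℝ := fun u => av (fun y : Fin m → Option α =>
    ind (∀ a, wd (fun i => (l i).getD a) u y ∈ A0))
  have hF : θ ≤ av F := by
    rw [av_prod] at hl
    refine hl.trans (av_mono fun u => av_mono fun y => ind_mono fun hh => hh.2)
  obtain ⟨S, r, hS, -, hav⟩ := hNf i0 (Fin m') (by simpa using hNfle i0) F
    (fun u => av_le fun y => ind_le_one _) hF
  have hemb : ∀ (a : α) (b : Option α),
      Sum.elim id (fun i => (l i).getD a) (emb i0 b) = b.getD a := by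
    intro a b
    cases b <;> simp [emb, hi0]
  let w : (S → Option α) → Fin m' → Option α :=
    fun z p => if h : p ∈ S then z ⟨p, h⟩ else Sum.elim some l (r p)
  have hwz : ∀ (z : S → Option α) (a : α) p,
      ap (fill S (emb i0) r z) (fun i => (l i).getD a) p = (w z p).getD a := by
    intro z a p
    unfold ap fill
    by_cases hp : p ∈ S
    · simp only [dif_pos hp, w]
      exact hemb a _
    · simp only [dif_neg hp, w]
      generalize r p = t
      cases t <;> rfl
  let g : (Fin m → Option α) → (Fin n1 ⊕ Fin m') ⊕ Fin m → Option α ⊕ S := fun y =>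
    Sum.elim (Sum.elim (fun i => Sum.inl (l i))
      (fun p => if h : p ∈ S then Sum.inr ⟨p, h⟩ else Sum.inl (Sum.elim some l (r p))))
      (fun j => Sum.inl (y j))
  have hg : ∀ y, Pr (g y) := fun y k => ⟨Sum.inl (Sum.inr k.1), by simp [g]⟩
  have hgap : ∀ y z, ap (g y) z = Sum.elim (Sum.elim l (w z)) y := by
    intro y z
    funext j
    rcases j with (i | p) | j
    · rfl
    · simp only [ap, g, Sum.elim_inl, Sum.elim_inr, w]
      by_cases hp : p ∈ S
      · simp [dif_pos hp]
      · simp [dif_neg hp]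
    · rfl
  let A' : (Fin m → Option α) → Set (S → Option α) := fun y => {z | ap (g y) z ∈ A0}
  let C : (Fin m → Option α) → α → Set (S → Option α) := fun y a =>
    {z | wd (fun i => (l i).getD a) (fill S (emb i0) r z) y ∈ A0}
  have hC : ∀ y a, Ins a (C y a) := by
    intro y a z z' hz hzC
    change wd (fun i => (l i).getD a) (fill S (emb i0) r z') y ∈ A0
    have : wd (fun i => (l i).getD a) (fill S (emb i0) r z') y =
        wd (fun i => (l i).getD a) (fill S (emb i0) r z) y := by
      unfold wd
      congr 2
      funext p
      rw [hwz, hwz]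
      simp only [w]
      split_ifs with hp
      · rw [hz]
      · rfl
    rw [this]; exact hzC
  have hdisj : ∀ y z, z ∈ A' y → (∀ a, z ∈ C y a) → False := by
    intro y z hz hzC
    refine hno0 ⟨Sum.elim (fun j => (Sum.elim l (w z) j).map some) (fun j => some (y j)),
      ⟨Sum.inl (Sum.inl i0), by simp [hi0]⟩, fun b => ?_⟩
    cases b with
    | none =>
      have h1 : ap (g y) z ∈ A0 := hz
      rw [hgap] at h1
      convert h1 using 1
      funext j
      rcases j with j | j
      · simp only [Sum.elim_inl]
        cases Sum.elim l (w z) j <;> rfl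
      · rfl
    | some a =>
      have h1 : wd (fun i => (l i).getD a) (fill S (emb i0) r z) y ∈ A0 := hzC a
      convert h1 using 1
      funext j
      rcases j with (i | p) | j
      · simp only [Sum.elim_inl, wd]
        cases l i <;> rfl
      · simp only [Sum.elim_inl, Sum.elim_inr, wd, hwz]
        cases w z p <;> rfl
      · rfl
  have hnoA' : ∀ y, ¬ HasLine (A' y) := fun y hl => hno0 (hl.pull (g y) (hg y))
  obtain ⟨y, hy1, hy2⟩ := select (f := fun y => den (A' y))
    (g := fun y => av (fun z => ind (∀ a, z ∈ C y a))) (δ := δ) hη hθ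
    (fun y => by
      by_contra hcon
      push Not at hcon
      exact hnoA' y (hN3 S (le_trans (le_max_right _ _) hS) _ hcon.le))
    (by
      unfold den
      rw [av_comm]
      refine le_av fun z => ?_
      have := hμlow (Sum.elim l (w z))
      refine this.trans (le_of_eq ?_)
      simp only [μ, A']
      congr 1
      funext y
      refine ind_congr ?_
      change _ ↔ ap (g y) z ∈ A0
      rw [hgap])
    (fun y => av_le fun z => ind_le_one _)
    (by
      rw [av_comm]
      exact hav)
  have hfin := hN2 S (le_trans (le_max_left _ _) hS) (fun z => ind (z ∈ A' y) - (δ + γ))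
    (fun z => by linarith [ind_le_one (z ∈ A' y)])
    (fun g' hg' => by
      rw [av_sub, av_const]
      have : av (fun x => ind (ap g' x ∈ A' y)) ≤ δ + γ := by
        by_contra hcon
        push Not at hcon
        exact hnoA' y (HasLine.pull g' hg' (hM (Fin M) (by simp) {x | ap g' x ∈ A' y} hcon.le))
      have : 0 < γ / K := by positivity
      linarith) (C y) (hC y)
  have heq : av (fun z => ind (¬ ∀ a, z ∈ C y a) * (ind (z ∈ A' y) - (δ + γ))) =
      den (A' y) - (δ + γ) * (1 - av (fun z => ind (∀ a, z ∈ C y a))) := by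
    unfold den
    rw [← av_const (X := S → Option α) 1, ← av_sub, ← av_mul_left, ← av_sub]
    congr 1
    funext z
    by_cases hz : ∀ a, z ∈ C y a
    · rw [ind_false (not_not.2 hz), ind_true hz, ind_false (fun hzA => hdisj y z hzA hz)]
      ring
    · rw [ind_true hz, ind_false hz]
      ring
  rw [heq] at hfin
  have hKK : (Nat.card α : ℝ) * (2 ^ Nat.card α * (γ / K)) = γ := by
    rw [← mul_assoc, ← hK]; field_simp
  rw [hKK] at hfin
  have h12 : 12 * η / θ ≤ δ * θ / 16 := by
    rw [div_le_iff₀ hθ]; nlinarith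
  have hmul : (δ + γ) * (θ / 4) ≤ (δ + γ) * av (fun z => ind (∀ a, z ∈ C y a)) := by
    gcongr
  have : 0 < γ * θ := by positivity
  have : 0 < δ * θ := by positivity
  nlinarith

theorem dhj_option {α : Type} [Finite α] [Nonempty α] (h : Dhj α) : Dhj (Option α) := by
  by_contra hcon
  simp only [Dhj, not_forall] at hcon
  obtain ⟨δ0, hδ0, hbad⟩ := hcon
  have hmono : ∀ {a b : ℝ}, a ≤ b → Good (Option α) a → Good (Option α) b := by
    rintro a b hab ⟨N, hN⟩
    exact ⟨N, fun ι _ hι A hA => hN ι hι A (hab.trans hA)⟩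
  let G : Set ℝ := {δ | Good (Option α) δ}
  have hlow : ∀ x ∈ G, δ0 ≤ x := by
    intro x hx
    by_contra hlt
    push Not at hlt
    exact hbad (hmono hlt.le hx)
  have h2 : (2 : ℝ) ∈ G := ⟨0, fun ι _ _ A hA => by
    have := den_le_one A
    linarith⟩
  have hδ : δ0 ≤ sInf G := le_csInf ⟨2, h2⟩ hlow
  obtain ⟨ε, hε, hg⟩ := step h (δ := sInf G) (by linarith) (fun ε hε => by
    obtain ⟨x, hx, hlt⟩ := exists_lt_of_csInf_lt ⟨2, h2⟩ (show sInf G < sInf G + ε by linarith)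
    exact hmono hlt.le hx)
  have : sInf G ≤ sInf G - ε := csInf_le ⟨δ0, hlow⟩ hg
  linarith

theorem Dhj.congr {α β : Type} [Finite α] [Finite β] (e : α ≃ β) (h : Dhj α) : Dhj β := by
  intro δ hδ
  obtain ⟨N, hN⟩ := h δ hδ
  refine ⟨N, fun ι _ hι A hA => ?_⟩
  have hA' : δ ≤ den {x : ι → α | (fun i => e (x i)) ∈ A} := by
    refine hA.trans (le_of_eq ?_)
    exact (av_equiv (Equiv.arrowCongr (Equiv.refl ι) e) (fun x => ind (x ∈ A))).symm
  obtain ⟨l, ⟨i, hi⟩, hl⟩ := hN ι hι _ hA'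
  refine ⟨fun i => (l i).map e, ⟨i, by simp [hi]⟩, fun b => ?_⟩
  have := hl (e.symm b)
  change (fun i => e ((l i).getD (e.symm b))) ∈ A at this
  convert this using 2 with i
  change ((l i).map e).getD b = _
  generalize l i = t
  cases t <;> simp

theorem dhj_fin (k : ℕ) : Dhj (Fin (k + 1)) := by
  induction k with
  | zero =>
    intro δ hδ
    refine ⟨1, fun ι _ hι A hA => ?_⟩
    obtain ⟨x, hx⟩ := exists_ge hA
    have hxA : x ∈ A := by
      by_contra hn
      rw [ind_false hn] at hx
      linarith
    have : Nonempty ι := (Nat.card_pos_iff.1 (by omega)).1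
    refine ⟨fun _ => none, ⟨Classical.arbitrary ι, rfl⟩, fun b => ?_⟩
    convert hxA using 1
    funext i
    exact Subsingleton.elim (α := Fin 1) _ _
  | succ k ih =>
    exact Dhj.congr (finSuccEquiv (k + 1)).symm (dhj_option ih)

end DHJ

namespace DHJ
open Finset
open scoped Pointwise

/-- The conclusion of the almost-period lemma. -/
def AlmP (K t σ : ℝ) (A : Finset ℝ) : Prop :=
  ∃ X S : Finset ℝ, (∃ a, ∀ x ∈ A, x + a ∈ X) ∧ (#X : ℝ) ≤ K * #A ∧ σ * (#A : ℝ) ≤ #S ∧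
    ∀ d ∈ S, t * (#(X.filter (fun x => x - d ∉ X)) : ℝ) ≤ #X

lemma sanders_aux (K t : ℝ) (hK : 0 < K) (ht : 1 ≤ t) (j : ℕ) : ∃ s σ : ℝ, 0 < s ∧ 0 < σ ∧
    ∀ A : Finset ℝ, A.Nonempty → (#(A + A) : ℝ) ≤ K * #A → (#(A - A) : ℝ) ≤ K * #A →
    AlmP K t σ A ∨ ∃ B ⊆ A, B.Nonempty ∧ s * (#A : ℝ) ≤ #B ∧
      (#(B + A) : ℝ) ≤ (1 - 1 / t) ^ j * (K * #A) := by
  induction j with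
  | zero =>
    refine ⟨1, 1, one_pos, one_pos, fun A hA h1 h2 => Or.inr ⟨A, Subset.rfl, hA, by simp, by simpa using h1⟩⟩
  | succ j ih =>
    obtain ⟨s, σ, hs, hσ, H⟩ := ih
    refine ⟨s ^ 2 / (2 * K), min σ (s ^ 2 / 2), by positivity, by positivity, fun A hA h1 h2 => ?_⟩
    have hn0 : (0 : ℝ) < #A := by exact_mod_cast hA.card_pos
    rcases H A hA h1 h2 with h | ⟨B, hBA, hB, hsB, hBX⟩
    · left
      obtain ⟨X, S, h3, h4, h5, h6⟩ := h
      refine ⟨X, S, h3, h4, le_trans ?_ h5, h6⟩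
      gcongr
      exact min_le_left _ _
    set X := B + A with hX
    set s' : ℝ := s ^ 2 / (2 * K) with hs'
    let C : ℝ → Finset ℝ := fun d => B.filter (fun x => x - d ∈ B)
    let S : Finset ℝ := (A - A).filter (fun d => s' * (#A : ℝ) ≤ #(C d))
    have hXK : (#X : ℝ) ≤ K * #A :=
      le_trans (by exact_mod_cast card_le_card (add_subset_add_right hBA)) h1
    have hcount : (#B : ℝ) ^ 2 = ∑ d ∈ A - A, (#(C d) : ℝ) := by
      have e1 : #(B ×ˢ B) = ∑ d ∈ A - A, #((B ×ˢ B).filter (fun p => p.1 - p.2 = d)) := by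
        refine card_eq_sum_card_fiberwise ?_
        intro p hp
        have hp := mem_product.1 (mem_coe.1 hp)
        exact mem_coe.2 (sub_mem_sub (hBA hp.1) (hBA hp.2))
      have e2 : ∀ d, #((B ×ˢ B).filter (fun p => p.1 - p.2 = d)) = #(C d) := by
        intro d
        refine card_bij' (fun p _ => p.1) (fun x _ => (x, x - d)) ?_ ?_ ?_ ?_
        · rintro ⟨x, y⟩ hp
          simp only [mem_filter, mem_product] at hp
          obtain ⟨⟨hx, hy⟩, rfl⟩ := hp
          simp only [C, mem_filter]
          exact ⟨hx, by simpa using hy⟩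
        · intro x hx
          simp only [C, mem_filter] at hx
          simp [hx.1, hx.2]
        · rintro ⟨x, y⟩ hp
          simp only [mem_filter, mem_product] at hp
          obtain ⟨⟨hx, hy⟩, rfl⟩ := hp
          simp
        · intro x hx
          rfl
      simp only [e2, card_product] at e1
      rw [sq]
      exact_mod_cast e1
    have hS : s ^ 2 / 2 * (#A : ℝ) ≤ #S := by
      have e1 : ∑ d ∈ A - A, (#(C d) : ℝ) ≤
          ∑ d ∈ A - A, (s' * (#A : ℝ) + if s' * (#A : ℝ) ≤ #(C d) then (#A : ℝ) else 0) := by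
        refine sum_le_sum fun d _ => ?_
        split_ifs with h
        · have : (#(C d) : ℝ) ≤ #A := by
            exact_mod_cast card_le_card ((filter_subset _ _).trans hBA)
          have : 0 ≤ s' * (#A : ℝ) := by positivity
          linarith
        · push Not at h; linarith
      rw [sum_add_distrib, ← sum_filter, sum_const, sum_const, nsmul_eq_mul, nsmul_eq_mul,
        ← hcount] at e1
      change _ ≤ _ + (#S : ℝ) * _ at e1
      have e2 : (s * (#A : ℝ)) ^ 2 ≤ (#B : ℝ) ^ 2 := by gcongr
      have e3 : (#(A - A) : ℝ) * (s' * #A) ≤ (K * #A) * (s' * #A) := by gcongr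
      have e4 : (K * #A) * (s' * (#A : ℝ)) = s ^ 2 / 2 * (#A : ℝ) ^ 2 := by
        rw [hs']; field_simp
      have e5 : s ^ 2 / 2 * (#A : ℝ) * #A ≤ #S * #A := by nlinarith
      exact le_of_mul_le_mul_right e5 hn0
    by_cases hall : ∀ d ∈ S, t * (#(X.filter (fun x => x - d ∉ X)) : ℝ) ≤ #X
    · left
      obtain ⟨b, hb⟩ := hB
      refine ⟨X, S, ⟨b, fun x hx => ?_⟩, hXK, le_trans ?_ hS, hall⟩
      · rw [add_comm]; exact add_mem_add hb hx
      · gcongr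
        exact min_le_right _ _
    · right
      push Not at hall
      obtain ⟨d, hd, hbad⟩ := hall
      have hd2 := (mem_filter.1 hd).2
      have hCpos : (0 : ℝ) < #(C d) := lt_of_lt_of_le (by positivity) hd2
      refine ⟨C d, (filter_subset _ _).trans hBA, card_pos.1 (by exact_mod_cast hCpos), hd2, ?_⟩
      have e1 : C d + A ⊆ X.filter (fun x => x - d ∈ X) := by
        intro y hy
        obtain ⟨x, hx, a, ha, rfl⟩ := mem_add.1 hy
        have hx := mem_filter.1 hx
        refine mem_filter.2 ⟨add_mem_add hx.1 ha, ?_⟩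
        have : x + a - d = (x - d) + a := by ring
        rw [this]
        exact add_mem_add hx.2 ha
      have e2 : (#(C d + A) : ℝ) ≤ #(X.filter (fun x => x - d ∈ X)) := by
        exact_mod_cast card_le_card e1
      have e3 : (#(X.filter (fun x => x - d ∈ X)) : ℝ) + #(X.filter (fun x => x - d ∉ X)) = #X := by
        exact_mod_cast card_filter_add_card_filter_not (s := X) (fun x => x - d ∈ X)
      have e4 : (#X : ℝ) / t ≤ #(X.filter (fun x => x - d ∉ X)) := by
        rw [div_le_iff₀ (by linarith)]; linarith
      have e5 : 0 ≤ 1 - 1 / t := by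
        rw [sub_nonneg, div_le_one (by linarith)]; exact ht
      calc (#(C d + A) : ℝ) ≤ (1 - 1 / t) * #X := by
            have : (1 - 1 / t) * (#X : ℝ) = #X - #X / t := by ring
            linarith
        _ ≤ (1 - 1 / t) * ((1 - 1 / t) ^ j * (K * #A)) := by gcongr
        _ = _ := by ring

theorem sanders (K t : ℝ) (hK : 0 < K) (ht : 1 ≤ t) : ∃ σ : ℝ, 0 < σ ∧
    ∀ A : Finset ℝ, A.Nonempty → (#(A + A) : ℝ) ≤ K * #A → (#(A - A) : ℝ) ≤ K * #A →
    AlmP K t σ A := by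
  have e5 : 0 ≤ 1 - 1 / t := by
    rw [sub_nonneg, div_le_one (by linarith)]; exact ht
  have e6 : 1 - 1 / t < 1 := by
    have : 0 < 1 / t := by positivity
    linarith
  obtain ⟨j, hj⟩ := exists_pow_lt_of_lt_one (show 0 < 1 / K by positivity) e6
  obtain ⟨s, σ, hs, hσ, H⟩ := sanders_aux K t hK ht j
  refine ⟨σ, hσ, fun A hA h1 h2 => ?_⟩
  rcases H A hA h1 h2 with h | ⟨B, hBA, hB, hsB, hBX⟩
  · exact h
  · exfalso
    have hn0 : (0 : ℝ) < #A := by exact_mod_cast hA.card_pos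
    have e1 : (#A : ℝ) ≤ #(B + A) := by exact_mod_cast card_le_card_add_left hB
    have e2 : (1 - 1 / t) ^ j * (K * #A) < 1 / K * (K * #A) := by gcongr
    have e3 : 1 / K * (K * #A) = (#A : ℝ) := by field_simp
    linarith

end DHJ

namespace DHJ
open Finset
open scoped Pointwise

set_option maxHeartbeats 1000000 in
/-- A Balog-Szemeredi-Gowers statement for midpoints. -/
theorem bsg {c : ℝ} (hc : 0 < c) : ∃ c2 K : ℝ, 0 < c2 ∧ 0 < K ∧ ∀ A : Finset ℝ, A.Nonempty →
    c * (#A : ℝ) ^ 2 ≤ (#((A ×ˢ A).filter (fun p => (p.1 + p.2) / 2 ∈ A)) : ℝ) →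
    ∃ A' ⊆ A, A'.Nonempty ∧ c2 * (#A : ℝ) ≤ #A' ∧ (#(A' - A') : ℝ) ≤ K * #A' := by
  classical
  set τ : ℝ := c ^ 2 / 16 with hτ
  have hτ0 : 0 < τ := by positivity
  refine ⟨c / 4, 16 / (c ^ 2 * τ ^ 2), by positivity, by positivity, fun A hA hG => ?_⟩
  set n : ℝ := (#A : ℝ) with hn
  have hn0 : 0 < n := by rw [hn]; exact_mod_cast hA.card_pos
  let Nb : ℝ → Finset ℝ := fun b => A.filter (fun a => (a + b) / 2 ∈ A)
  let cd : ℝ → ℝ → Finset ℝ := fun a a' => A.filter (fun b => (a + b) / 2 ∈ A ∧ (a' + b) / 2 ∈ A)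
  let bad : ℝ → ℝ → Prop := fun a a' => (#(cd a a') : ℝ) < τ * n
  have h1 : c * n ^ 2 ≤ ∑ b ∈ A, (#(Nb b) : ℝ) := by
    refine hG.trans (le_of_eq ?_)
    rw [card_filter, sum_product_right]
    push_cast
    refine sum_congr rfl fun b _ => ?_
    simp [Nb]
  have h2 : (c * n ^ 2) ^ 2 ≤ n * ∑ b ∈ A, (#(Nb b) : ℝ) ^ 2 := by
    refine le_trans ?_ sq_sum_le_card_mul_sum_sq
    gcongr
  have h3 : ∑ b ∈ A, (#(((Nb b) ×ˢ (Nb b)).filter (fun p => bad p.1 p.2)) : ℝ) ≤ n ^ 2 * (τ * n) := by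
    have : ∑ b ∈ A, (#(((Nb b) ×ˢ (Nb b)).filter (fun p => bad p.1 p.2)) : ℝ) =
        ∑ p ∈ (A ×ˢ A).filter (fun p => bad p.1 p.2), (#(cd p.1 p.2) : ℝ) := by
      have e1 : ∀ b, (#(((Nb b) ×ˢ (Nb b)).filter (fun p => bad p.1 p.2)) : ℝ) =
          ∑ p ∈ (A ×ˢ A).filter (fun p => bad p.1 p.2),
            if ((p.1 + b) / 2 ∈ A ∧ (p.2 + b) / 2 ∈ A) then (1 : ℝ) else 0 := by
        intro b
        rw [← sum_filter, sum_const, nsmul_eq_mul, mul_one, filter_filter]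
        congr 2
        ext p
        simp only [Nb, mem_filter, mem_product]
        tauto
      simp only [e1]
      rw [sum_comm]
      refine sum_congr rfl fun p _ => ?_
      simp [cd]
    rw [this]
    calc _ ≤ ∑ p ∈ (A ×ˢ A).filter (fun p => bad p.1 p.2), τ * n := by
          refine sum_le_sum fun p hp => ?_
          exact (mem_filter.1 hp).2.le
      _ ≤ ∑ p ∈ (A ×ˢ A), τ * n :=
          sum_le_sum_of_subset_of_nonneg (filter_subset _ _) (fun _ _ _ => by positivity)
      _ = n ^ 2 * (τ * n) := by
          rw [sum_const, card_product, nsmul_eq_mul]; push_cast; ring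
  obtain ⟨b0, hb0, hb⟩ : ∃ b ∈ A, c ^ 2 / 2 * n ^ 2 ≤ (#(Nb b) : ℝ) ^ 2 -
      8 * (#(((Nb b) ×ˢ (Nb b)).filter (fun p => bad p.1 p.2)) : ℝ) := by
    by_contra! hcon
    have := sum_lt_sum_of_nonempty hA hcon
    rw [sum_sub_distrib, ← mul_sum, sum_const, nsmul_eq_mul, ← hn] at this
    have h4 : c ^ 2 * n ^ 3 ≤ ∑ b ∈ A, (#(Nb b) : ℝ) ^ 2 := by
      have : n * (c ^ 2 * n ^ 3) ≤ n * ∑ b ∈ A, (#(Nb b) : ℝ) ^ 2 := by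
        refine le_trans (le_of_eq (by ring)) h2
      exact le_of_mul_le_mul_left this hn0
    have h5 : n ^ 2 * (τ * n) = c ^ 2 * n ^ 3 / 16 := by rw [hτ]; ring
    nlinarith
  set A1 := Nb b0 with hA1
  set m : ℝ := (#A1 : ℝ) with hm
  have hbadnn : (0 : ℝ) ≤ (#((A1 ×ˢ A1).filter (fun p => bad p.1 p.2)) : ℝ) := by positivity
  have hm1 : c / 2 * n ≤ m := by
    have : (c / 2 * n) ^ 2 ≤ m ^ 2 := by nlinarith [mul_pos (pow_pos hc 2) (pow_pos hn0 2)]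
    exact le_of_sq_le_sq this (by positivity)
  have hm0 : 0 < m := by have : 0 < c / 2 * n := by positivity
                         linarith
  have hbad : (#((A1 ×ˢ A1).filter (fun p => bad p.1 p.2)) : ℝ) ≤ m ^ 2 / 8 := by
    have : 0 < c ^ 2 / 2 * n ^ 2 := by positivity
    linarith
  let bd : ℝ → Finset ℝ := fun a => A1.filter (fun a' => bad a a')
  let A2 : Finset ℝ := A1.filter (fun a => (#(bd a) : ℝ) ≤ m / 4)
  have hA2m : m / 2 ≤ (#A2 : ℝ) := by
    have e1 : (#((A1 ×ˢ A1).filter (fun p => bad p.1 p.2)) : ℝ) = ∑ a ∈ A1, (#(bd a) : ℝ) := by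
      rw [card_filter, sum_product]
      push_cast
      refine sum_congr rfl fun a _ => ?_
      simp [bd]
    have e2 : ∑ a ∈ A1, (m / 4 - if (#(bd a) : ℝ) ≤ m / 4 then m / 4 else 0) ≤
        ∑ a ∈ A1, (#(bd a) : ℝ) := by
      refine sum_le_sum fun a _ => ?_
      split_ifs with h
      · simp
      · push Not at h; linarith
    rw [sum_sub_distrib, ← sum_filter, sum_const, sum_const, nsmul_eq_mul, nsmul_eq_mul, ← hm,
      ← e1] at e2
    have e3 : m * (m / 2) ≤ m * (#A2 : ℝ) := by
      change m * (m / 4) - (#A2 : ℝ) * (m / 4) ≤ _ at e2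
      nlinarith
    exact le_of_mul_le_mul_left e3 hm0
  have hA2sub : A2 ⊆ A1 := filter_subset _ _
  have hA1sub : A1 ⊆ A := filter_subset _ _
  have hA2pos : (0 : ℝ) < #A2 := by linarith
  refine ⟨A2, hA2sub.trans hA1sub, card_pos.1 (by exact_mod_cast hA2pos), by linarith, ?_⟩
  -- counting
  let Q4 : Finset ((ℝ × ℝ) × (ℝ × ℝ)) := (A ×ˢ A) ×ˢ (A ×ˢ A)
  let val : (ℝ × ℝ) × (ℝ × ℝ) → ℝ := fun q => 2 * (q.1.1 - q.1.2 + q.2.1 - q.2.2)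
  have hfib : ∀ v ∈ A2 - A2, m / 2 * (τ * n) ^ 2 ≤ (#(Q4.filter (fun q => val q = v)) : ℝ) := by
    intro v hv
    obtain ⟨a, ha, a', ha', rfl⟩ := mem_sub.1 hv
    let gd : Finset ℝ := A1.filter (fun x => ¬ bad a x ∧ ¬ bad a' x)
    have hgd : m / 2 ≤ (#gd : ℝ) := by
      have e1 : A1 ⊆ gd ∪ (bd a ∪ bd a') := by
        intro x hx
        simp only [gd, bd, mem_union, mem_filter]
        tauto
      have e2 : (#A1 : ℝ) ≤ #gd + (#(bd a) + #(bd a')) := by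
        exact_mod_cast (card_le_card e1).trans ((card_union_le _ _).trans
          (Nat.add_le_add_left (card_union_le _ _) _))
      have e3 := (mem_filter.1 ha).2
      have e4 := (mem_filter.1 ha').2
      linarith
    let Tr : Finset (Σ _ : ℝ, ℝ × ℝ) := gd.sigma (fun x => cd a x ×ˢ cd a' x)
    have hTr : m / 2 * (τ * n) ^ 2 ≤ (#Tr : ℝ) := by
      rw [card_sigma]
      push_cast
      calc m / 2 * (τ * n) ^ 2 ≤ (#gd : ℝ) * (τ * n) ^ 2 := by gcongr
        _ = ∑ x ∈ gd, (τ * n) ^ 2 := by rw [sum_const, nsmul_eq_mul]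
        _ ≤ _ := by
          refine sum_le_sum fun x hx => ?_
          have := (mem_filter.1 hx).2
          simp only [bad, not_lt] at this
          rw [card_product, sq]
          push_cast
          exact mul_le_mul this.1 this.2 (by positivity) (by positivity)
    refine hTr.trans ?_
    refine Nat.cast_le.2 (card_le_card_of_injOn
      (fun w => (((a + w.2.1) / 2, (w.1 + w.2.1) / 2), ((w.1 + w.2.2) / 2, (a' + w.2.2) / 2)))
      ?_ ?_)
    · rintro ⟨x, b, b'⟩ hw
      simp only [Tr, coe_sigma, Set.mem_sigma_iff, mem_coe, mem_product, cd, mem_filter] at hw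
      simp only [coe_filter, Q4, mem_product, Set.mem_ofPred_eq, val]
      refine ⟨⟨⟨?_, ?_⟩, ?_, ?_⟩, ?_⟩
      · exact hw.2.1.2.1
      · exact hw.2.1.2.2
      · exact hw.2.2.2.2
      · exact hw.2.2.2.1
      · ring
    · rintro ⟨x, b, b'⟩ _ ⟨y, d, d'⟩ _ h
      simp only [Prod.mk.injEq] at h
      obtain ⟨⟨h1, h2⟩, h3, h4⟩ := h
      have hb : b = d := by linarith
      have hb' : b' = d' := by linarith
      have hx : x = y := by linarith
      subst hb hb' hx
      rfl
  have hsum : (#(A2 - A2) : ℝ) * (m / 2 * (τ * n) ^ 2) ≤ n ^ 4 := by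
    calc (#(A2 - A2) : ℝ) * (m / 2 * (τ * n) ^ 2) = ∑ v ∈ A2 - A2, m / 2 * (τ * n) ^ 2 := by
          rw [sum_const, nsmul_eq_mul]
      _ ≤ ∑ v ∈ A2 - A2, (#(Q4.filter (fun q => val q = v)) : ℝ) := sum_le_sum hfib
      _ = (#(Q4.filter (fun q => val q ∈ A2 - A2)) : ℝ) := by
          rw [card_eq_sum_card_fiberwise (f := val) (t := A2 - A2)]
          · push_cast
            refine sum_congr rfl fun v hv => ?_
            congr 2
            rw [filter_filter]
            ext q
            simp only [mem_filter]
            constructor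
            · rintro ⟨h1, rfl⟩; exact ⟨h1, hv, rfl⟩
            · rintro ⟨h1, _, h2⟩; exact ⟨h1, h2⟩
          · intro q hq
            exact (mem_filter.1 hq).2
      _ ≤ (#Q4 : ℝ) := by exact_mod_cast card_le_card (filter_subset _ _)
      _ = n ^ 4 := by
          simp only [Q4, card_product]; push_cast; ring
  have hAA : (#A2 : ℝ) ≤ m := by
    rw [hm]; exact_mod_cast card_le_card hA2sub
  have hfinal : (#(A2 - A2) : ℝ) * (m * τ ^ 2) ≤ 2 * n ^ 2 := by
    have : (#(A2 - A2) : ℝ) * (m * τ ^ 2) * (n ^ 2 / 2) ≤ 2 * n ^ 2 * (n ^ 2 / 2) := by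
      refine le_trans (le_of_eq ?_) (hsum.trans (le_of_eq ?_)) <;> ring
    exact le_of_mul_le_mul_right this (by positivity)
  rw [div_mul_eq_mul_div, le_div_iff₀ (by positivity)]
  have h7 : (#(A2 - A2) : ℝ) * (m * τ ^ 2) * c ^ 2 ≤ 2 * n ^ 2 * c ^ 2 := by gcongr
  have h8 : 2 * n ^ 2 * c ^ 2 ≤ 8 * m ^ 2 := by
    have e1 : (c / 2 * n) ^ 2 ≤ m ^ 2 := by gcongr
    have e2 : (c / 2 * n) ^ 2 = n ^ 2 * c ^ 2 / 4 := by ring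
    rw [e2] at e1
    linarith
  have h9 : (#(A2 - A2) : ℝ) * (c ^ 2 * τ ^ 2) * m ≤ 16 * (#A2 : ℝ) * m := by
    have e1 : (#(A2 - A2) : ℝ) * (c ^ 2 * τ ^ 2) * m = (#(A2 - A2) : ℝ) * (m * τ ^ 2) * c ^ 2 := by
      ring
    have e2 : m / 2 * m ≤ (#A2 : ℝ) * m := mul_le_mul_of_nonneg_right hA2m hm0.le
    rw [e1]
    linarith [e2, h7, h8, sq m]
  exact le_of_mul_le_mul_right h9 hm0

end DHJ

namespace DHJ
open Finset
open scoped Pointwise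

/-- Number of points of `X` whose translate by `-v` leaves `X`. -/
noncomputable def bd (X : Finset ℝ) (v : ℝ) : ℝ := (#(X.filter (fun x => x - v ∉ X)) : ℝ)

lemma bd_nonneg (X : Finset ℝ) (v : ℝ) : 0 ≤ bd X v := by unfold bd; positivity

lemma bd_zero (X : Finset ℝ) : bd X 0 = 0 := by
  simp [bd]

lemma bd_add (X : Finset ℝ) (u v : ℝ) : bd X (u + v) ≤ bd X u + bd X v := by
  have e1 : X.filter (fun x => x - (u + v) ∉ X) ⊆
      X.filter (fun x => x - u ∉ X) ∪ (X.filter (fun x => x - v ∉ X)).image (fun x => x + u) := by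
    intro x hx
    have hx := mem_filter.1 hx
    by_cases h : x - u ∈ X
    · refine mem_union_right _ (mem_image.2 ⟨x - u, mem_filter.2 ⟨h, ?_⟩, by ring⟩)
      rw [sub_sub]; exact hx.2
    · exact mem_union_left _ (mem_filter.2 ⟨hx.1, h⟩)
  unfold bd
  exact_mod_cast (card_le_card e1).trans ((card_union_le _ _).trans
    (Nat.add_le_add_left card_image_le _))

lemma bd_nsmul (X : Finset ℝ) (v : ℝ) (m : ℕ) : bd X (m * v) ≤ m * bd X v := by
  induction m with
  | zero => simp [bd_zero]
  | succ m ih =>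
    have : ((m + 1 : ℕ) : ℝ) * v = m * v + v := by push_cast; ring
    rw [this]
    refine (bd_add _ _ _).trans ?_
    push_cast
    linarith

lemma bd_sum (X : Finset ℝ) {ι : Type*} (s : Finset ι) (f : ι → ℝ) :
    bd X (∑ i ∈ s, f i) ≤ ∑ i ∈ s, bd X (f i) :=
  le_sum_of_subadditive (bd X) (bd_zero X).le (bd_add X) s f

lemma bd_lower (X E : Finset ℝ) (hE : E ⊆ X) (v : ℝ) :
    (#E : ℝ) - bd X v ≤ (#(X.filter (fun x => x + v ∈ E)) : ℝ) := by
  have e1 : E ⊆ (X.filter (fun x => x + v ∈ E)).image (fun x => x + v) ∪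
      X.filter (fun x => x - v ∉ X) := by
    intro x hx
    by_cases h : x - v ∈ X
    · exact mem_union_left _ (mem_image.2 ⟨x - v, mem_filter.2 ⟨h, by simpa using hx⟩, by ring⟩)
    · exact mem_union_right _ (mem_filter.2 ⟨hE hx, h⟩)
  have e2 : (#E : ℝ) ≤ #(X.filter (fun x => x + v ∈ E)) + bd X v := by
    unfold bd
    exact_mod_cast (card_le_card e1).trans ((card_union_le _ _).trans
      (Nat.add_le_add_right card_image_le _))
  linarith

lemma av_subtype (X : Finset ℝ) (p : ℝ → Prop) [DecidablePred p] :
    av (fun x : X => ind (p x)) = (#(X.filter p) : ℝ) / #X := by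
  classical
  rw [av_def, Fintype.card_coe]
  congr 1
  rw [sum_coe_sort X (fun x => ind (p x)), card_filter]
  push_cast
  refine sum_congr rfl fun x _ => ?_
  unfold ind
  congr

lemma card_subtype_av {Y : Type*} [Fintype Y] (p : Y → Prop) [Fintype {y // p y}] :
    (Fintype.card Y : ℝ) * av (fun y => ind (p y)) = (Fintype.card {y // p y} : ℝ) := by
  classical
  rw [← sum_eq_av, Fintype.card_subtype, card_filter]
  push_cast
  refine sum_congr rfl fun x _ => ?_
  unfold ind
  congr

set_option maxHeartbeats 1000000 in
theorem ap_count (k : ℕ) (hk : 1 ≤ k) (K : ℝ) (hK : 1 ≤ K) : ∃ c' : ℝ, 0 < c' ∧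
    ∀ A : Finset ℝ, A.Nonempty → (#(A + A) : ℝ) ≤ K * #A → (#(A - A) : ℝ) ≤ K * #A →
    ∃ T : Finset (ℝ × ℝ), c' * (#A : ℝ) ^ 2 ≤ #T ∧
      ∀ q ∈ T, ∀ i : ℕ, i ≤ k → q.1 + (i : ℝ) * q.2 ∈ A := by
  classical
  have hK0 : 0 < K := by linarith
  set δ0 : ℝ := 1 / (2 * K) with hδ0
  have hδpos : 0 < δ0 := by positivity
  obtain ⟨N, hN⟩ := dhj_fin k (δ0 / 2) (by positivity)
  set n := N + 1 with hn
  set t : ℝ := 2 * K * n * k + 1 with ht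
  have ht1 : 1 ≤ t := by
    have : 0 ≤ 2 * K * n * k := by positivity
    linarith
  obtain ⟨σ, hσ, H⟩ := sanders K t hK0 ht1
  set c1 : ℝ := δ0 / 2 / (Nat.card (Fin n → Option (Fin (k + 1))) : ℝ) with hc1
  have hc1pos : 0 < c1 := by
    have : 0 < Nat.card (Fin n → Option (Fin (k + 1))) := Nat.card_pos
    have : (0 : ℝ) < Nat.card (Fin n → Option (Fin (k + 1))) := by exact_mod_cast this
    positivity
  refine ⟨c1 * σ, by positivity, fun A hA h1 h2 => ?_⟩
  obtain ⟨X, S, ⟨a, ha⟩, hXK, hS, hbd⟩ := H A hA h1 h2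
  have hn0 : (0 : ℝ) < #A := by exact_mod_cast hA.card_pos
  have hSpos : (0 : ℝ) < #S := lt_of_lt_of_le (by positivity) hS
  have hSne : S.Nonempty := card_pos.1 (by exact_mod_cast hSpos)
  have hXne : X.Nonempty := by
    obtain ⟨x, hx⟩ := hA
    exact ⟨_, ha x hx⟩
  have hXpos : (0 : ℝ) < #X := by exact_mod_cast hXne.card_pos
  set E : Finset ℝ := A.image (fun x => x + a) with hE
  have hEX : E ⊆ X := by
    intro y hy
    obtain ⟨x, hx, rfl⟩ := mem_image.1 hy
    exact ha x hx
  have hEc : #E = #A := card_image_of_injective _ (add_left_injective a)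
  have hAX : (#A : ℝ) ≤ #X := by
    rw [← hEc]; exact_mod_cast card_le_card hEX
  have : Nonempty X := hXne.to_subtype
  have : Nonempty S := hSne.to_subtype
  let vv : (Fin n → S) → (Fin n → Fin (k + 1)) → ℝ := fun d w => ∑ i, ((w i : ℕ) : ℝ) * (d i : ℝ)
  have hvv : ∀ d w, bd X (vv d w) ≤ #X / (2 * K) := by
    intro d w
    have e1 : bd X (vv d w) ≤ ∑ i : Fin n, (k : ℝ) * (#X / t) := by
      refine (bd_sum X _ _).trans (sum_le_sum fun i _ => ?_)
      refine (bd_nsmul X _ _).trans ?_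
      have e2 : bd X (d i) ≤ #X / t := by
        rw [le_div_iff₀ (by linarith), mul_comm]
        exact hbd _ (d i).2
      have e3 : ((w i : ℕ) : ℝ) ≤ k := by exact_mod_cast Nat.lt_succ_iff.1 (w i).2
      exact mul_le_mul e3 e2 (bd_nonneg _ _) (by positivity)
    refine e1.trans ?_
    rw [sum_const, card_univ, Fintype.card_fin, nsmul_eq_mul, le_div_iff₀ (by positivity)]
    have e4 : (n : ℝ) * (k * (#X / t)) * (2 * K) = (t - 1) / t * #X := by
      rw [ht]; field_simp; ring
    rw [e4]
    have e5 : (t - 1) / t ≤ 1 := by rw [div_le_one (by linarith)]; linarith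
    nlinarith
  let W : X × (Fin n → S) → Set (Fin n → Fin (k + 1)) := fun y => {w | (y.1 : ℝ) + vv y.2 w ∈ E}
  have hav : δ0 ≤ av (fun y => den (W y)) := by
    unfold den
    rw [av_comm]
    refine le_av fun w => ?_
    rw [av_prod, av_comm]
    refine le_av fun d => ?_
    change δ0 ≤ av (fun x : X => ind ((x : ℝ) + vv d w ∈ E))
    rw [av_subtype X (fun x => x + vv d w ∈ E), le_div_iff₀ hXpos]
    refine le_trans ?_ (bd_lower X E hEX _)
    have e1 := hvv d w
    rw [hEc]
    have e2 : (#X : ℝ) / K ≤ #A := by rw [div_le_iff₀ hK0]; linarith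
    have e3 : δ0 * (#X : ℝ) = #X / K - #X / (2 * K) := by rw [hδ0]; field_simp; ring
    linarith
  have hmk := markov (fun y => den_le_one (W y)) hav hδpos.le
  let q : (Fin n → Option (Fin (k + 1))) → X × (Fin n → S) → Prop := fun l y =>
    (∃ i, l i = none) ∧ ∀ b, (fun i => (l i).getD b) ∈ W y
  obtain ⟨l, hl⟩ := pigeon (fun y => δ0 / 2 ≤ den (W y)) q (fun y hy => by
    obtain ⟨l, h3, h4⟩ := hN (Fin n) (by simp [hn]) (W y) hy
    exact ⟨l, h3, h4⟩) (by positivity) hmk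
  rw [← hc1] at hl
  obtain ⟨y0, hy0⟩ := exists_ge hl
  obtain ⟨i0, hi0⟩ : ∃ i, l i = none := by
    by_contra hcon
    have : ¬ q l y0 := fun h => hcon h.1
    rw [ind_false this] at hy0
    linarith
  let Pf : (Fin n → S) → ℝ := fun d => ∑ i, (l i).elim 0 (fun b => ((b : ℕ) : ℝ)) * (d i : ℝ)
  let Qf : (Fin n → S) → ℝ := fun d => ∑ i, (l i).elim 1 (fun _ => 0) * (d i : ℝ)
  have hPQ : ∀ d b, vv d (fun i => (l i).getD b) = Pf d + ((b : ℕ) : ℝ) * Qf d := by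
    intro d b
    simp only [vv, Pf, Qf]
    rw [mul_sum, ← sum_add_distrib]
    refine sum_congr rfl fun i _ => ?_
    cases l i <;> simp
  let F : X × (Fin n → S) → ℝ × ℝ := fun y => ((y.1 : ℝ) + Pf y.2 - a, Qf y.2)
  let T : Finset (ℝ × ℝ) := (univ.filter (fun y => q l y)).image F
  refine ⟨T, ?_, ?_⟩
  · let G : {y // q l y} → T × ({i : Fin n // i ≠ i0} → S) := fun y =>
      (⟨F y.1, mem_image_of_mem _ (mem_filter.2 ⟨mem_univ _, y.2⟩)⟩, fun i => y.1.2 i.1)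
    have hG : Function.Injective G := by
      rintro ⟨⟨x, d⟩, hy⟩ ⟨⟨x', d'⟩, hy'⟩ h
      simp only [G, F, Prod.mk.injEq, Subtype.mk.injEq] at h
      obtain ⟨⟨h3, h4⟩, h5⟩ := h
      have h6 : ∀ i, i ≠ i0 → d i = d' i := fun i hi => congrFun h5 ⟨i, hi⟩
      have h7 : d i0 = d' i0 := by
        have e1 : ∀ d : Fin n → S, Qf d = (d i0 : ℝ) +
            ∑ i ∈ univ.erase i0, (l i).elim 1 (fun _ => 0) * (d i : ℝ) := by
          intro d
          simp only [Qf]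
          rw [← add_sum_erase univ _ (mem_univ i0), hi0]
          simp
        rw [e1, e1] at h4
        have e2 : ∑ i ∈ univ.erase i0, (l i).elim (1 : ℝ) (fun _ => 0) * (d i : ℝ) =
            ∑ i ∈ univ.erase i0, (l i).elim (1 : ℝ) (fun _ => 0) * (d' i : ℝ) :=
          sum_congr rfl fun i hi => by rw [h6 i (ne_of_mem_erase hi)]
        rw [e2] at h4
        exact Subtype.ext (add_right_cancel h4)
      have h8 : d = d' := by
        funext i
        by_cases hi : i = i0
        · rw [hi]; exact h7
        · exact h6 i hi
      subst h8
      have h9 : x = x' := Subtype.ext (by linarith)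
      subst h9
      rfl
    have hcard := Fintype.card_le_of_injective G hG
    rw [Fintype.card_prod, Fintype.card_fun, Fintype.card_coe, Fintype.card_coe,
      Fintype.card_subtype_compl, Fintype.card_fin, Fintype.card_subtype_eq] at hcard
    have hcard2 : (Fintype.card {y // q l y} : ℝ) ≤ #T * (#S : ℝ) ^ N := by
      have : n - 1 = N := by simp [hn]
      rw [this] at hcard
      exact_mod_cast hcard
    rw [← card_subtype_av (fun y => q l y), Fintype.card_prod, Fintype.card_fun, Fintype.card_coe, Fintype.card_coe,
      Fintype.card_fin] at hcard2
    push_cast at hcard2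
    have hpw : (0 : ℝ) < (#S : ℝ) ^ N := by positivity
    have e1 : (#X : ℝ) * (#S : ℝ) ^ n * c1 ≤ #T * (#S : ℝ) ^ N :=
      le_trans (by gcongr) hcard2
    have e2 : (#X : ℝ) * #S * c1 ≤ #T := by
      have : (#X : ℝ) * #S * c1 * (#S : ℝ) ^ N ≤ #T * (#S : ℝ) ^ N := by
        refine le_trans (le_of_eq ?_) e1
        rw [hn, pow_succ]; ring
      exact le_of_mul_le_mul_right this hpw
    refine le_trans ?_ e2
    have e3 : (#A : ℝ) * (σ * #A) ≤ #X * #S := mul_le_mul hAX hS (by positivity) (by positivity)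
    calc c1 * σ * (#A : ℝ) ^ 2 = (#A : ℝ) * (σ * #A) * c1 := by ring
      _ ≤ _ := by gcongr
  · intro p hp i hi
    obtain ⟨y, hy, rfl⟩ := mem_image.1 hp
    have hy := (mem_filter.1 hy).2.2 ⟨i, Nat.lt_succ_of_le hi⟩
    change (y.1 : ℝ) + vv y.2 _ ∈ E at hy
    rw [hPQ] at hy
    obtain ⟨z, hz, hz2⟩ := mem_image.1 hy
    have : (F y).1 + (i : ℝ) * (F y).2 = z := by
      simp only [F]
      simp only at hz2
      linarith
    rw [this]; exact hz

end DHJ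

open Finset Pointwise in
/-- Main theorem. For every `c > 0` and every integer `k ≥ 3` there are a threshold `n₀`
and a constant `δ′ > 0` depending only on `c` and `k` such that: if `A` is a finite set of
reals with `|A| ≥ n₀` containing at least `c·|A|²` `k`-term arithmetic progressions (pairs
`(x, d)` with `d ≠ 0` and `x + i·d ∈ A` for all `0 ≤ i ≤ k − 1`), then `A` contains at least
`δ′·|A|²` `(k+1)`-term arithmetic progressions. -/
theorem DHJ.main (c : ℝ) (hc : 0 < c) (k : ℕ) (hk : 3 ≤ k) :
    ∃ (n₀ : ℕ) (δ' : ℝ), 0 < δ' ∧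
      ∀ A : Finset ℝ,
        n₀ ≤ A.card →
        c * (A.card : ℝ) ^ 2 ≤
          ({q : ℝ × ℝ | q.2 ≠ 0 ∧ ∀ i : ℕ, i ≤ k - 1 → q.1 + (i : ℝ) * q.2 ∈ A}.ncard : ℝ) →
        δ' * (A.card : ℝ) ^ 2 ≤
          ({q : ℝ × ℝ | q.2 ≠ 0 ∧ ∀ i : ℕ, i ≤ k → q.1 + (i : ℝ) * q.2 ∈ A}.ncard : ℝ) := by
  classical
  obtain ⟨c2, K, hc2, hK, H⟩ := DHJ.bsg hc
  set K' : ℝ := max 1 (max K (K ^ 2)) with hK'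
  have hK1 : 1 ≤ K' := le_max_left _ _
  have hK2 : K ≤ K' := (le_max_left _ _).trans (le_max_right _ _)
  have hK3 : K ^ 2 ≤ K' := (le_max_right _ _).trans (le_max_right _ _)
  obtain ⟨c', hc', H2⟩ := DHJ.ap_count k (by omega) K' hK1
  have hβ : 0 < c' * c2 ^ 2 := by positivity
  refine ⟨⌈2 / (c' * c2 ^ 2)⌉₊ + 1, c' * c2 ^ 2 / 2, by positivity, fun A hA0 hA => ?_⟩
  have hAne : A.Nonempty := card_pos.1 (by omega)
  have hn0 : (0 : ℝ) < #A := by exact_mod_cast hAne.card_pos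
  have hAbig : 2 / (c' * c2 ^ 2) ≤ (#A : ℝ) := by
    refine (Nat.le_ceil _).trans ?_
    exact_mod_cast (by omega : ⌈2 / (c' * c2 ^ 2)⌉₊ ≤ #A)
  have hbs : c * (#A : ℝ) ^ 2 ≤ (#((A ×ˢ A).filter (fun p => (p.1 + p.2) / 2 ∈ A)) : ℝ) := by
    refine hA.trans ?_
    rw [← Set.ncard_coe_finset]
    refine Nat.cast_le.2 (Set.ncard_le_ncard_of_injOn (fun q => (q.1, q.1 + 2 * q.2)) ?_ ?_
      (Finset.finite_toSet _))
    · rintro ⟨x, d⟩ ⟨-, h⟩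
      have h0 := h 0 (by omega)
      have h1 := h 1 (by omega)
      have h2 := h 2 (by omega)
      simp only [Nat.cast_zero, Nat.cast_one, Nat.cast_ofNat, zero_mul, add_zero, one_mul] at h0 h1 h2
      refine mem_coe.2 (mem_filter.2 ⟨mem_product.2 ⟨h0, h2⟩, ?_⟩)
      have : (x + (x + 2 * d)) / 2 = x + d := by ring
      simpa [this] using h1
    · rintro ⟨x, d⟩ _ ⟨x', d'⟩ _ h
      simp only [Prod.mk.injEq] at h ⊢
      exact ⟨h.1, by linarith [h.1, h.2]⟩
  obtain ⟨A', hsub, hne, hcard, hdiff⟩ := H A hAne hbs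
  have hA'0 : (0 : ℝ) < #A' := by exact_mod_cast hne.card_pos
  have hsum : (#(A' + A') : ℝ) ≤ K ^ 2 * #A' := by
    have e1 : (#(A' + A') : ℝ) * #A' ≤ #(A' - A') * #(A' - A') := by
      exact_mod_cast ruzsa_triangle_inequality_add_sub_sub A' A' A'
    have e2 : (#(A' - A') : ℝ) * #(A' - A') ≤ (K * #A') * (K * #A') := by gcongr
    have e3 : (#(A' + A') : ℝ) * #A' ≤ K ^ 2 * #A' * #A' := by
      refine (e1.trans e2).trans (le_of_eq (by ring))
    exact le_of_mul_le_mul_right e3 hA'0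
  obtain ⟨T, hT, hTA⟩ := H2 A' hne (hsum.trans (by gcongr)) (hdiff.trans (by gcongr))
  have hfin : {q : ℝ × ℝ | q.2 ≠ 0 ∧ ∀ i : ℕ, i ≤ k → q.1 + (i : ℝ) * q.2 ∈ A}.Finite := by
    refine (Finset.finite_toSet (A ×ˢ (A - A))).subset ?_
    rintro ⟨x, d⟩ ⟨-, h⟩
    have h0 := h 0 (by omega)
    have h1 := h 1 (by omega)
    simp only [Nat.cast_zero, Nat.cast_one, zero_mul, add_zero, one_mul] at h0 h1
    refine mem_coe.2 (mem_product.2 ⟨h0, mem_sub.2 ⟨_, h1, _, h0, by ring⟩⟩)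
  have e1 : #(T.filter (fun q => q.2 = 0)) ≤ #A := by
    refine card_le_card_of_injOn (fun q => q.1) ?_ ?_
    · intro q hq
      have h := hTA q (mem_filter.1 hq).1 0 (by omega)
      simp only [Nat.cast_zero, zero_mul, add_zero] at h
      exact mem_coe.2 (hsub h)
    · rintro ⟨x, d⟩ hq ⟨x', d'⟩ hq' h
      have h1 := (mem_filter.1 hq).2
      have h2 := (mem_filter.1 hq').2
      simp only at h h1 h2
      rw [h, h1, h2]
  have e2 : #(T.filter (fun q => ¬ q.2 = 0)) ≤
      {q : ℝ × ℝ | q.2 ≠ 0 ∧ ∀ i : ℕ, i ≤ k → q.1 + (i : ℝ) * q.2 ∈ A}.ncard := by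
    rw [← Set.ncard_coe_finset]
    refine Set.ncard_le_ncard ?_ hfin
    intro q hq
    have hq := mem_filter.1 (mem_coe.1 hq)
    exact ⟨hq.2, fun i hi => hsub (hTA q hq.1 i hi)⟩
  have e3 := card_filter_add_card_filter_not (s := T) (fun q => q.2 = 0)
  have e4 : (#T : ℝ) ≤ #A +
      ({q : ℝ × ℝ | q.2 ≠ 0 ∧ ∀ i : ℕ, i ≤ k → q.1 + (i : ℝ) * q.2 ∈ A}.ncard : ℝ) := by
    rw [← e3]; push_cast
    exact add_le_add (by exact_mod_cast e1) (by exact_mod_cast e2)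
  have e5 : c' * (c2 * (#A : ℝ)) ^ 2 ≤ c' * (#A' : ℝ) ^ 2 := by gcongr
  have e6 : (#A : ℝ) ≤ c' * c2 ^ 2 / 2 * (#A : ℝ) ^ 2 := by
    rw [div_le_iff₀ hβ] at hAbig
    nlinarith
  have e7 : c' * (c2 * (#A : ℝ)) ^ 2 = c' * c2 ^ 2 / 2 * (#A : ℝ) ^ 2 +
    c' * c2 ^ 2 / 2 * (#A : ℝ) ^ 2 := by ring
  linarith


/-- For every `c > 0` and every integer `k ≥ 3` there are a threshold `n₀`
and a constant `δ′ > 0` depending only on `c` and `k` such that: if `A` is a finite set of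
reals with `|A| ≥ n₀` containing at least `c·|A|²` `k`-term arithmetic progressions (pairs
`(x, d)` with `d ≠ 0` and `x + i·d ∈ A` for all `0 ≤ i ≤ k − 1`), then `A` contains at least
`δ′·|A|²` `(k+1)`-term arithmetic progressions. -/
theorem stmt_7 (c : ℝ) (hc : 0 < c) (k : ℕ) (hk : 3 ≤ k) :
    ∃ (n₀ : ℕ) (δ' : ℝ), 0 < δ' ∧
      ∀ A : Finset ℝ,
        n₀ ≤ A.card →
        c * (A.card : ℝ) ^ 2 ≤
          ({q : ℝ × ℝ | q.2 ≠ 0 ∧ ∀ i : ℕ, i ≤ k - 1 → q.1 + (i : ℝ) * q.2 ∈ A}.ncard : ℝ) →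
        δ' * (A.card : ℝ) ^ 2 ≤
          ({q : ℝ × ℝ | q.2 ≠ 0 ∧ ∀ i : ℕ, i ≤ k → q.1 + (i : ℝ) * q.2 ∈ A}.ncard : ℝ) := by
  exact DHJ.main c hc k hk
end
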